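/- If S̃_{p₀,…,p_m}^{q₁,…,q_m} and S̃_{r₀,…,r_n}^{s₁,…,s_n} are two admissible sawtooth moves on the same negative edge, i.e. p₀p_m = r₀r_n = e, then the composition S̃_{r₀,…,r_n}^{s₁,…,s_n} ∘ (S̃_{p₀,…,p_m}^{q₁,…,q_m})⁻¹ factorizes into admissible R̃ moves and admissible W̃ moves and their inverses. -/

import Mathlib

open Set

noncomputable section

/-- Points of `ℝ³`, written `(x, y, z)`. -/
abbrev R3 := ℝ × ℝ × ℝ

/-- The involution of `ℝ³` given by the π-rotation around the y-axis. -/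
def tau : R3 → R3 := fun p => (-p.1, p.2.1, -p.2.2)

/-- The fixed-point axis `𝐚` of `tau` (the y-axis). -/
def axisA : Set R3 := {p | p.1 = 0 ∧ p.2.2 = 0}

/-- The braid axis `𝐛` (the z-axis). -/
def axisB : Set R3 := {p | p.1 = 0 ∧ p.2.1 = 0}

/-- Orthogonal projection to the (x,y)-plane (the plane of link diagrams). -/
def proj (p : R3) : ℝ × ℝ := (p.1, p.2.1)

/-- Planar cross product, used to detect the sense of rotation around the origin. -/
def cross2 (u v : ℝ × ℝ) : ℝ := u.1 * v.2 - u.2 * v.1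

/-- An oriented edge is positive if its projection runs counterclockwise around the origin. -/
def PosEdge (e : R3 × R3) : Prop := 0 < cross2 (proj e.1) (proj e.2)

/-- An oriented edge is negative if its projection runs clockwise around the origin. -/
def NegEdge (e : R3 × R3) : Prop := cross2 (proj e.1) (proj e.2) < 0

/-- The (possibly degenerate) triangle with vertices `a`, `b`, `c`. -/
def tri (a b c : R3) : Set R3 := convexHull ℝ ({a, b, c} : Set R3)

/-- A polygonal link, presented by its finite list of oriented edges. -/
abbrev PolyLink := List (R3 × R3)

/-- The underlying subset of `ℝ³` of a polygonal link. -/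
def carrier (L : PolyLink) : Set R3 := ⋃ e ∈ L, segment ℝ e.1 e.2

/-- The edge list describes an embedded disjoint union of polygonal circles. -/
def IsLink (L : PolyLink) : Prop :=
  L.Nodup ∧ (∀ e ∈ L, e.1 ≠ e.2) ∧
  (∀ e ∈ L, ∀ f ∈ L, e ≠ f →
    segment ℝ e.1 e.2 ∩ segment ℝ f.1 f.2 ⊆ ({e.1, e.2} : Set R3) ∩ ({f.1, f.2} : Set R3)) ∧
  (∀ e ∈ L, ∃! f, f ∈ L ∧ f.1 = e.2) ∧
  (∀ e ∈ L, ∃! f, f ∈ L ∧ f.2 = e.1)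

/-- `L` is preserved setwise by `tau`, with the orientation reversed. -/
def StronglyInvolutive (L : PolyLink) : Prop := ∀ e ∈ L, (tau e.2, tau e.1) ∈ L

/-- The standing assumption on diagrams: no edge projects into a line through the origin,
and the projection has only double points. -/
def GoodDiagram (L : PolyLink) : Prop :=
  (∀ e ∈ L, cross2 (proj e.1) (proj e.2) ≠ 0) ∧
  (∀ p : ℝ × ℝ, ({x ∈ carrier L | proj x = p}).ncard ≤ 2)

open scoped Classical in
/-- The complexity `h(L)`: the number of negative edges of `L`. -/
def hNeg (L : PolyLink) : ℕ := L.countP fun e => decide (NegEdge e)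

/-! ### The elementary moves -/

/-- The result of the triangle move `E_{a,c}^b`: the edge `(a,c)` is replaced by
`(a,b)` and `(b,c)`. -/
def applyE (a c b : R3) (L : PolyLink) : PolyLink := L.erase (a, c) ++ [(a, b), (b, c)]

/-- The move `E_{a,c}^b` is defined: `a, c` are consecutive vertices and the result is a link. -/
def MoveEOk (a c b : R3) (L : PolyLink) : Prop := (a, c) ∈ L ∧ IsLink (applyE a c b L)

/-- Admissibility of `E_{a,c}^b` (not through `∞`): `[a,b,c] ∩ L = [a,c]`. -/
def AdmE (a c b : R3) (L : PolyLink) : Prop :=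
  MoveEOk a c b L ∧ tri a b c ∩ carrier L = segment ℝ a c

/-- Admissibility of an `E` move going through `∞`: the plane through `a`, `b`, `c` meets
`L ∖ [a,c]` only inside the interior of the triangle `[a,b,c]`. -/
def AdmEInf (a c b : R3) (L : PolyLink) : Prop :=
  MoveEOk a c b L ∧ ¬ Collinear ℝ ({a, b, c} : Set R3) ∧ b ∉ carrier L ∧
  (affineSpan ℝ ({a, b, c} : Set R3) : Set R3) ∩ (carrier L \ segment ℝ a c)
    ⊆ intrinsicInterior ℝ (tri a b c)

/-- The equivariant triangle move `Ẽ_{a,c}^b = E_{τ(a),τ(c)}^{τ(b)} ∘ E_{a,c}^b`. -/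
def applyEtil (a c b : R3) (L : PolyLink) : PolyLink :=
  applyE (tau c) (tau a) (tau b) (applyE a c b L)

/-- Admissibility of the equivariant triangle move `Ẽ_{a,c}^b`. -/
def AdmEtil (a c b : R3) (L : PolyLink) : Prop :=
  AdmE a c b L ∧ AdmE (tau c) (tau a) (tau b) (applyE a c b L)

/-- The quadrilateral `Q` with vertices `a`, `b`, `c`, `τ(a)` of a `D` move. -/
def quadD (a c b : R3) : Set R3 := convexHull ℝ ({a, b, c, tau a} : Set R3)

/-- The τ-symmetric quadrilateral move `D_{a,c}^b`, replacing `[a,c] ∪ [c,τ(a)]` by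
`[a,b] ∪ [b,τ(a)]`, where `b` lies on the axis `𝐚`. -/
def applyD (a c b : R3) (L : PolyLink) : PolyLink :=
  ((L.erase (a, c)).erase (c, tau a)) ++ [(a, b), (b, tau a)]

/-- The move `D_{a,c}^b` is defined. -/
def MoveDOk (a c b : R3) (L : PolyLink) : Prop :=
  (a, c) ∈ L ∧ (c, tau a) ∈ L ∧ b ∈ axisA ∧ Coplanar ℝ ({a, b, c, tau a} : Set R3) ∧
  IsLink (applyD a c b L)

/-- Admissibility of `D_{a,c}^b` (not through `∞`): `Q ∩ L = [a,c] ∪ [c,τ(a)]`. -/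
def AdmD (a c b : R3) (L : PolyLink) : Prop :=
  MoveDOk a c b L ∧ quadD a c b ∩ carrier L = segment ℝ a c ∪ segment ℝ c (tau a)

/-- Admissibility of a `D` move going through `∞`: the closure of `(α ∖ Q) ∩ L` equals
`[a,c] ∪ [c,τ(a)]`, where `α` is the plane of `Q`. -/
def AdmDInf (a c b : R3) (L : PolyLink) : Prop :=
  MoveDOk a c b L ∧
  closure (((affineSpan ℝ ({a, b, c, tau a} : Set R3) : Set R3) \ quadD a c b) ∩ carrier L)
    = segment ℝ a c ∪ segment ℝ c (tau a)

/-! ### `R`-type moves (all involved edges positive) -/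

/-- An `R̃` move: an admissible `Ẽ_{a,c}^b` whose edges `ab`, `ac`, `cb` are all positive. -/
def AdmRtil (a c b : R3) (L : PolyLink) : Prop :=
  AdmEtil a c b L ∧ PosEdge (a, b) ∧ PosEdge (a, c) ∧ PosEdge (c, b)

/-- An `R` move: an admissible `D_{a,c}^b` (not through `∞`) with `ac`, `ab` positive. -/
def AdmR (a c b : R3) (L : PolyLink) : Prop :=
  AdmD a c b L ∧ PosEdge (a, c) ∧ PosEdge (a, b)

/-! ### `W`-type moves -/

/-- The move `W̃_{a,d}^{b,c} = Ẽ_{b,d}^c ∘ Ẽ_{a,d}^b`. -/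
def applyWtil (a d b c : R3) (L : PolyLink) : PolyLink := applyEtil b d c (applyEtil a d b L)

/-- Admissibility of `W̃_{a,d}^{b,c}`. -/
def AdmWtil (a d b c : R3) (L : PolyLink) : Prop :=
  PosEdge (a, b) ∧ PosEdge (b, c) ∧ PosEdge (c, d) ∧ PosEdge (a, d) ∧ PosEdge (d, b) ∧
  AdmEtil a d b L ∧ AdmEtil b d c (applyEtil a d b L)

/-- The move `W_{a,d}^{b,c} = D_{b,d}^c ∘ Ẽ_{a,d}^b` (with `c = τ(c)`, `d = τ(d)`). -/
def applyW (a d b c : R3) (L : PolyLink) : PolyLink := applyD b d c (applyEtil a d b L)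

/-- Admissibility of `W_{a,d}^{b,c}` not going through `∞`. -/
def AdmW (a d b c : R3) (L : PolyLink) : Prop :=
  c = tau c ∧ d = tau d ∧
  PosEdge (a, b) ∧ PosEdge (d, b) ∧ PosEdge (c, a) ∧ PosEdge (b, c) ∧
  AdmEtil a d b L ∧ AdmD b d c (applyEtil a d b L)

/-- Admissibility of `W_{a,d}^{b,c}` going through `∞`. -/
def AdmWInf (a d b c : R3) (L : PolyLink) : Prop :=
  c = tau c ∧ d = tau d ∧
  PosEdge (a, b) ∧ PosEdge (d, b) ∧ PosEdge (c, a) ∧ PosEdge (b, c) ∧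
  AdmEtil a d b L ∧ AdmDInf b d c (applyEtil a d b L)

/-- The support of `W̃_{a,d}^{b,c}`. -/
def suppWtil (a d b c : R3) : Set R3 := convexHull ℝ ({a, b, c, d} : Set R3)

/-- The support of a `W` move not going through `∞`. -/
def suppW (a d b c : R3) : Set R3 := convexHull ℝ ({a, b, c, tau a, tau b} : Set R3)

/-- The hexagon `[a,c,τ(a),b,τ(b),d]`. -/
def hexW (a d b c : R3) : Set R3 := convexHull ℝ ({a, c, tau a, b, tau b, d} : Set R3)

/-- The support of a `W` move going through `∞`. -/
def suppWInf (a d b c : R3) : Set R3 := closure ((hexW a d b c)ᶜ)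

/-- An empty `W̃` move: admissible, its support meets `L` only in `[a,d]`, and meets `𝐚`
at most in an endpoint of `[a,d]` lying on `𝐚`. -/
def EmptyWtil (a d b c : R3) (L : PolyLink) : Prop :=
  AdmWtil a d b c L ∧
  suppWtil a d b c ∩ carrier L = segment ℝ a d ∧
  (suppWtil a d b c ∩ axisA = ∅ ∨
    (a ∈ axisA ∧ suppWtil a d b c ∩ axisA = {a}) ∨
    (d ∈ axisA ∧ suppWtil a d b c ∩ axisA = {d}))

/-- An empty `W` move (not through `∞`): admissible and its support meets `L` only in
the two consumed edges. -/
def EmptyW (a d b c : R3) (L : PolyLink) : Prop :=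
  AdmW a d b c L ∧ suppW a d b c ∩ carrier L = segment ℝ a d ∪ segment ℝ d (tau a)

/-- An empty `W` move through `∞`. -/
def EmptyWInf (a d b c : R3) (L : PolyLink) : Prop :=
  AdmWInf a d b c L ∧ suppWInf a d b c ∩ carrier L = segment ℝ a d ∪ segment ℝ d (tau a)

/-- A really empty `W̃` move. -/
def ReallyEmptyWtil (a d b c : R3) (L : PolyLink) : Prop :=
  EmptyWtil a d b c L ∧
  proj '' suppWtil a d b c ∩ proj '' carrier L = proj '' segment ℝ a d ∧
  (suppWtil a d b c ∩ axisA = ∅ ∨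
    (a ∈ axisA ∧ suppWtil a d b c ∩ axisA = {a}) ∨
    (d ∈ axisA ∧ suppWtil a d b c ∩ axisA = {d}))

/-- A really empty `W` move not going through `∞`. -/
def ReallyEmptyW (a d b c : R3) (L : PolyLink) : Prop :=
  EmptyW a d b c L ∧
  proj '' hexW a d b c ∩ proj '' carrier L
    = proj '' segment ℝ a d ∪ proj '' segment ℝ d (tau a)

/-- The quadrilateral with vertices `b`, `c`, `d`, `τ(b)`. -/
def quadInf (a d b c : R3) : Set R3 := convexHull ℝ ({b, c, d, tau b} : Set R3)

/-- A really empty `W` move going through `∞`. -/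
def ReallyEmptyWInf (a d b c : R3) (L : PolyLink) : Prop :=
  EmptyWInf a d b c L ∧
  proj '' (carrier L \ (segment ℝ a d ∪ tau '' segment ℝ a d)) ∩ proj '' tri a b d = ∅ ∧
  proj '' carrier L ⊆ proj '' quadInf a d b c

/-- A `W̃` move is of crossing type if the projections of `[a,b]` and `[d,c]` cross. -/
def CrossingType (a d b c : R3) : Prop :=
  (proj '' openSegment ℝ a b ∩ proj '' openSegment ℝ d c).Nonempty

/-- A `W` move is of type A if `π(b)` and `π(c)` lie on the same side of the projection of
the line through `a` and `τ(a)` (and `c ∉ [a,b,τ(a),τ(b)]`). -/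
def TypeA (a d b c : R3) : Prop :=
  c ∉ convexHull ℝ ({a, b, tau a, tau b} : Set R3) ∧
  0 < (b.2.1 - a.2.1) * (c.2.1 - a.2.1)

/-- A `W` move is of type B if `π(b)` and `π(c)` lie on opposite sides of the projection of
the line through `a` and `τ(a)` (and `c ∉ [a,b,τ(a),τ(b)]`). -/
def TypeB (a d b c : R3) : Prop :=
  c ∉ convexHull ℝ ({a, b, tau a, tau b} : Set R3) ∧
  (b.2.1 - a.2.1) * (c.2.1 - a.2.1) < 0

/-! ### Sawtooth moves -/

/-- The data of a sawtooth move `S̃_{p₀,…,p_m}^{q₁,…,q_m}`. -/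
structure Sawtooth where
  m : ℕ
  p : Fin (m + 1) → R3
  q : Fin m → R3

/-- The edge `e = p₀ p_m` on which the sawtooth move is performed. -/
def Sawtooth.e (S : Sawtooth) : R3 × R3 := (S.p 0, S.p (Fin.last S.m))

/-- The `i`-th tooth `[pᵢ, pᵢ₊₁, qᵢ₊₁]` of a sawtooth move. -/
def Sawtooth.tooth (S : Sawtooth) (i : Fin S.m) : Set R3 :=
  tri (S.p i.castSucc) (S.p i.succ) (S.q i)

/-- Subdivide the edge `e = p₀p_m` (and its mirror image) at the points `pᵢ` (resp. `τ(pᵢ)`);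
this adds the `pᵢ` to the vertices of `L`. -/
def subdivide (m : ℕ) (p : Fin (m + 1) → R3) (L : PolyLink) : PolyLink :=
  ((L.erase (p 0, p (Fin.last m))).erase (tau (p (Fin.last m)), tau (p 0)))
    ++ ((List.finRange m).map fun i => (p i.castSucc, p i.succ))
    ++ ((List.finRange m).map fun i => (tau (p i.succ), tau (p i.castSucc)))

/-- Apply a sequence of `Ẽ` moves. -/
def applyEtilSeq : List (R3 × R3 × R3) → PolyLink → PolyLink
  | [], L => L
  | (a, c, b) :: t, L => applyEtilSeq t (applyEtil a c b L)

/-- Each `Ẽ` move of a sequence is admissible on the link it is applied to. -/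
def AdmEtilSeq : List (R3 × R3 × R3) → PolyLink → Prop
  | [], _ => True
  | (a, c, b) :: t, L => AdmEtil a c b L ∧ AdmEtilSeq t (applyEtil a c b L)

/-- The list of `Ẽ` moves constituting a sawtooth move. -/
def Sawtooth.data (S : Sawtooth) : List (R3 × R3 × R3) :=
  (List.finRange S.m).map fun i => (S.p i.castSucc, S.p i.succ, S.q i)

/-- The result of a sawtooth move: `Ẽ_{p_{m-1},p_m}^{q_m} ∘ ⋯ ∘ Ẽ_{p₀,p₁}^{q₁}` after
subdividing the edge `e`. -/
def Sawtooth.apply (S : Sawtooth) (L : PolyLink) : PolyLink :=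
  applyEtilSeq S.data (subdivide S.m S.p L)

/-- Admissibility of a sawtooth move on `L`. -/
def Sawtooth.Adm (S : Sawtooth) (L : PolyLink) : Prop :=
  0 < S.m ∧
  S.e ∈ L ∧
  NegEdge S.e ∧
  (∀ i : Fin (S.m + 1), i ≠ 0 → i ≠ Fin.last S.m →
    S.p i ∈ openSegment ℝ (S.p 0) (S.p (Fin.last S.m))) ∧
  (∀ i : Fin S.m, NegEdge (S.p i.castSucc, S.p i.succ)) ∧
  (∀ i : Fin S.m, S.q i ∉ segment ℝ (S.p 0) (S.p (Fin.last S.m))) ∧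
  (∀ i : Fin S.m, PosEdge (S.p i.castSucc, S.q i) ∧ PosEdge (S.q i, S.p i.succ)) ∧
  AdmEtilSeq S.data (subdivide S.m S.p L) ∧
  (∀ i j : Fin S.m, i ≠ j → S.tooth i ∩ tau '' S.tooth j = ∅)

/-! ### `S³` and equivariant isotopy -/

/-- `S³` as the one-point compactification of `ℝ³`. -/
abbrev S3 := OnePoint R3

/-- The inclusion `ℝ³ ⊆ S³`. -/
def embS3 : R3 → S3 := OnePoint.some

/-- The extension of `tau` to `S³`, fixing `∞`. -/
def tauS3 : S3 → S3 := OnePoint.map tau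

/-- The braid axis `𝐛 = (z-axis) ∪ {∞}` inside `S³`. -/
def axisBS3 : Set S3 := embS3 '' axisB ∪ {OnePoint.infty}

/-- Two subsets of `ℝ³` are equivariantly isotopic: there is an ambient isotopy of `S³`
commuting with `τ` at every time and carrying the first onto the second. -/
def EquivIsotopicSets (A B : Set R3) : Prop :=
  ∃ H : ℝ → S3 ≃ₜ S3,
    Continuous (fun q : ℝ × S3 => H q.1 q.2) ∧
    H 0 = Homeomorph.refl S3 ∧
    (∀ t, ∀ x : S3, H t (tauS3 x) = tauS3 (H t x)) ∧
    H 1 '' (embS3 '' A) = embS3 '' B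


/-- The involution `ρ` of `I × D²`: `(x,(y,z)) ↦ (1-x,(y,-z))`. -/
def rho : R3 → R3 := fun p => (1 - p.1, p.2.1, -p.2.2)

/-- Membership in the disk `D²`. -/
def inDisk (u : ℝ × ℝ) : Prop := u.1 ^ 2 + u.2 ^ 2 ≤ 1

/-- The solid cylinder `I × D² ⊆ ℝ³`. -/
def Cyl : Set R3 := {p | p.1 ∈ Icc (0:ℝ) 1 ∧ inDisk (p.2.1, p.2.2)}

/-- The base points `p₁, …, p_m` on the horizontal diameter of `D²`. -/
def basePt (m : ℕ) (i : Fin m) : ℝ := -1 + 2 * ((i : ℕ) + 1) / (m + 1)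

/-- A function `ℝ → ℝ²` is a PL path: affine on each interval of a finite subdivision
of `[0,1]`. -/
def IsPLPath (f : ℝ → ℝ × ℝ) : Prop :=
  ∃ (k : ℕ) (t : Fin (k + 1) → ℝ),
    t 0 = 0 ∧ t (Fin.last k) = 1 ∧ Monotone t ∧
    ∀ j : Fin k, ∃ u v : ℝ × ℝ, ∀ s ∈ Icc (t j.castSucc) (t j.succ), f s = u + s • v

/-- A geometric braid on `m` strands in `I × D²`: each strand is (the graph of) a PL path
in the disk, strands are disjoint, start at the base points and end at a permutation
of the base points. (Parametrising strands by the `I`-coordinate makes every component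
strictly monotone in the `I`-direction and excludes closed components.) -/
structure GeomBraid (m : ℕ) where
  f : Fin m → ℝ → ℝ × ℝ
  pl : ∀ i, IsPLPath (f i)
  disj : ∀ t ∈ Icc (0:ℝ) 1, ∀ i j : Fin m, i ≠ j → f i t ≠ f j t
  inD : ∀ i, ∀ t ∈ Icc (0:ℝ) 1, inDisk (f i t)
  start : ∀ i, f i 0 = (basePt m i, 0)
  finish : ∃ σ : Equiv.Perm (Fin m), ∀ i, f i 1 = (basePt m (σ i), 0)

/-- The subset of `I × D² ⊆ ℝ³` underlying a geometric braid. -/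
def GeomBraid.carrier {m : ℕ} (g : GeomBraid m) : Set R3 :=
  {p | ∃ i : Fin m, ∃ t ∈ Icc (0:ℝ) 1, p = (t, (g.f i t).1, (g.f i t).2)}

/-- A symmetric representative: the geometric braid is fixed setwise by `ρ`. -/
def GeomBraid.Symmetric {m : ℕ} (g : GeomBraid m) : Prop := rho '' g.carrier = g.carrier

/-- Two strand families are homotopic through configurations, relative to endpoints;
this is equality in the braid group. -/
def BraidHomotopic (m : ℕ) (f g : Fin m → ℝ → ℝ × ℝ) : Prop :=
  (∀ i, f i 0 = g i 0) ∧ (∀ i, f i 1 = g i 1) ∧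
  ∃ F : ℝ → Fin m → ℝ → ℝ × ℝ,
    (∀ i, ContinuousOn (fun q : ℝ × ℝ => F q.1 i q.2) (Icc 0 1 ×ˢ Icc 0 1)) ∧
    (∀ i, ∀ t ∈ Icc (0:ℝ) 1, F 0 i t = f i t ∧ F 1 i t = g i t) ∧
    (∀ s ∈ Icc (0:ℝ) 1, ∀ i, F s i 0 = f i 0 ∧ F s i 1 = f i 1) ∧
    (∀ s ∈ Icc (0:ℝ) 1, ∀ t ∈ Icc (0:ℝ) 1, ∀ i j : Fin m, i ≠ j → F s i t ≠ F s j t) ∧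
    (∀ s ∈ Icc (0:ℝ) 1, ∀ t ∈ Icc (0:ℝ) 1, ∀ i, inDisk (F s i t))

/-- Two geometric braids represent the same braid. -/
def SameBraid {m : ℕ} (a b : GeomBraid m) : Prop := BraidHomotopic m a.f b.f

/-- `f` is piecewise linear on `s`: it agrees with affine maps on the cells of a finite
cover of `s` by compact convex sets. -/
def IsPLOn (f : R3 → R3) (s : Set R3) : Prop :=
  ∃ (k : ℕ) (P : Fin k → Set R3) (g : Fin k → (R3 →ᵃ[ℝ] R3)),
    s = ⋃ i, P i ∧ (∀ i, IsCompact (P i) ∧ Convex ℝ (P i)) ∧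
    ∀ i, EqOn f (g i) (P i)

/-! ### The equivariant closure -/

/-- Embedding of `I × D²` onto the solid cylinder `B₁`. -/
def iota1 (p : R3) : R3 := (p.1 - 1/2, p.2.1 - 2, p.2.2)

/-- Embedding of `I × D²` onto the solid cylinder `B₂`. -/
def iota2 (p : R3) : R3 := (p.1 - 1/2, p.2.1 + 2, p.2.2)

def pathSegs (l : List R3) : List (R3 × R3) := l.zip l.tail

/-- The polygonal arc through the vertices of `l`. -/
def pathCarrier (l : List R3) : Set R3 := ⋃ e ∈ pathSegs l, segment ℝ e.1 e.2

def arcStart (m : ℕ) (i : Fin m) : R3 := (-(1:ℝ)/2, basePt m i + 2, 0)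
def arcEnd (m : ℕ) (i : Fin m) : R3 := (-(1:ℝ)/2, basePt m i - 2, 0)

/-- A connecting arc `γᵢ` of the equivariant closure: a polygonal arc in the `(x,y)`-plane
from the `i`-th endpoint of `B₂` to the `i`-th endpoint of `B₁`, projecting monotonically
to the `y`-axis. -/
def IsConnArc (m : ℕ) (i : Fin m) (l : List R3) : Prop :=
  l.head? = some (arcStart m i) ∧ l.getLast? = some (arcEnd m i) ∧
  (∀ p ∈ l, p.2.2 = 0) ∧
  l.Chain' (fun p q : R3 => q.2.1 < p.2.1)

/-- `L` is an equivariant closure of the (carriers of the) geometric braids `A` and `B`: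
`A` is embedded in `B₁`, `B` in `B₂`, and corresponding endpoints are joined by arcs
`γᵢ` in the `(x,y)`-plane monotone over the `y`-axis, together with their `τ`-images. -/
def IsEqClosure (m : ℕ) (A B : Set R3) (L : Set R3) : Prop :=
  ∃ g : Fin m → List R3,
    (∀ i, IsConnArc m i (g i)) ∧
    (∀ i j, i ≠ j → pathCarrier (g i) ∩ pathCarrier (g j) = ∅) ∧
    (∀ i j, pathCarrier (g i) ∩ tau '' pathCarrier (g j) = ∅) ∧
    (∀ i, pathCarrier (g i) ∩ (iota1 '' A ∪ iota2 '' B) ⊆ {arcStart m i, arcEnd m i}) ∧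
    L = iota1 '' A ∪ iota2 '' B ∪ (⋃ i, pathCarrier (g i)) ∪ (⋃ i, tau '' pathCarrier (g i))

/-! ### The braid group and the algebraic Markov moves -/

/-- The braid relations on the Artin generators `σ₀, …, σ_{n-1}` (for the braid group on
`n+1` strands). -/
def braidRels (n : ℕ) : Set (FreeGroup (Fin n)) :=
  {r | ∃ i j : Fin n, ((i : ℕ) + 2 ≤ (j : ℕ) ∨ (j : ℕ) + 2 ≤ (i : ℕ)) ∧
      r = .of i * .of j * (.of i)⁻¹ * (.of j)⁻¹} ∪
  {r | ∃ i j : Fin n, (j : ℕ) = (i : ℕ) + 1 ∧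
      r = .of i * .of j * .of i * ((.of j) * (.of i) * (.of j))⁻¹}

/-- The braid group on `n+1` strands, with `n` Artin generators. -/
abbrev BraidGroup (n : ℕ) := PresentedGroup (braidRels n)

/-- The projection from words to braids. -/
def bmk (n : ℕ) : FreeGroup (Fin n) →* BraidGroup n := PresentedGroup.mk (braidRels n)

/-- The reverse of a word: the word read from right to left. -/
def revF {n : ℕ} : FreeGroup (Fin n) → FreeGroup (Fin n) :=
  fun w => ((FreeGroup.lift fun i => MulOpposite.op (FreeGroup.of i)) w).unop

/-- A braid is palindromic if it is represented by a word equal, in the braid group,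
to its reverse. -/
def Palindromic {n : ℕ} (β : BraidGroup n) : Prop :=
  ∃ w : FreeGroup (Fin n), bmk n w = β ∧ bmk n (revF w) = β

/-- The inclusion `S : Bₙ → Bₙ₊₁`, `σᵢ ↦ σᵢ₊₁` (at the level of words). -/
def mapS {n : ℕ} : FreeGroup (Fin n) →* FreeGroup (Fin (n + 1)) :=
  FreeGroup.lift fun i => FreeGroup.of i.succ

/-- The inclusion `E : Bₙ → Bₙ₊₁`, `σᵢ ↦ σᵢ` (at the level of words). -/
def mapE {n : ℕ} : FreeGroup (Fin n) →* FreeGroup (Fin (n + 1)) :=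
  FreeGroup.lift fun i => FreeGroup.of i.castSucc

def mapS2 {n : ℕ} : FreeGroup (Fin n) →* FreeGroup (Fin (n + 2)) := mapS.comp mapS

/-- The letter `σᵢ^{±1}`. -/
def genW {n : ℕ} (p : Fin n × Bool) : FreeGroup (Fin n) :=
  cond p.2 (FreeGroup.of p.1) (FreeGroup.of p.1)⁻¹

/-- The word `Δ = σ_{j₁}^{ε₁} ⋯ σ_{j_k}^{ε_k}`. -/
def deltaWord {n : ℕ} (d : List (Fin n × Bool)) : FreeGroup (Fin n) := (d.map genW).prod

/-- `Δ` is a product of distinct pairwise-commuting Artin generators. -/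
def IsDelta {n : ℕ} (d : List (Fin n × Bool)) : Prop :=
  d.Pairwise fun p q => (p.1 : ℕ) + 2 ≤ (q.1 : ℕ) ∨ (q.1 : ℕ) + 2 ≤ (p.1 : ℕ)

/-- The bottom generator `σ₁^{±1}` of `B_{n+2}`. -/
def sigmaBot (n : ℕ) (ε : Bool) : FreeGroup (Fin (n + 1)) := genW (⟨0, n.succ_pos⟩, ε)

/-- The top generator `σ_{n+1}^{±1}` of `B_{n+2}`. -/
def sigmaTop (n : ℕ) (ε : Bool) : FreeGroup (Fin (n + 1)) := genW (Fin.last n, ε)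

def sigma2 (n : ℕ) (ε : Bool) : FreeGroup (Fin (n + 2)) :=
  genW (⟨1, by omega⟩, ε)

def sigma1' (n : ℕ) (ε : Bool) : FreeGroup (Fin (n + 2)) :=
  genW (⟨0, by omega⟩, ε)

/-- A state: a pair of (palindromic) braids on a common number of strands. -/
abbrev MPair := Σ n : ℕ, BraidGroup n × BraidGroup n

/-- Equivariant conjugation: `(α, β) ↦ (γ α γ̄, γ̄⁻¹ β γ⁻¹)`. -/
def ConjStep (P Q : MPair) : Prop :=
  ∃ (n : ℕ) (α β : BraidGroup n) (g : FreeGroup (Fin n)),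
    P = ⟨n, (α, β)⟩ ∧
    Q = ⟨n, (bmk n g * α * bmk n (revF g), (bmk n (revF g))⁻¹ * β * (bmk n g)⁻¹)⟩

/-- Stabilization of type `S` on a fixed point. -/
def StabSStep (P Q : MPair) : Prop :=
  ∃ (n : ℕ) (x w : FreeGroup (Fin n)) (d : List (Fin n × Bool)) (ε : Bool),
    IsDelta d ∧ (∀ p ∈ d, (p.1 : ℕ) ≠ 0) ∧
    ((P = ⟨n, (bmk n (x * deltaWord d * revF x), bmk n w)⟩ ∧
      Q = ⟨n + 1, (bmk (n + 1) (mapS x * mapS (deltaWord d) * sigmaBot n ε * mapS (revF x)),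
        bmk (n + 1) (mapS w))⟩) ∨
     (P = ⟨n, (bmk n w, bmk n (x * deltaWord d * revF x))⟩ ∧
      Q = ⟨n + 1, (bmk (n + 1) (mapS w),
        bmk (n + 1) (mapS x * mapS (deltaWord d) * sigmaBot n ε * mapS (revF x)))⟩))

/-- Stabilization of type `E` on a fixed point. -/
def StabEStep (P Q : MPair) : Prop :=
  ∃ (n : ℕ) (x w : FreeGroup (Fin n)) (d : List (Fin n × Bool)) (ε : Bool),
    IsDelta d ∧ (∀ p ∈ d, (p.1 : ℕ) + 1 ≠ n) ∧
    ((P = ⟨n, (bmk n (x * deltaWord d * revF x), bmk n w)⟩ ∧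
      Q = ⟨n + 1, (bmk (n + 1) (mapE x * mapE (deltaWord d) * sigmaTop n ε * mapE (revF x)),
        bmk (n + 1) (mapE w))⟩) ∨
     (P = ⟨n, (bmk n w, bmk n (x * deltaWord d * revF x))⟩ ∧
      Q = ⟨n + 1, (bmk (n + 1) (mapE w),
        bmk (n + 1) (mapE x * mapE (deltaWord d) * sigmaTop n ε * mapE (revF x)))⟩))

/-- Double stabilization. -/
def DoubleStep (P Q : MPair) : Prop :=
  ∃ (n : ℕ) (x y : FreeGroup (Fin n)) (d d' : List (Fin n × Bool)) (ε η : Bool),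
    IsDelta d ∧ IsDelta d' ∧
    P = ⟨n, (bmk n (x * deltaWord d * revF x), bmk n (y * deltaWord d' * revF y))⟩ ∧
    Q = ⟨n + 2, (bmk (n + 2) (mapS2 x * mapS2 (deltaWord d) * sigma1' n ε * mapS2 (revF x)),
      bmk (n + 2) (sigma2 n η * mapS2 y * mapS2 (deltaWord d') * sigma1' n (!ε) *
        mapS2 (revF y) * sigma2 n η))⟩

/-- One equivariant Markov move: equivariant conjugation, (de-)stabilization of type `S`
or `E` on a fixed point, or double stabilization. -/
def MarkovRel (P Q : MPair) : Prop :=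
  ConjStep P Q ∨ ConjStep Q P ∨ StabSStep P Q ∨ StabSStep Q P ∨
  StabEStep P Q ∨ StabEStep Q P ∨ DoubleStep P Q

/-! ### Geometric realization of words -/

/-- The motion of the `n+1` base points realizing one letter `σ_k^{±1}`. -/
def letterMotion (n : ℕ) (k : Fin n) (ε : Bool) (i : Fin (n + 1)) (t : ℝ) : ℝ × ℝ :=
  let c : ℝ := (basePt (n + 1) k.castSucc + basePt (n + 1) k.succ) / 2
  let r : ℝ := (basePt (n + 1) k.succ - basePt (n + 1) k.castSucc) / 2
  let s : ℝ := cond ε 1 (-1)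
  if i = k.castSucc then (c - r * Real.cos (Real.pi * t), s * r * Real.sin (Real.pi * t))
  else if i = k.succ then (c + r * Real.cos (Real.pi * t), -s * r * Real.sin (Real.pi * t))
  else (basePt (n + 1) i, 0)

/-- The strand paths realizing a word, parametrized on `[0, length]`. -/
def wordPathN (n : ℕ) : List (Fin n × Bool) → Fin (n + 1) → ℝ → ℝ × ℝ
  | [], i, _ => (basePt (n + 1) i, 0)
  | ℓ :: rest, i, t =>
      if t ≤ 1 then letterMotion n ℓ.1 ℓ.2 i t
      else wordPathN n rest (Equiv.swap ℓ.1.castSucc ℓ.1.succ i) (t - 1)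

/-- The standard geometric realization of a word, parametrized on `[0,1]`. -/
def wordPath (n : ℕ) (w : List (Fin n × Bool)) (i : Fin (n + 1)) (t : ℝ) : ℝ × ℝ :=
  wordPathN n w i (t * w.length)

/-- A geometric braid represents an element of the braid group if it is braid-homotopic
to the standard realization of some word for that element. -/
def Represents {n : ℕ} (g : GeomBraid (n + 1)) (β : BraidGroup n) : Prop :=
  ∃ w : FreeGroup (Fin n), bmk n w = β ∧
    BraidHomotopic (n + 1) g.f (wordPath n w.toWord)


/-- An admissible `R̃` move, as a step relation on links. -/
def RtilStep (X Y : PolyLink) : Prop :=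
  ∃ a c b, AdmRtil a c b X ∧ Y = applyEtil a c b X

/-- An admissible `W̃` move, as a step relation on links. -/
def AdmWtilStep (X Y : PolyLink) : Prop :=
  ∃ a d b c, AdmWtil a d b c X ∧ Y = applyWtil a d b c X

open Filter Topology

/-! ### The involution and triangles -/

@[simp] theorem tau_tau (x : R3) : tau (tau x) = x := by simp [tau]

theorem tau_injective : Function.Injective tau := fun x y h => by
  rw [← tau_tau x, h, tau_tau]

@[simp] theorem tau_inj {x y : R3} : tau x = tau y ↔ x = y := tau_injective.eq_iff

theorem tau_eq_comm {x y : R3} : tau x = y ↔ x = tau y :=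
  ⟨fun h => by rw [← h, tau_tau], fun h => by rw [h, tau_tau]⟩

theorem tau_add (x y : R3) : tau (x + y) = tau x + tau y := by
  ext <;> simp [tau] <;> ring

theorem tau_sub (x y : R3) : tau (x - y) = tau x - tau y := by
  ext <;> simp [tau] <;> ring

theorem tau_smul (r : ℝ) (x : R3) : tau (r • x) = r • tau x := by
  ext <;> simp [tau]

theorem continuous_tau : Continuous tau := by
  unfold tau; fun_prop

theorem mem_tri {a b c x : R3} : x ∈ tri a b c ↔
    ∃ i j k : ℝ, 0 ≤ i ∧ 0 ≤ j ∧ 0 ≤ k ∧ i + j + k = 1 ∧ i • a + j • b + k • c = x := by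
  unfold tri
  rw [convexHull_insert ⟨b, by simp⟩, convexHull_pair]
  simp only [convexJoin_singleton_left, mem_iUnion, exists_prop]
  constructor
  · rintro ⟨y, ⟨p, q, hp, hq, hpq, rfl⟩, ⟨r, s, hr, hs, hrs, rfl⟩⟩
    refine ⟨r, s * p, s * q, hr, by positivity, by positivity, ?_, ?_⟩
    · rw [add_assoc, ← mul_add, hpq, mul_one, hrs]
    · simp only [smul_add, smul_smul, add_assoc]
  · rintro ⟨i, j, k, hi, hj, hk, h, rfl⟩
    rcases eq_or_lt_of_le (add_nonneg hj hk) with h0 | h0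
    · have hj0 : j = 0 := by linarith
      have hk0 : k = 0 := by linarith
      have hi1 : i = 1 := by linarith
      refine ⟨b, left_mem_segment ℝ _ _, ?_⟩
      simpa [hj0, hk0, hi1] using left_mem_segment ℝ a b
    · refine ⟨(j / (j + k)) • b + (k / (j + k)) • c,
        ⟨j / (j + k), k / (j + k), by positivity, by positivity, by field_simp, rfl⟩,
        ⟨i, j + k, hi, h0.le, by linarith, ?_⟩⟩
      rw [smul_add, smul_smul, smul_smul, mul_div_cancel₀ _ h0.ne', mul_div_cancel₀ _ h0.ne',
        add_assoc]

theorem mem_seg {a b x : R3} : x ∈ segment ℝ a b ↔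
    ∃ i j : ℝ, 0 ≤ i ∧ 0 ≤ j ∧ i + j = 1 ∧ i • a + j • b = x := by
  constructor
  · rintro ⟨i, j, h⟩; exact ⟨i, j, h⟩
  · rintro ⟨i, j, h⟩; exact ⟨i, j, h⟩

theorem mem_carrier {L : PolyLink} {x : R3} :
    x ∈ carrier L ↔ ∃ f ∈ L, x ∈ segment ℝ f.1 f.2 := by
  simp [carrier]

theorem convex_tri (a b c : R3) : Convex ℝ (tri a b c) := convex_convexHull _ _

theorem left_mem_tri (a b c : R3) : a ∈ tri a b c :=
  subset_convexHull ℝ ({a, b, c} : Set R3) (by simp)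
theorem mid_mem_tri (a b c : R3) : b ∈ tri a b c :=
  subset_convexHull ℝ ({a, b, c} : Set R3) (by simp)
theorem right_mem_tri (a b c : R3) : c ∈ tri a b c :=
  subset_convexHull ℝ ({a, b, c} : Set R3) (by simp)

theorem tri_subset {a b c : R3} {s : Set R3} (hs : Convex ℝ s) (ha : a ∈ s) (hb : b ∈ s)
    (hc : c ∈ s) : tri a b c ⊆ s :=
  convexHull_min (by rintro x (rfl | rfl | rfl) <;> assumption) hs

theorem seg_subset_tri₁₂ (a b c : R3) : segment ℝ a b ⊆ tri a b c :=
  (convex_tri a b c).segment_subset (left_mem_tri _ _ _) (mid_mem_tri _ _ _)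
theorem seg_subset_tri₂₃ (a b c : R3) : segment ℝ b c ⊆ tri a b c :=
  (convex_tri a b c).segment_subset (mid_mem_tri _ _ _) (right_mem_tri _ _ _)
theorem seg_subset_tri₁₃ (a b c : R3) : segment ℝ a c ⊆ tri a b c :=
  (convex_tri a b c).segment_subset (left_mem_tri _ _ _) (right_mem_tri _ _ _)

theorem tri_swap (a b c : R3) : tri a b c = tri c b a := by
  unfold tri; congr 1; ext x; simp; tauto

theorem tri_rot (a b c : R3) : tri a b c = tri a c b := by
  unfold tri; congr 1; ext x; simp; tauto

theorem tau_mem_tri {a b c x : R3} : tau x ∈ tri (tau a) (tau b) (tau c) ↔ x ∈ tri a b c := by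
  simp only [mem_tri, ← tau_smul, ← tau_add, tau_inj]

theorem mem_tri_tau {a b c x : R3} : x ∈ tri (tau a) (tau b) (tau c) ↔ tau x ∈ tri a b c := by
  conv_rhs => rw [← tau_mem_tri, tau_tau]

theorem tau_mem_seg {a b x : R3} : tau x ∈ segment ℝ (tau a) (tau b) ↔ x ∈ segment ℝ a b := by
  simp only [mem_seg, ← tau_smul, ← tau_add, tau_inj]

theorem mem_seg_tau {a b x : R3} : x ∈ segment ℝ (tau a) (tau b) ↔ tau x ∈ segment ℝ a b := by
  conv_rhs => rw [← tau_mem_seg, tau_tau]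

/-- `a`, `b`, `c` are not collinear. -/
def NC (a b c : R3) : Prop := ∀ x y : ℝ, x • (b - a) + y • (c - a) = 0 → x = 0 ∧ y = 0

theorem NC.tau {a b c : R3} (h : NC a b c) : NC (tau c) (tau b) (tau a) := by
  intro x y e
  have e' : x • (b - c) + y • (a - c) = 0 := by
    apply tau_injective
    rw [tau_add, tau_smul, tau_smul, tau_sub, tau_sub, e]
    ext <;> simp [_root_.tau]
  obtain ⟨h1, h2⟩ := h x (-x - y) (by rw [← e']; module)
  exact ⟨h1, by linarith⟩

theorem NC.ab {a b c : R3} (h : NC a b c) : a ≠ b := by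
  rintro rfl; have := h 1 0 (by simp); simp at this
theorem NC.ac {a b c : R3} (h : NC a b c) : a ≠ c := by
  rintro rfl; have := h 0 1 (by simp); simp at this
theorem NC.bc {a b c : R3} (h : NC a b c) : b ≠ c := by
  rintro rfl; have := h 1 (-1) (by simp); simp at this

theorem NC.coeff {a b c : R3} (h : NC a b c) {i j k i' j' k' : ℝ} (h1 : i + j + k = 1)
    (h2 : i' + j' + k' = 1) (e : i • a + j • b + k • c = i' • a + j' • b + k' • c) :
    i = i' ∧ j = j' ∧ k = k' := by
  obtain rfl : i = 1 - j - k := by linarith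
  obtain rfl : i' = 1 - j' - k' := by linarith
  obtain ⟨hx, hy⟩ := h (j - j') (k - k') (by
    have := sub_eq_zero.mpr e
    rw [← this]; module)
  exact ⟨by linarith, by linarith, by linarith⟩

/-! ### Links, up to permutation of the edges -/

/-- Compatibility of two distinct edges of a link. -/
def LP (e f : R3 × R3) : Prop :=
  e.1 ≠ f.1 ∧ e.2 ≠ f.2 ∧ ∀ x, x ∈ segment ℝ e.1 e.2 → x ∈ segment ℝ f.1 f.2 →
    (x = e.1 ∨ x = e.2) ∧ (x = f.1 ∨ x = f.2)

theorem LP.symm {e f : R3 × R3} (h : LP e f) : LP f e :=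
  ⟨h.1.symm, h.2.1.symm, fun x h1 h2 => (h.2.2 x h2 h1).symm⟩

instance : Std.Symm LP := ⟨fun _ _ => LP.symm⟩

theorem isLink_iff (L : PolyLink) : IsLink L ↔
    (∀ e ∈ L, e.1 ≠ e.2) ∧ L.Pairwise LP ∧ ∀ p, (∃ e ∈ L, e.1 = p) ↔ ∃ e ∈ L, e.2 = p := by
  constructor
  · rintro ⟨hn, hne, hi, hnx, hpv⟩
    refine ⟨hne, ?_, ?_⟩
    · refine List.Pairwise.imp_of_mem ?_ hn
      intro e f he hf hef
      refine ⟨?_, ?_, ?_⟩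
      · intro h
        obtain ⟨g, ⟨hg, hg2⟩, -⟩ := hpv e he
        exact hef ((hnx g hg).unique ⟨he, hg2.symm⟩ ⟨hf, h.symm.trans hg2.symm⟩)
      · intro h
        obtain ⟨g, ⟨hg, hg2⟩, -⟩ := hnx e he
        exact hef ((hpv g hg).unique ⟨he, hg2.symm⟩ ⟨hf, h.symm.trans hg2.symm⟩)
      · intro x hx hx'
        simpa using hi e he f hf hef ⟨hx, hx'⟩
    · intro p
      constructor
      · rintro ⟨e, he, rfl⟩
        obtain ⟨g, ⟨hg, hg2⟩, -⟩ := hpv e he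
        exact ⟨g, hg, hg2⟩
      · rintro ⟨e, he, rfl⟩
        obtain ⟨g, ⟨hg, hg2⟩, -⟩ := hnx e he
        exact ⟨g, hg, hg2⟩
  · rintro ⟨hne, hp, hv⟩
    have key : ∀ e ∈ L, ∀ f ∈ L, e ≠ f → LP e f := by
      intro e he f hf hef
      exact hp.forall he hf hef
    refine ⟨?_, hne, ?_, ?_, ?_⟩
    · exact hp.imp fun h e => h.1 (by rw [e])
    · intro e he f hf hef x hx
      simpa using (key e he f hf hef).2.2 x hx.1 hx.2
    · intro e he
      obtain ⟨g, hg, hg2⟩ := (hv e.2).2 ⟨e, he, rfl⟩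
      refine ⟨g, ⟨hg, hg2⟩, ?_⟩
      rintro g' ⟨hg', hg2'⟩
      by_contra hne'
      exact (key g' hg' g hg hne').1 (hg2'.trans hg2.symm)
    · intro e he
      obtain ⟨g, hg, hg2⟩ := (hv e.1).1 ⟨e, he, rfl⟩
      refine ⟨g, ⟨hg, hg2⟩, ?_⟩
      rintro g' ⟨hg', hg2'⟩
      by_contra hne'
      exact (key g' hg' g hg hne').2.1 (hg2'.trans hg2.symm)

theorem IsLink.perm {L L' : PolyLink} (h : IsLink L) (hp : L.Perm L') : IsLink L' := by
  rw [isLink_iff] at h ⊢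
  refine ⟨fun e he => h.1 e (hp.mem_iff.2 he), ?_, ?_⟩
  · exact (hp.pairwise_iff (fun h => LP.symm h)).1 h.2.1
  · intro p; simpa only [hp.mem_iff] using h.2.2 p

theorem isLink_perm {L L' : PolyLink} (hp : L.Perm L') : IsLink L ↔ IsLink L' :=
  ⟨fun h => h.perm hp, fun h => h.perm hp.symm⟩

theorem isLink_triangle_iff {a b c : R3} {L : PolyLink} (hnc : NC a b c)
    (hL : ∀ x ∈ tri a b c, ∀ f ∈ L, x ∈ segment ℝ f.1 f.2 → x = a ∨ x = c) :
    IsLink (L ++ [(a, c)]) ↔ IsLink (L ++ [(a, b), (b, c)]) := by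
  have hab : ∀ f ∈ L, ∀ x ∈ segment ℝ a b, x ∈ segment ℝ f.1 f.2 → x = a := by
    intro f hf x hx hxf
    rcases hL x (seg_subset_tri₁₂ _ _ _ hx) f hf hxf with h | h
    · exact h
    · subst h
      obtain ⟨i, j, hi, hj, hij, e⟩ := hx
      have := hnc.coeff (i := i) (j := j) (k := 0) (i' := 0) (j' := 0) (k' := 1)
        (by linarith) (by simp) (by rw [zero_smul, add_zero, e]; simp)
      linarith [this.2.2]
  have hbc : ∀ f ∈ L, ∀ x ∈ segment ℝ b c, x ∈ segment ℝ f.1 f.2 → x = c := by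
    intro f hf x hx hxf
    rcases hL x (seg_subset_tri₂₃ _ _ _ hx) f hf hxf with h | h
    · subst h
      obtain ⟨i, j, hi, hj, hij, e⟩ := hx
      have := hnc.coeff (i := 0) (j := i) (k := j) (i' := 1) (j' := 0) (k' := 0)
        (by linarith) (by simp) (by rw [zero_smul, zero_add, e]; simp)
      linarith [this.1]
    · exact h
  have hbL : ∀ f ∈ L, f.1 ≠ b ∧ f.2 ≠ b := by
    intro f hf
    constructor
    · intro h
      exact hnc.ab (hab f hf b (right_mem_segment _ _ _) (h ▸ left_mem_segment _ _ _)).symm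
    · intro h
      exact hnc.ab (hab f hf b (right_mem_segment _ _ _) (h ▸ right_mem_segment _ _ _)).symm
  have hinn : LP (a, b) (b, c) := by
    refine ⟨hnc.ab, hnc.bc, ?_⟩
    rintro x ⟨i, j, hi, hj, hij, e⟩ ⟨i', j', hi', hj', hij', e'⟩
    have := hnc.coeff (i := i) (j := j) (k := 0) (i' := 0) (j' := i') (k' := j')
      (by linarith) (by linarith) (by rw [zero_smul, add_zero, zero_smul, zero_add]; exact e.trans e'.symm)
    have hxb : x = b := by
      rw [← e, this.1, show j = 1 by linarith]; simp
    simp [hxb]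
  simp only [isLink_iff, List.pairwise_append, List.mem_append, List.mem_cons, List.not_mem_nil,
    or_false, List.pairwise_cons, List.Pairwise.nil, and_true, forall_eq,
    or_imp, forall_and, IsEmpty.forall_iff, implies_true, true_and]
  constructor
  · rintro ⟨⟨h1, h2⟩, ⟨h3, h4⟩, h5⟩
    refine ⟨⟨h1, hnc.ab, hnc.bc⟩, ⟨h3, hinn, ?_, ?_⟩, ?_⟩
    · intro f hf
      refine ⟨(h4 f hf).1, (hbL f hf).2, fun x hx hx' => ?_⟩
      have hxa := hab f hf x hx' hx
      subst hxa
      exact ⟨((h4 f hf).2.2 x hx (left_mem_segment _ _ _)).1, Or.inl rfl⟩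
    · intro f hf
      refine ⟨(hbL f hf).1, (h4 f hf).2.1, fun x hx hx' => ?_⟩
      have hxa := hbc f hf x hx' hx
      subst hxa
      exact ⟨((h4 f hf).2.2 x hx (right_mem_segment _ _ _)).1, Or.inr rfl⟩
    · intro p
      have := h5 p
      simp only [or_and_right, exists_or, exists_eq_left] at this ⊢
      rw [← or_assoc, this, or_assoc, or_comm (a := c = p)]
  · rintro ⟨⟨h1, h2⟩, ⟨h3, -, h4, h4'⟩, h5⟩
    refine ⟨⟨h1, hnc.ac⟩, ⟨h3, ?_⟩, ?_⟩
    · intro f hf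
      refine ⟨(h4 f hf).1, (h4' f hf).2.1, fun x hx hx' => ?_⟩
      rcases hL x (seg_subset_tri₁₃ _ _ _ hx') f hf hx with h | h
      · subst h
        exact ⟨((h4 f hf).2.2 x hx (left_mem_segment _ _ _)).1, Or.inl rfl⟩
      · subst h
        exact ⟨((h4' f hf).2.2 x hx (right_mem_segment _ _ _)).1, Or.inr rfl⟩
    · intro p
      have := h5 p
      simp only [or_and_right, exists_or, exists_eq_left] at this ⊢
      by_cases hp : p = b
      · subst hp
        have e1 : ¬ ∃ e ∈ L, e.1 = p := by rintro ⟨e, he, h⟩; exact (hbL e he).1 h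
        have e2 : ¬ ∃ e ∈ L, e.2 = p := by rintro ⟨e, he, h⟩; exact (hbL e he).2 h
        simp [e1, e2, hnc.ab, hnc.bc.symm]
      · have hp' : b ≠ p := fun h => hp h.symm
        simpa [hp'] using this

/-- A list of edges is preserved by the involution, with orientation reversed. -/
def TauSymm (R : PolyLink) : Prop := ∀ f ∈ R, (tau f.2, tau f.1) ∈ R

theorem TauSymm.carrier {R : PolyLink} (h : TauSymm R) {x : R3} (hx : x ∈ carrier R) :
    tau x ∈ carrier R := by
  rw [mem_carrier] at hx ⊢
  obtain ⟨f, hf, hx⟩ := hx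
  refine ⟨_, h f hf, ?_⟩
  rw [segment_symm, tau_mem_seg]; exact hx

theorem TauSymm.append {R R' : PolyLink} (h : TauSymm R) (h' : TauSymm R') : TauSymm (R ++ R') := by
  intro f hf
  rw [List.mem_append] at hf ⊢
  exact hf.imp (h f) (h' f)

theorem admE_of_perm {a b c : R3} {L R : PolyLink} (hp : L.Perm (R ++ [(a, c)])) (hL : IsLink L)
    (hnc : NC a b c) (hR : ∀ x ∈ tri a b c, x ∈ carrier R → x = a ∨ x = c) :
    AdmE a c b L ∧ (applyE a c b L).Perm (R ++ [(a, b), (b, c)]) := by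
  have hp2 : (applyE a c b L).Perm (R ++ [(a, b), (b, c)]) := by
    refine List.Perm.append_right _ ?_
    have h1 := hp.erase (a, c)
    refine h1.trans ?_
    have h2 : (R ++ [(a, c)]).Perm ((a, c) :: R) := List.perm_append_comm
    simpa using h2.erase (a, c)
  refine ⟨⟨⟨hp.mem_iff.2 (by simp), ?_⟩, ?_⟩, hp2⟩
  · rw [isLink_perm hp2, ← isLink_triangle_iff hnc, ← isLink_perm hp]
    · exact hL
    · intro x hx f hf hxf
      exact hR x hx (mem_carrier.2 ⟨f, hf, hxf⟩)
  · ext x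
    constructor
    · rintro ⟨hx, hx'⟩
      obtain ⟨f, hf, hxf⟩ := mem_carrier.1 hx'
      rw [hp.mem_iff, List.mem_append, List.mem_singleton] at hf
      rcases hf with hf | rfl
      · rcases hR x hx (mem_carrier.2 ⟨f, hf, hxf⟩) with rfl | rfl
        · exact left_mem_segment _ _ _
        · exact right_mem_segment _ _ _
      · exact hxf
    · intro hx
      exact ⟨seg_subset_tri₁₃ _ _ _ hx, mem_carrier.2 ⟨(a, c), hp.mem_iff.2 (by simp), hx⟩⟩

theorem carrier_append (L L' : PolyLink) : carrier (L ++ L') = carrier L ∪ carrier L' := by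
  ext x; simp [mem_carrier, or_and_right, exists_or]

theorem carrier_perm {L L' : PolyLink} (h : L.Perm L') : carrier L = carrier L' := by
  ext x; simp [mem_carrier, h.mem_iff]

theorem isLink_etil {a b c : R3} {R : PolyLink} (hnc : NC a b c) (hs : TauSymm R)
    (hR : ∀ x ∈ tri a b c, x ∈ carrier R → x = a ∨ x = c)
    (ht : ∀ x ∈ tri a b c, tau x ∈ tri a b c → x = a ∨ x = c) :
    (∀ x ∈ tri a b c, x ∈ carrier (R ++ [(tau c, tau a)]) → x = a ∨ x = c) ∧
    (∀ x ∈ tri (tau c) (tau b) (tau a), x ∈ carrier (R ++ [(a, b), (b, c)]) →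
      x = tau c ∨ x = tau a) ∧
    (IsLink (R ++ [(a, c), (tau c, tau a)]) ↔
      IsLink (R ++ [(a, b), (b, c), (tau c, tau b), (tau b, tau a)])) := by
  have h1 : ∀ x ∈ tri a b c, x ∈ carrier (R ++ [(tau c, tau a)]) → x = a ∨ x = c := by
    intro x hx hx'
    rw [carrier_append] at hx'
    rcases hx' with h | h
    · exact hR x hx h
    · rw [mem_carrier] at h
      simp only [List.mem_singleton, exists_eq_left] at h
      rw [mem_seg_tau] at h
      refine ht x hx ?_
      rw [tri_swap]; exact seg_subset_tri₁₃ _ _ _ h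
  have h2 : ∀ x ∈ tri (tau c) (tau b) (tau a), x ∈ carrier (R ++ [(a, b), (b, c)]) →
      x = tau c ∨ x = tau a := by
    intro x hx hx'
    rw [mem_tri_tau, tri_swap] at hx
    rw [← tau_eq_comm, ← tau_eq_comm, or_comm]
    rw [carrier_append] at hx'
    rcases hx' with h | h
    · exact hR _ hx (hs.carrier h)
    · rw [mem_carrier] at h
      simp only [List.mem_cons, List.not_mem_nil, or_false, exists_eq_or_imp, exists_eq_left] at h
      refine ht _ hx ?_
      rw [tau_tau]
      rcases h with h | h
      · exact seg_subset_tri₁₂ _ _ _ h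
      · exact seg_subset_tri₂₃ _ _ _ h
  refine ⟨h1, h2, ?_⟩
  have p1 : (R ++ [(a, c), (tau c, tau a)]).Perm ((R ++ [(tau c, tau a)]) ++ [(a, c)]) := by
    rw [List.append_assoc]
    exact List.Perm.append_left _ (List.Perm.swap _ _ _)
  have p2 : ((R ++ [(tau c, tau a)]) ++ [(a, b), (b, c)]).Perm
      ((R ++ [(a, b), (b, c)]) ++ [(tau c, tau a)]) := by
    simp only [List.append_assoc]
    exact List.Perm.append_left _ List.perm_append_comm
  rw [isLink_perm p1, isLink_triangle_iff hnc fun x hx f hf hxf =>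
    h1 x hx (mem_carrier.2 ⟨f, hf, hxf⟩), isLink_perm p2, isLink_triangle_iff hnc.tau
    fun x hx f hf hxf => h2 x hx (mem_carrier.2 ⟨f, hf, hxf⟩)]
  simp

theorem admEtil_of_perm {a b c : R3} {L R : PolyLink}
    (hp : L.Perm (R ++ [(a, c), (tau c, tau a)])) (hL : IsLink L)
    (hnc : NC a b c) (hs : TauSymm R)
    (hR : ∀ x ∈ tri a b c, x ∈ carrier R → x = a ∨ x = c)
    (ht : ∀ x ∈ tri a b c, tau x ∈ tri a b c → x = a ∨ x = c) :
    AdmEtil a c b L ∧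
      (applyEtil a c b L).Perm (R ++ [(a, b), (b, c), (tau c, tau b), (tau b, tau a)]) := by
  obtain ⟨h1, h2, -⟩ := isLink_etil hnc hs hR ht
  have p1 : L.Perm ((R ++ [(tau c, tau a)]) ++ [(a, c)]) := by
    refine hp.trans ?_
    rw [List.append_assoc]
    exact List.Perm.append_left _ (List.Perm.swap _ _ _)
  obtain ⟨a1, q1⟩ := admE_of_perm p1 hL hnc h1
  have p2 : (applyE a c b L).Perm ((R ++ [(a, b), (b, c)]) ++ [(tau c, tau a)]) := by
    refine q1.trans ?_
    simp only [List.append_assoc]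
    exact List.Perm.append_left _ List.perm_append_comm
  obtain ⟨a2, q2⟩ := admE_of_perm p2 a1.1.2 hnc.tau h2
  refine ⟨⟨a1, a2⟩, q2.trans ?_⟩
  simp

/-! ### Teeth on a negative edge -/

/-- The unit vector of the braid axis. -/
def zhat : R3 := (0, 0, 1)

theorem tau_zhat : tau zhat = (-1 : ℝ) • zhat := by ext <;> simp [tau, zhat]

/-- The point of the segment `PQ` with parameter `s`. -/
def pt (P Q : R3) (s : ℝ) : R3 := (1 - s) • P + s • Q

@[simp] theorem pt_zero (P Q : R3) : pt P Q 0 = P := by simp [pt]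
@[simp] theorem pt_one (P Q : R3) : pt P Q 1 = Q := by simp [pt]

theorem tau_pt (P Q : R3) (s : ℝ) : tau (pt P Q s) = pt (tau Q) (tau P) (1 - s) := by
  simp only [pt, tau_add, tau_smul]; module

/-- A tooth with base `[u, v]`, whose tip is obtained from the point with parameter `s` by
pushing it through the point of height `h` on the braid axis, with factor `k`. -/
structure Tooth where
  u : ℝ
  v : ℝ
  s : ℝ
  h : ℝ
  k : ℝ

/-- The parameters of a tooth are in the expected ranges. -/
structure Tooth.Ok (T : Tooth) : Prop where
  u0 : 0 ≤ T.u
  us : T.u < T.s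
  sv : T.s < T.v
  v1 : T.v ≤ 1
  k0 : 0 < T.k

/-- The tip of a tooth. -/
def tip (P Q : R3) (s h k : ℝ) : R3 := ((1 + k) * h) • zhat - k • pt P Q s

theorem tau_tip (P Q : R3) (s h k : ℝ) :
    tau (tip P Q s h k) = tip (tau Q) (tau P) (1 - s) (-h) k := by
  unfold tip
  rw [tau_sub, tau_smul, tau_smul, tau_zhat, tau_pt]; module

/-- The triangle over the base `[u, v]` with tip `t`. -/
def slab (P Q : R3) (u v : ℝ) (t : R3) : Set R3 := tri (pt P Q u) t (pt P Q v)

/-- The tip of a tooth. -/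
def Tooth.tp (P Q : R3) (T : Tooth) : R3 := tip P Q T.s T.h T.k

/-- The triangle of a tooth. -/
def Tooth.body (P Q : R3) (T : Tooth) : Set R3 := slab P Q T.u T.v (T.tp P Q)

theorem coord_zero {P Q : R3} (hD : NegEdge (P, Q)) {a b c : ℝ}
    (h : a • P + b • Q + c • zhat = 0) : a = 0 ∧ b = 0 ∧ c = 0 := by
  have h1 := congrArg Prod.fst h
  have h2 := congrArg (fun x => x.2.1) h
  have h3 := congrArg (fun x => x.2.2) h
  simp [zhat] at h1 h2 h3
  simp only [NegEdge, cross2, proj] at hD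
  have ha : a = 0 := by
    have : a * (P.1 * Q.2.1 - P.2.1 * Q.1) = 0 := by linear_combination Q.2.1 * h1 - Q.1 * h2
    exact (mul_eq_zero.1 this).resolve_right hD.ne
  have hb : b = 0 := by
    have : b * (P.1 * Q.2.1 - P.2.1 * Q.1) = 0 := by linear_combination P.1 * h2 - P.2.1 * h1
    exact (mul_eq_zero.1 this).resolve_right hD.ne
  subst ha hb
  simpa using h3

theorem coord_inj {P Q : R3} (hD : NegEdge (P, Q)) {a b c a' b' c' : ℝ}
    (h : a • P + b • Q + c • zhat = a' • P + b' • Q + c' • zhat) : a = a' ∧ b = b' ∧ c = c' := by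
  have := coord_zero hD (a := a - a') (b := b - b') (c := c - c') (by
    rw [← sub_eq_zero.2 h]; module)
  exact ⟨by linarith [this.1], by linarith [this.2.1], by linarith [this.2.2]⟩

theorem NegEdge.tau {P Q : R3} (hD : NegEdge (P, Q)) : NegEdge (tau Q, tau P) := by
  simp only [NegEdge, cross2, proj, _root_.tau] at hD ⊢; linarith

theorem comb_slab (P Q : R3) (u v s h k i j l : ℝ) :
    i • pt P Q u + j • tip P Q s h k + l • pt P Q v =
      (i * (1 - u) + l * (1 - v) - j * k * (1 - s)) • P + (i * u + l * v - j * k * s) • Q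
        + (j * (1 + k) * h) • zhat := by
  simp only [pt, tip]; module

theorem pt_coord (P Q : R3) (r : ℝ) : pt P Q r = (1 - r) • P + r • Q + (0 : ℝ) • zhat := by
  simp [pt]

theorem pt_injective {P Q : R3} (hD : NegEdge (P, Q)) : Function.Injective (pt P Q) := by
  intro r s h
  rw [pt_coord, pt_coord] at h
  exact (coord_inj hD h).2.1

theorem mem_slab {P Q : R3} {u v s h k : ℝ} {x : R3} :
    x ∈ slab P Q u v (tip P Q s h k) ↔ ∃ i j l : ℝ, 0 ≤ i ∧ 0 ≤ j ∧ 0 ≤ l ∧ i + j + l = 1 ∧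
      x = (i * (1 - u) + l * (1 - v) - j * k * (1 - s)) • P + (i * u + l * v - j * k * s) • Q
        + (j * (1 + k) * h) • zhat := by
  unfold slab
  rw [mem_tri]
  constructor
  · rintro ⟨i, j, l, hi, hj, hl, h1, e⟩
    exact ⟨i, j, l, hi, hj, hl, h1, by rw [← e, comb_slab]⟩
  · rintro ⟨i, j, l, hi, hj, hl, h1, e⟩
    exact ⟨i, j, l, hi, hj, hl, h1, by rw [e, comb_slab]⟩

theorem pt_mem_slab_iff {P Q : R3} (hD : NegEdge (P, Q)) {u v s h k r : ℝ} (huv : u ≤ v)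
    (hk : 0 ≤ k) : pt P Q r ∈ slab P Q u v (tip P Q s h k) ↔ u ≤ r ∧ r ≤ v := by
  rw [mem_slab]
  constructor
  · rintro ⟨i, j, l, hi, hj, hl, h1, e⟩
    rw [pt_coord] at e
    obtain ⟨e1, e2, e3⟩ := coord_inj hD e
    have hj0 : j = 0 := by
      have : j * (1 + k) = 0 := by linear_combination e1 + e2 + h1
      rcases mul_eq_zero.1 this with h | h
      · exact h
      · linarith
    subst hj0
    have hi1 : i = 1 - l := by linarith
    subst hi1
    constructor <;> nlinarith
  · rintro ⟨h1, h2⟩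
    rcases eq_or_lt_of_le huv with rfl | huv
    · refine ⟨1, 0, 0, by simp, by simp, by simp, by simp, ?_⟩
      rw [le_antisymm h2 h1, pt_coord]; simp
    · have : v - u ≠ 0 := by linarith
      refine ⟨(v - r) / (v - u), 0, (r - u) / (v - u), div_nonneg (by linarith) (by linarith),
        le_rfl, div_nonneg (by linarith) (by linarith), by field_simp; ring, ?_⟩
      rw [pt_coord, show (v - r) / (v - u) * (1 - u) + (r - u) / (v - u) * (1 - v) - 0 * k * (1 - s)
        = 1 - r by field_simp; ring, show (v - r) / (v - u) * u + (r - u) / (v - u) * v - 0 * k * s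
        = r by field_simp; ring]
      simp

theorem zhat_mem_slab {P Q : R3} {u v s h k : ℝ} (hus : u ≤ s) (hsv : s ≤ v) (huv : u < v)
    (hk : 0 ≤ k) : h • zhat ∈ slab P Q u v (tip P Q s h k) := by
  rw [mem_slab]
  have h1 : 1 + k ≠ 0 := by linarith
  have h2 : v - u ≠ 0 := by linarith
  refine ⟨k * (v - s) / ((1 + k) * (v - u)), 1 / (1 + k), k * (s - u) / ((1 + k) * (v - u)),
    div_nonneg (mul_nonneg hk (by linarith)) (mul_nonneg (by linarith) (by linarith)),
    by positivity, div_nonneg (mul_nonneg hk (by linarith)) (mul_nonneg (by linarith) (by linarith)),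
    by field_simp; ring, ?_⟩
  rw [show k * (v - s) / ((1 + k) * (v - u)) * (1 - u) + k * (s - u) / ((1 + k) * (v - u)) * (1 - v)
    - 1 / (1 + k) * k * (1 - s) = 0 by field_simp; ring,
    show k * (v - s) / ((1 + k) * (v - u)) * u + k * (s - u) / ((1 + k) * (v - u)) * v
    - 1 / (1 + k) * k * s = 0 by field_simp; ring,
    show 1 / (1 + k) * (1 + k) * h = h by field_simp]
  simp

theorem slab_convex (P Q : R3) (u v : ℝ) (t : R3) : Convex ℝ (slab P Q u v t) := convex_tri _ _ _

theorem tp_mem_slab (P Q : R3) (u v : ℝ) (t : R3) : t ∈ slab P Q u v t := mid_mem_tri _ _ _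

theorem slab_mono {P Q : R3} (hD : NegEdge (P, Q)) {u v s h k a b : ℝ} (hk : 0 ≤ k) (ha : u ≤ a)
    (hab : a ≤ b) (hb : b ≤ v) :
    slab P Q a b (tip P Q s h k) ⊆ slab P Q u v (tip P Q s h k) :=
  tri_subset (slab_convex _ _ _ _ _) ((pt_mem_slab_iff hD (by linarith) hk).2 ⟨ha, by linarith⟩)
    (tp_mem_slab _ _ _ _ _) ((pt_mem_slab_iff hD (by linarith) hk).2 ⟨by linarith, hb⟩)

theorem slab_zhat_subset {P Q : R3} (hD : NegEdge (P, Q)) {u v s h k a b : ℝ} (hk : 0 ≤ k)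
    (hus : u ≤ s) (hsv : s ≤ v) (huv : u < v) (ha : u ≤ a)
    (hab : a ≤ b) (hb : b ≤ v) :
    slab P Q a b (h • zhat) ⊆ slab P Q u v (tip P Q s h k) :=
  tri_subset (slab_convex _ _ _ _ _) ((pt_mem_slab_iff hD (by linarith) hk).2 ⟨ha, by linarith⟩)
    (zhat_mem_slab hus hsv huv hk) ((pt_mem_slab_iff hD (by linarith) hk).2 ⟨by linarith, hb⟩)

theorem tip_zero (P Q : R3) (s h : ℝ) : tip P Q s h 0 = h • zhat := by simp [tip]

theorem NC_slab {P Q : R3} (hD : NegEdge (P, Q)) {u v s h k : ℝ} (hk : 0 ≤ k) (huv : u ≠ v) :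
    NC (pt P Q u) (tip P Q s h k) (pt P Q v) := by
  intro x y e
  have h1 : (-x - y) • pt P Q u + x • tip P Q s h k + y • pt P Q v = 0 := by
    rw [← e]; module
  rw [comb_slab] at h1
  obtain ⟨e1, e2, e3⟩ := coord_zero hD h1
  have hx : x = 0 := by
    have : x * (1 + k) = 0 := by linear_combination -(e1 + e2)
    rcases mul_eq_zero.1 this with h | h
    · exact h
    · linarith
  subst hx
  refine ⟨rfl, ?_⟩
  have : y * (v - u) = 0 := by linear_combination e2
  exact (mul_eq_zero.1 this).resolve_right (sub_ne_zero.2 huv.symm)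

theorem NC.rotate {a b c : R3} (h : NC a b c) : NC b c a := by
  intro x y e
  obtain ⟨h1, h2⟩ := h (-x - y) x (by rw [← e]; module)
  exact ⟨h2, by linarith⟩

/-- Two teeth at different heights over non-overlapping bases meet at most in a base point. -/
theorem slab_inter {P Q : R3} (hD : NegEdge (P, Q)) {u v s h k u' v' s' h' k' : ℝ}
    (hk : 0 ≤ k) (hk' : 0 ≤ k') (hh : h ≠ h') (huv : u < v) (huv' : u' < v') (hv : v ≤ u') {x : R3}
    (hx : x ∈ slab P Q u v (tip P Q s h k)) (hx' : x ∈ slab P Q u' v' (tip P Q s' h' k')) :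
    x = pt P Q v ∧ u' = v := by
  rw [mem_slab] at hx hx'
  obtain ⟨i, j, l, hi, hj, hl, h1, e⟩ := hx
  obtain ⟨i', j', l', hi', hj', hl', h1', e'⟩ := hx'
  obtain ⟨e1, e2, e3⟩ := coord_inj hD (e.symm.trans e')
  have hJ : j * (1 + k) = j' * (1 + k') := by linear_combination h1 - h1' - e1 - e2
  have hj0 : j = 0 := by
    have : j * (1 + k) * (h - h') = 0 := by rw [mul_sub, e3, hJ]; ring
    rcases mul_eq_zero.1 this with h0 | h0
    · rcases mul_eq_zero.1 h0 with h0 | h0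
      · exact h0
      · linarith
    · exact absurd (sub_eq_zero.1 h0) hh
  have hj0' : j' = 0 := by
    rw [hj0, zero_mul] at hJ
    rcases mul_eq_zero.1 hJ.symm with h0 | h0
    · exact h0
    · linarith
  subst hj0 hj0'
  have hl1 : l = 1 - i := by linarith
  have hl1' : l' = 1 - i' := by linarith
  subst hl1 hl1'
  have hi0 : i * (v - u) = 0 := by nlinarith
  have hi0' : (1 - i') * (v' - u') = 0 := by nlinarith
  have hi0 := (mul_eq_zero.1 hi0).resolve_right (by linarith)
  have hi0' := (mul_eq_zero.1 hi0').resolve_right (by linarith)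
  have hi0' : i' = 1 := by linarith
  subst hi0 hi0'
  refine ⟨by rw [e, pt_coord]; simp, by linarith⟩

theorem cross_pt {P Q : R3} (r s : ℝ) :
    cross2 (proj (pt P Q r)) (proj (pt P Q s)) = (s - r) * cross2 (proj P) (proj Q) := by
  simp [cross2, proj, pt]; ring

theorem posEdge_pt {P Q : R3} (hD : NegEdge (P, Q)) {r s : ℝ} (h : s < r) :
    PosEdge (pt P Q r, pt P Q s) := by
  unfold PosEdge; unfold NegEdge at hD
  simp only [cross_pt]; simp only at hD; nlinarith

theorem posEdge_pt_tip {P Q : R3} (hD : NegEdge (P, Q)) {r s h k : ℝ} (hr : r < s) (hk : 0 < k) :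
    PosEdge (pt P Q r, tip P Q s h k) := by
  have : cross2 (proj (pt P Q r)) (proj (tip P Q s h k)) =
      -(k * (s - r)) * cross2 (proj P) (proj Q) := by
    simp [cross2, proj, pt, tip, zhat]; ring
  unfold PosEdge; unfold NegEdge at hD
  simp only at hD ⊢; rw [this]; have := mul_pos hk (sub_pos.2 hr); nlinarith

theorem posEdge_tip_pt {P Q : R3} (hD : NegEdge (P, Q)) {r s h k : ℝ} (hr : s < r) (hk : 0 < k) :
    PosEdge (tip P Q s h k, pt P Q r) := by
  have : cross2 (proj (tip P Q s h k)) (proj (pt P Q r)) =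
      -(k * (r - s)) * cross2 (proj P) (proj Q) := by
    simp [cross2, proj, pt, tip, zhat]; ring
  unfold PosEdge; unfold NegEdge at hD
  simp only at hD ⊢; rw [this]; have := mul_pos hk (sub_pos.2 hr); nlinarith

/-! ### Configurations of teeth -/

/-- The standing assumptions on the link `M` and its negative edge `PQ`. -/
structure Ctx (M : PolyLink) (P Q : R3) : Prop where
  link : IsLink M
  symm : StronglyInvolutive M
  gen : ∀ e ∈ M, cross2 (proj e.1) (proj e.2) ≠ 0
  mem : (P, Q) ∈ M
  neg : NegEdge (P, Q)
  ne : (P, Q) ≠ (tau Q, tau P)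

/-- The edges of `M` other than `PQ` and its mirror image. -/
def rest (M : PolyLink) (P Q : R3) : PolyLink := (M.erase (P, Q)).erase (tau Q, tau P)

theorem Ctx.mem_rest {M : PolyLink} {P Q : R3} (hC : Ctx M P Q) {f : R3 × R3} :
    f ∈ rest M P Q ↔ f ∈ M ∧ f ≠ (P, Q) ∧ f ≠ (tau Q, tau P) := by
  unfold rest
  rw [(hC.link.1.erase _).mem_erase_iff, hC.link.1.mem_erase_iff]; tauto

theorem Ctx.symm_rest {M : PolyLink} {P Q : R3} (hC : Ctx M P Q) : TauSymm (rest M P Q) := by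
  intro f hf
  rw [hC.mem_rest] at hf ⊢
  refine ⟨hC.symm f hf.1, ?_, ?_⟩
  · intro h
    rw [Prod.mk.injEq, tau_eq_comm, tau_eq_comm] at h
    exact hf.2.2 (Prod.ext h.2 h.1)
  · intro h
    rw [Prod.mk.injEq, tau_inj, tau_inj] at h
    exact hf.2.1 (Prod.ext h.2 h.1)

theorem Ctx.mirror {M : PolyLink} {P Q : R3} (hC : Ctx M P Q) : Ctx M (tau Q) (tau P) where
  link := hC.link
  symm := hC.symm
  gen := hC.gen
  mem := hC.symm _ hC.mem
  neg := hC.neg.tau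
  ne := by rw [tau_tau, tau_tau]; exact hC.ne.symm

theorem rest_mirror (M : PolyLink) (P Q : R3) : rest M (tau Q) (tau P) = rest M P Q := by
  unfold rest; rw [tau_tau, tau_tau, List.erase_comm]

/-- The slab over `[u, v]` with tip `t` meets the other edges of the link at most in `P`, `Q`. -/
def FreeOf (B : PolyLink) (P Q : R3) (u v : ℝ) (t : R3) : Prop :=
  ∀ x ∈ slab P Q u v t, x ∈ carrier B → x = P ∨ x = Q

/-- A slab meets the mirror image of another one at most in a fixed endpoint of `PQ`. -/
def TauFree (P Q : R3) (u v : ℝ) (t : R3) (u' v' : ℝ) (t' : R3) : Prop :=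
  ∀ x ∈ slab P Q u v t, tau x ∈ slab P Q u' v' t' → (x = P ∨ x = Q) ∧ tau x = x

theorem TauFree.symm {P Q : R3} {u v : ℝ} {t : R3} {u' v' : ℝ} {t' : R3}
    (h : TauFree P Q u v t u' v' t') : TauFree P Q u' v' t' u v t := by
  intro x hx hx'
  obtain ⟨h1, h2⟩ := h (tau x) hx' (by rwa [tau_tau])
  rw [tau_tau] at h2
  exact ⟨h2 ▸ h1, h2.symm⟩

theorem TauFree.mono {P Q : R3} {u v : ℝ} {t : R3} {u' v' : ℝ} {t' : R3} {a b a' b' : ℝ} {r r' : R3}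
    (h : TauFree P Q u v t u' v' t') (h1 : slab P Q a b r ⊆ slab P Q u v t)
    (h2 : slab P Q a' b' r' ⊆ slab P Q u' v' t') : TauFree P Q a b r a' b' r' :=
  fun x hx hx' => h x (h1 hx) (h2 hx')

theorem FreeOf.mono {B : PolyLink} {P Q : R3} {u v : ℝ} {t : R3} {a b : ℝ} {r : R3}
    (h : FreeOf B P Q u v t) (h1 : slab P Q a b r ⊆ slab P Q u v t) : FreeOf B P Q a b r :=
  fun x hx hx' => h x (h1 hx) hx'

/-- Two teeth have different heights and non-overlapping bases. -/
def Apart (T T' : Tooth) : Prop := T.h ≠ T'.h ∧ (T.v ≤ T'.u ∨ T'.v ≤ T.u)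

theorem Apart.symm {T T' : Tooth} (h : Apart T T') : Apart T' T := ⟨h.1.symm, h.2.symm⟩

/-- `TauFree` for teeth. -/
def TauFreeT (P Q : R3) (T T' : Tooth) : Prop :=
  TauFree P Q T.u T.v (T.tp P Q) T'.u T'.v (T'.tp P Q)

theorem TauFreeT.symm {P Q : R3} {T T' : Tooth} (h : TauFreeT P Q T T') : TauFreeT P Q T' T :=
  TauFree.symm h

/-- `FreeOf` for teeth. -/
def FreeOfT (B : PolyLink) (P Q : R3) (T : Tooth) : Prop := FreeOf B P Q T.u T.v (T.tp P Q)

/-- A family of teeth which can be added to the link simultaneously. -/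
structure Good (B : PolyLink) (P Q : R3) (l : List Tooth) : Prop where
  ok : ∀ T ∈ l, T.Ok
  free : ∀ T ∈ l, FreeOfT B P Q T
  sep : l.Pairwise Apart
  tau : ∀ T ∈ l, ∀ T' ∈ l, TauFreeT P Q T T'

theorem Good.perm {B : PolyLink} {P Q : R3} {l l' : List Tooth} (h : Good B P Q l)
    (hp : l.Perm l') : Good B P Q l' where
  ok T hT := h.ok T (hp.mem_iff.2 hT)
  free T hT := h.free T (hp.mem_iff.2 hT)
  sep := (hp.pairwise_iff (fun h => Apart.symm h)).1 h.sep
  tau T hT T' hT' := h.tau T (hp.mem_iff.2 hT) T' (hp.mem_iff.2 hT')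

/-- The edges of a tooth and its mirror image. -/
def Tooth.edges (P Q : R3) (T : Tooth) : PolyLink :=
  [(pt P Q T.u, T.tp P Q), (T.tp P Q, pt P Q T.v), (tau (pt P Q T.v), tau (T.tp P Q)),
    (tau (T.tp P Q), tau (pt P Q T.u))]

/-- The edges of a family of teeth. -/
def edgesOf (P Q : R3) (l : List Tooth) : PolyLink := l.flatMap (Tooth.edges P Q)

theorem edgesOf_cons (P Q : R3) (T : Tooth) (l : List Tooth) :
    edgesOf P Q (T :: l) = T.edges P Q ++ edgesOf P Q l := by simp [edgesOf]

theorem edgesOf_perm {P Q : R3} {l l' : List Tooth} (hp : l.Perm l') :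
    (edgesOf P Q l).Perm (edgesOf P Q l') := hp.flatMap_right _

theorem Tooth.symm_edges (P Q : R3) (T : Tooth) : TauSymm (T.edges P Q) := by
  intro f hf
  simp only [Tooth.edges, List.mem_cons, List.not_mem_nil, or_false] at hf ⊢
  rcases hf with rfl | rfl | rfl | rfl <;> simp

theorem symm_edgesOf (P Q : R3) (l : List Tooth) : TauSymm (edgesOf P Q l) := by
  intro f hf
  simp only [edgesOf, List.mem_flatMap] at hf ⊢
  obtain ⟨T, hT, hf⟩ := hf
  exact ⟨T, hT, T.symm_edges P Q f hf⟩

theorem Tooth.mem_carrier_edges {P Q : R3} {T : Tooth} {x : R3} (h : x ∈ carrier (T.edges P Q)) :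
    x ∈ T.body P Q ∨ tau x ∈ T.body P Q := by
  rw [mem_carrier] at h
  obtain ⟨f, hf, hx⟩ := h
  simp only [Tooth.edges, List.mem_cons, List.not_mem_nil, or_false] at hf
  rcases hf with rfl | rfl | rfl | rfl
  · exact Or.inl (seg_subset_tri₁₂ _ _ _ hx)
  · exact Or.inl (seg_subset_tri₂₃ _ _ _ hx)
  · refine Or.inr (seg_subset_tri₂₃ _ _ _ ?_)
    rw [segment_symm]; exact mem_seg_tau.1 hx
  · refine Or.inr (seg_subset_tri₁₂ _ _ _ ?_)
    rw [segment_symm]; exact mem_seg_tau.1 hx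

theorem mem_carrier_edgesOf {P Q : R3} {l : List Tooth} {x : R3} (h : x ∈ carrier (edgesOf P Q l)) :
    ∃ T ∈ l, x ∈ T.body P Q ∨ tau x ∈ T.body P Q := by
  rw [mem_carrier] at h
  obtain ⟨f, hf, hx⟩ := h
  simp only [edgesOf, List.mem_flatMap] at hf
  obtain ⟨T, hT, hf⟩ := hf
  exact ⟨T, hT, T.mem_carrier_edges (mem_carrier.2 ⟨f, hf, hx⟩)⟩

/-- The link obtained by adding a family of teeth. -/
def state (M : PolyLink) (P Q : R3) (l : List Tooth) : PolyLink := rest M P Q ++ edgesOf P Q l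

theorem state_perm {M : PolyLink} {P Q : R3} {l l' : List Tooth} (hp : l.Perm l') :
    (state M P Q l).Perm (state M P Q l') := (edgesOf_perm hp).append_left _

theorem sep_inter {P Q : R3} (hD : NegEdge (P, Q)) {T T' : Tooth} (hT : T.Ok) (hT' : T'.Ok)
    (hs : Apart T T') {x : R3} (hx : x ∈ T.body P Q) (hx' : x ∈ T'.body P Q) :
    x = pt P Q T.u ∨ x = pt P Q T.v := by
  rcases hs.2 with h | h
  · exact Or.inr (slab_inter hD hT.k0.le hT'.k0.le hs.1 (hT.us.trans hT.sv) (hT'.us.trans hT'.sv)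
      h hx hx').1
  · have := (slab_inter hD hT'.k0.le hT.k0.le hs.1.symm (hT'.us.trans hT'.sv) (hT.us.trans hT.sv)
      h hx' hx)
    exact Or.inl (by rw [this.2]; exact this.1)

/-- A point of a tooth which is an endpoint of `PQ` is an endpoint of the base. -/
theorem body_end {P Q : R3} (hD : NegEdge (P, Q)) {T : Tooth} (hT : T.Ok) {x : R3}
    (hx : x ∈ T.body P Q) (h : x = P ∨ x = Q) : x = pt P Q T.u ∨ x = pt P Q T.v := by
  have huv : T.u ≤ T.v := (hT.us.trans hT.sv).le
  rcases h with rfl | rfl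
  · have h0 : pt x Q 0 ∈ slab x Q T.u T.v (T.tp x Q) := by rw [pt_zero]; exact hx
    have := (pt_mem_slab_iff hD huv hT.k0.le).1 h0
    left; rw [le_antisymm this.1 hT.u0, pt_zero]
  · have h0 : pt P x 1 ∈ slab P x T.u T.v (T.tp P x) := by rw [pt_one]; exact hx
    have := (pt_mem_slab_iff hD huv hT.k0.le).1 h0
    right; rw [le_antisymm hT.v1 this.2, pt_one]

theorem Good.body_inter {M : PolyLink} {P Q : R3} (hD : NegEdge (P, Q)) {T : Tooth} {r : List Tooth}
    (h : Good (rest M P Q) P Q (T :: r)) {x : R3} (hx : x ∈ T.body P Q)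
    (hx' : x ∈ carrier (rest M P Q ++ edgesOf P Q r)) : x = pt P Q T.u ∨ x = pt P Q T.v := by
  have hT := h.ok T (by simp)
  rw [carrier_append] at hx'
  rcases hx' with hx' | hx'
  · exact body_end hD hT hx (h.free T (by simp) x hx hx')
  · obtain ⟨T', hT', hx' | hx'⟩ := mem_carrier_edgesOf hx'
    · exact sep_inter hD hT (h.ok T' (by simp [hT'])) ((List.pairwise_cons.1 h.sep).1 T' hT') hx hx'
    · exact body_end hD hT hx (h.tau T (by simp) T' (by simp [hT']) x hx hx').1

/-! ### Splitting a tooth by a `W̃` move -/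

theorem splitR_free {M : PolyLink} {P Q : R3} (hD : NegEdge (P, Q)) {T T2 : Tooth}
    {r : List Tooth} (hv : T2.v = T.v) (h : Good (rest M P Q) P Q (T :: r))
    (h2 : Good (rest M P Q) P Q ({T with v := T2.u} :: T2 :: r)) :
    (∀ x ∈ tri (T.tp P Q) (pt P Q T2.u) (pt P Q T2.v),
      x ∈ carrier (rest M P Q ++ edgesOf P Q r ++
        [(pt P Q T.u, T.tp P Q), (tau (T.tp P Q), tau (pt P Q T.u))]) →
      x = T.tp P Q ∨ x = pt P Q T2.v) ∧
    (∀ x ∈ tri (T.tp P Q) (pt P Q T2.u) (pt P Q T2.v),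
      tau x ∈ tri (T.tp P Q) (pt P Q T2.u) (pt P Q T2.v) → x = T.tp P Q ∨ x = pt P Q T2.v) := by
  have hT := h.ok T (by simp)
  have hT1 := h2.ok {T with v := T2.u} (by simp)
  have hT2 := h2.ok T2 (by simp)
  have h1 := hT1.sv
  have h3 := hT2.us
  have h4 := hT2.sv
  have h5 := hT.us
  simp only at h1
  have hsub : tri (T.tp P Q) (pt P Q T2.u) (pt P Q T2.v) ⊆ T.body P Q := by
    refine tri_subset (slab_convex _ _ _ _ _) (tp_mem_slab _ _ _ _ _) ?_ ?_
    · exact (pt_mem_slab_iff hD (by linarith) hT.k0.le).2 ⟨by linarith, by linarith⟩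
    · exact (pt_mem_slab_iff hD (by linarith) hT.k0.le).2 ⟨by linarith, by linarith⟩
  have hnu : ∀ x ∈ tri (T.tp P Q) (pt P Q T2.u) (pt P Q T2.v), x ≠ pt P Q T.u := by
    rintro x hx rfl
    have hx' : pt P Q T.u ∈ slab P Q T2.u T2.v (tip P Q T.s T.h T.k) := by
      refine tri_subset (slab_convex _ _ _ _ _) (tp_mem_slab _ _ _ _ _) ?_ ?_ hx
      · exact left_mem_tri _ _ _
      · exact right_mem_tri _ _ _
    have := (pt_mem_slab_iff hD (by linarith) hT.k0.le).1 hx'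
    linarith [this.1]
  have hend : ∀ x ∈ tri (T.tp P Q) (pt P Q T2.u) (pt P Q T2.v),
      (x = pt P Q T.u ∨ x = pt P Q T.v) → x = pt P Q T2.v := by
    rintro x hx (h' | h')
    · exact absurd h' (hnu x hx)
    · rw [hv]; exact h'
  constructor
  · intro x hx hx'
    rw [carrier_append] at hx'
    rcases hx' with hx' | hx'
    · exact Or.inr (hend x hx (h.body_inter hD (hsub hx) hx'))
    · rw [mem_carrier] at hx'
      simp only [List.mem_cons, List.not_mem_nil, or_false, exists_eq_or_imp, exists_eq_left] at hx'
      rcases hx' with hx' | hx'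
      · left
        obtain ⟨i, j, hi, hj, hij, e⟩ := hx'
        obtain ⟨a, b, c, ha, hb, hc, habc, e'⟩ := mem_tri.1 hx
        have e'' : (0 : ℝ) • pt P Q T.u + a • tip P Q T.s T.h T.k + (0 : ℝ) • pt P Q T.v
          + b • pt P Q T2.u + c • pt P Q T2.v = i • pt P Q T.u + j • tip P Q T.s T.h T.k
            + (0 : ℝ) • pt P Q T.v := by
          rw [zero_smul, zero_smul, zero_add, add_zero, add_zero]
          exact e'.trans e.symm
        rw [comb_slab, comb_slab, pt_coord, pt_coord] at e''
        obtain ⟨e1, e2, e3⟩ := coord_inj hD (a := -a * T.k * (1 - T.s) + b * (1 - T2.u) +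
          c * (1 - T2.v)) (b := -a * T.k * T.s + b * T2.u + c * T2.v) (c := a * (1 + T.k) * T.h)
          (Eq.trans (by module) e'')
        have hk := hT.k0
        have hja : j = a := by
          have : (1 + T.k) * (j - a) = 0 := by linear_combination e1 + e2 - habc + hij
          rcases mul_eq_zero.1 this with h | h <;> linarith
        subst hja
        have hi : i = b + c := by linarith
        subst hi
        have : b * (T2.u - T.u) + c * (T2.v - T.u) = 0 := by linear_combination e2
        have hb0 : b * (T2.u - T.u) = 0 := by nlinarith
        have hb0 := (mul_eq_zero.1 hb0).resolve_right (by linarith)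
        subst hb0
        have hc0 : c * (T2.v - T.u) = 0 := by nlinarith
        have hc0 := (mul_eq_zero.1 hc0).resolve_right (by linarith)
        subst hc0
        rw [← e', show j = 1 by linarith]; simp
      · right
        rw [mem_seg_tau] at hx'
        refine hend x hx (body_end hD hT (hsub hx) (h.tau T (by simp) T (by simp) x (hsub hx) ?_).1)
        rw [segment_symm] at hx'
        exact seg_subset_tri₁₂ _ _ _ hx'
  · intro x hx hx'
    exact Or.inr (hend x hx (body_end hD hT (hsub hx)
      (h.tau T (by simp) T (by simp) x (hsub hx) (hsub hx')).1))

theorem splitR {M : PolyLink} {P Q : R3} (hC : Ctx M P Q) {T T2 : Tooth}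
    {r : List Tooth} (hv : T2.v = T.v) (h : Good (rest M P Q) P Q (T :: r))
    (h2 : Good (rest M P Q) P Q ({T with v := T2.u} :: T2 :: r)) :
    (IsLink (state M P Q (T :: r)) ↔ IsLink (state M P Q ({T with v := T2.u} :: T2 :: r))) ∧
    ∀ L : PolyLink, L.Perm (state M P Q (T :: r)) → IsLink L →
      AdmWtil (T.tp P Q) (pt P Q T.v) (pt P Q T2.u) (T2.tp P Q) L ∧
      (applyWtil (T.tp P Q) (pt P Q T.v) (pt P Q T2.u) (T2.tp P Q) L).Perm
        (state M P Q ({T with v := T2.u} :: T2 :: r)) := by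
  have hD := hC.neg
  have hT := h.ok T (by simp)
  have hT1 := h2.ok {T with v := T2.u} (by simp)
  have hT2 := h2.ok T2 (by simp)
  obtain ⟨hR, ht⟩ := splitR_free hD hv h h2
  have h1 := hT1.sv
  simp only at h1
  have h3 := hT2.us.trans hT2.sv
  rw [← hv]
  set R := rest M P Q ++ edgesOf P Q r ++
        [(pt P Q T.u, T.tp P Q), (tau (T.tp P Q), tau (pt P Q T.u))] with hRdef
  have hsR : TauSymm R := by
    refine (hC.symm_rest.append (symm_edgesOf P Q r)).append ?_
    intro f hf
    simp only [List.mem_cons, List.not_mem_nil, or_false] at hf ⊢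
    rcases hf with rfl | rfl <;> simp
  have hnc1 : NC (T.tp P Q) (pt P Q T2.u) (pt P Q T2.v) :=
    (NC_slab hD (s := T.s) (h := T.h) hT.k0.le h3.ne').rotate
  set R2 := R ++ [(T.tp P Q, pt P Q T2.u), (tau (pt P Q T2.u), tau (T.tp P Q))] with hR2def
  have hsR2 : TauSymm R2 := by
    refine hsR.append ?_
    intro f hf
    simp only [List.mem_cons, List.not_mem_nil, or_false] at hf ⊢
    rcases hf with rfl | rfl <;> simp
  have hnc2 : NC (pt P Q T2.u) (T2.tp P Q) (pt P Q T2.v) := NC_slab hD hT2.k0.le h3.ne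
  have hgp : Good (rest M P Q) P Q (T2 :: {T with v := T2.u} :: r) := h2.perm (List.Perm.swap ..)
  have hRp2 : R2.Perm (rest M P Q ++ edgesOf P Q ({T with v := T2.u} :: r)) := by
    rw [List.perm_iff_count]; intro x
    simp only [hR2def, hRdef, edgesOf_cons, Tooth.edges, Tooth.tp, List.count_append,
      List.count_cons, List.count_nil]
    omega
  have hR2 : ∀ x ∈ tri (pt P Q T2.u) (T2.tp P Q) (pt P Q T2.v), x ∈ carrier R2 →
      x = pt P Q T2.u ∨ x = pt P Q T2.v := by
    intro x hx hx'
    rw [carrier_perm hRp2] at hx'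
    exact hgp.body_inter hD hx hx'
  have ht2 : ∀ x ∈ tri (pt P Q T2.u) (T2.tp P Q) (pt P Q T2.v),
      tau x ∈ tri (pt P Q T2.u) (T2.tp P Q) (pt P Q T2.v) →
      x = pt P Q T2.u ∨ x = pt P Q T2.v := by
    intro x hx hx'
    exact body_end hD hT2 hx (h2.tau T2 (by simp) T2 (by simp) x hx hx').1
  have p1 : (state M P Q (T :: r)).Perm (R ++ [(T.tp P Q, pt P Q T2.v),
      (tau (pt P Q T2.v), tau (T.tp P Q))]) := by
    rw [List.perm_iff_count]; intro x
    simp only [state, hRdef, edgesOf_cons, Tooth.edges, List.count_append, hv,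
      List.count_cons, List.count_nil]
    omega
  have p2 : (R ++ [(T.tp P Q, pt P Q T2.u), (pt P Q T2.u, pt P Q T2.v),
      (tau (pt P Q T2.v), tau (pt P Q T2.u)), (tau (pt P Q T2.u), tau (T.tp P Q))]).Perm
      (R2 ++ [(pt P Q T2.u, pt P Q T2.v), (tau (pt P Q T2.v), tau (pt P Q T2.u))]) := by
    rw [List.perm_iff_count]; intro x
    simp only [hR2def, List.count_append, List.count_cons, List.count_nil]
    omega
  have p3 : (R2 ++ [(pt P Q T2.u, T2.tp P Q), (T2.tp P Q, pt P Q T2.v),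
      (tau (pt P Q T2.v), tau (T2.tp P Q)), (tau (T2.tp P Q), tau (pt P Q T2.u))]).Perm
      (state M P Q ({T with v := T2.u} :: T2 :: r)) := by
    rw [List.perm_iff_count]; intro x
    simp only [hR2def, hRdef, state, edgesOf_cons, Tooth.edges, Tooth.tp, List.count_append,
      List.count_cons, List.count_nil]
    omega
  have l1 := (isLink_etil hnc1 hsR hR ht).2.2
  have l2 := (isLink_etil hnc2 hsR2 hR2 ht2).2.2
  refine ⟨?_, ?_⟩
  · rw [isLink_perm p1, l1, isLink_perm p2, l2, isLink_perm p3]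
  · intro L hp hL
    obtain ⟨a1, q1⟩ := admEtil_of_perm (hp.trans p1) hL hnc1 hsR hR ht
    have hL2 : IsLink (applyEtil (T.tp P Q) (pt P Q T2.v) (pt P Q T2.u) L) := a1.2.1.2
    obtain ⟨a2, q2⟩ := admEtil_of_perm (q1.trans p2) hL2 hnc2 hsR2 hR2 ht2
    refine ⟨⟨?_, ?_, ?_, ?_, ?_, a1, a2⟩, q2.trans p3⟩
    · exact posEdge_tip_pt hD h1 hT.k0
    · exact posEdge_pt_tip hD hT2.us hT2.k0
    · exact posEdge_tip_pt hD hT2.sv hT2.k0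
    · exact posEdge_tip_pt hD (by rw [hv]; exact hT.sv) hT.k0
    · exact posEdge_pt hD h3

/-! ### The mirror image of a configuration -/

/-- The mirror image of a tooth, as a tooth over the mirror image of the edge. -/
def Tooth.mir (T : Tooth) : Tooth := ⟨1 - T.v, 1 - T.u, 1 - T.s, -T.h, T.k⟩

@[simp] theorem Tooth.mir_mir (T : Tooth) : T.mir.mir = T := by
  simp [Tooth.mir]

theorem Tooth.tp_mir (P Q : R3) (T : Tooth) : T.mir.tp (tau Q) (tau P) = tau (T.tp P Q) := by
  simp only [Tooth.tp, tau_tip, Tooth.mir]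

theorem slab_mir (P Q : R3) (u v : ℝ) (t x : R3) :
    x ∈ slab (tau Q) (tau P) (1 - v) (1 - u) (tau t) ↔ tau x ∈ slab P Q u v t := by
  unfold slab
  rw [← tau_pt, ← tau_pt, mem_tri_tau, tri_swap]

theorem freeOf_mir {B : PolyLink} (hB : TauSymm B) {P Q : R3} {u v : ℝ} {t : R3}
    (h : FreeOf B P Q u v t) : FreeOf B (tau Q) (tau P) (1 - v) (1 - u) (tau t) := by
  intro x hx hx'
  rw [slab_mir] at hx
  have := h _ hx (hB.carrier hx')
  rw [tau_eq_comm, tau_eq_comm] at this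
  exact this.symm

theorem tauFree_mir {P Q : R3} {u v u' v' : ℝ} {t t' : R3}
    (h : TauFree P Q u v t u' v' t') :
    TauFree (tau Q) (tau P) (1 - v) (1 - u) (tau t) (1 - v') (1 - u') (tau t') := by
  intro x hx hx'
  rw [slab_mir] at hx hx'
  have := h _ hx hx'
  rw [tau_eq_comm, tau_eq_comm, tau_tau] at this
  exact ⟨this.1.symm, this.2.symm⟩

theorem Good.mirror {B : PolyLink} (hB : TauSymm B) {P Q : R3} {l : List Tooth}
    (h : Good B P Q l) : Good B (_root_.tau Q) (_root_.tau P) (l.map Tooth.mir) where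
  ok := by
    intro S hS
    obtain ⟨T, hT, rfl⟩ := List.mem_map.1 hS
    have := h.ok T hT
    exact ⟨by linarith [this.v1, show T.mir.u = 1 - T.v from rfl],
      by linarith [this.sv, show T.mir.u = 1 - T.v from rfl, show T.mir.s = 1 - T.s from rfl],
      by linarith [this.us, show T.mir.v = 1 - T.u from rfl, show T.mir.s = 1 - T.s from rfl],
      by linarith [this.u0, show T.mir.v = 1 - T.u from rfl], this.k0⟩
  free := by
    intro S hS
    obtain ⟨T, hT, rfl⟩ := List.mem_map.1 hS
    have := freeOf_mir hB (h.free T hT)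
    rw [← Tooth.tp_mir] at this
    exact this
  sep := by
    refine List.Pairwise.map _ ?_ h.sep
    intro T T' hs
    refine ⟨fun h => hs.1 (neg_injective h), ?_⟩
    simp only [Tooth.mir]
    rcases hs.2 with h | h
    · right; linarith
    · left; linarith
  tau := by
    intro S hS S' hS'
    obtain ⟨T, hT, rfl⟩ := List.mem_map.1 hS
    obtain ⟨T', hT', rfl⟩ := List.mem_map.1 hS'
    have := tauFree_mir (h.tau T hT T' hT')
    rw [← Tooth.tp_mir, ← Tooth.tp_mir] at this
    exact this

theorem Tooth.edges_mir (P Q : R3) (T : Tooth) :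
    (T.mir.edges (tau Q) (tau P)).Perm (T.edges P Q) := by
  have hu : pt (tau Q) (tau P) T.mir.u = tau (pt P Q T.v) := by rw [tau_pt]; rfl
  have hv : pt (tau Q) (tau P) T.mir.v = tau (pt P Q T.u) := by rw [tau_pt]; rfl
  rw [List.perm_iff_count]; intro x
  simp only [Tooth.edges, hu, hv, Tooth.tp_mir, tau_tau, List.count_cons, List.count_nil]
  omega

theorem edgesOf_mir (P Q : R3) (l : List Tooth) :
    (edgesOf (tau Q) (tau P) (l.map Tooth.mir)).Perm (edgesOf P Q l) := by
  induction l with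
  | nil => simp [edgesOf]
  | cons T l ih =>
    rw [List.map_cons, edgesOf_cons, edgesOf_cons]
    exact (T.edges_mir P Q).append ih

theorem state_mir (M : PolyLink) (P Q : R3) (l : List Tooth) :
    (state M (tau Q) (tau P) (l.map Tooth.mir)).Perm (state M P Q l) := by
  unfold state
  rw [rest_mirror]
  exact (edgesOf_mir P Q l).append_left _

/-! ### Reachability by moves -/

/-- The relation generated by the moves of the statement and their inverses. -/
def Reach : PolyLink → PolyLink → Prop :=
  Relation.ReflTransGen
    (fun X Y => RtilStep X Y ∨ RtilStep Y X ∨ AdmWtilStep X Y ∨ AdmWtilStep Y X)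

theorem Reach.refl (L : PolyLink) : Reach L L := Relation.ReflTransGen.refl

theorem Reach.trans {L L' L'' : PolyLink} (h : Reach L L') (h' : Reach L' L'') : Reach L L'' :=
  Relation.ReflTransGen.trans h h'

theorem Reach.symm {L L' : PolyLink} (h : Reach L L') : Reach L' L := by
  induction h with
  | refl => exact Reach.refl _
  | tail _ h ih => exact Relation.ReflTransGen.head (by tauto) ih

theorem AdmWtil.reach {a d b c : R3} {L : PolyLink} (h : AdmWtil a d b c L) :
    Reach L (applyWtil a d b c L) :=
  Relation.ReflTransGen.single (Or.inr (Or.inr (Or.inl ⟨a, d, b, c, h, rfl⟩)))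

theorem applyWtil_congr {a d b c : R3} {L L' : PolyLink} (h : (tau d, tau a) ∈ L.erase (a, d))
    (h' : (tau d, tau a) ∈ L'.erase (a, d))
    (e : (L.erase (a, d)).erase (tau d, tau a) = (L'.erase (a, d)).erase (tau d, tau a)) :
    applyWtil a d b c L = applyWtil a d b c L' := by
  have : applyEtil a d b L = applyEtil a d b L' := by
    unfold applyEtil applyE
    rw [List.erase_append_left _ h, List.erase_append_left _ h', e]
  unfold applyWtil; rw [this]

/-! ### Perturbing triangles -/

theorem mem_tri_simplex {a b c x : R3} : x ∈ tri a b c ↔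
    ∃ w ∈ stdSimplex ℝ (Fin 3), w 0 • a + w 1 • b + w 2 • c = x := by
  rw [mem_tri]
  constructor
  · rintro ⟨i, j, k, hi, hj, hk, h, e⟩
    refine ⟨![i, j, k], ⟨?_, ?_⟩, by simpa using e⟩
    · intro n; fin_cases n <;> simpa
    · simp [Fin.sum_univ_three, h]
  · rintro ⟨w, ⟨h0, h1⟩, e⟩
    rw [Fin.sum_univ_three] at h1
    exact ⟨w 0, w 1, w 2, h0 0, h0 1, h0 2, h1, e⟩

theorem continuousAt_combo {X W : Type*} [TopologicalSpace X] [TopologicalSpace W] {x₀ : X}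
    {a b c : X → R3} (ha : ContinuousAt a x₀) (hb : ContinuousAt b x₀) (hc : ContinuousAt c x₀)
    (w : W) {φ : W → Fin 3 → ℝ} (hφ : ContinuousAt φ w) :
    ContinuousAt (fun z : X × W => φ z.2 0 • a z.1 + φ z.2 1 • b z.1 + φ z.2 2 • c z.1)
      (x₀, w) := by
  have hcont : Continuous fun z : (R3 × R3 × R3) × (Fin 3 → ℝ) =>
      z.2 0 • z.1.1 + z.2 1 • z.1.2.1 + z.2 2 • z.1.2.2 := by fun_prop
  have h0 : ContinuousAt (fun z : X × W => ((a z.1, b z.1, c z.1), φ z.2)) (x₀, w) :=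
    ((ha.prodMk (hb.prodMk hc)).comp (x := (x₀, w)) (f := Prod.fst) continuousAt_fst).prodMk
      (hφ.comp (x := (x₀, w)) (f := Prod.snd) continuousAt_snd)
  exact hcont.continuousAt.comp h0

/-- Disjointness of two triangles is an open condition. -/
theorem eventually_tri_disjoint {X : Type*} [TopologicalSpace X] {x₀ : X} {a b c a' b' c' : X → R3}
    (ha : ContinuousAt a x₀) (hb : ContinuousAt b x₀) (hc : ContinuousAt c x₀)
    (ha' : ContinuousAt a' x₀) (hb' : ContinuousAt b' x₀) (hc' : ContinuousAt c' x₀)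
    (h : ∀ x ∈ tri (a x₀) (b x₀) (c x₀), x ∉ tri (a' x₀) (b' x₀) (c' x₀)) :
    ∀ᶠ y in 𝓝 x₀, ∀ x ∈ tri (a y) (b y) (c y), x ∉ tri (a' y) (b' y) (c' y) := by
  have hK : IsCompact (stdSimplex ℝ (Fin 3) ×ˢ stdSimplex ℝ (Fin 3)) :=
    (isCompact_stdSimplex ℝ _).prod (isCompact_stdSimplex ℝ _)
  have := hK.eventually_forall_of_forall_eventually (x₀ := x₀)
    (P := fun (y : X) (w : (Fin 3 → ℝ) × (Fin 3 → ℝ)) =>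
      w.1 0 • a y + w.1 1 • b y + w.1 2 • c y ≠ w.2 0 • a' y + w.2 1 • b' y + w.2 2 • c' y) (by
    rintro w ⟨hw, hw'⟩
    have h1 := continuousAt_combo ha hb hc w continuous_fst.continuousAt
    have h2 := continuousAt_combo ha' hb' hc' w continuous_snd.continuousAt
    refine (h1.ne_iff_eventually_ne h2).1 ?_
    intro e
    exact h _ (mem_tri_simplex.2 ⟨w.1, hw, rfl⟩) (mem_tri_simplex.2 ⟨w.2, hw', e.symm⟩))
  filter_upwards [this] with y hy x hx hx'
  obtain ⟨w, hw, e⟩ := mem_tri_simplex.1 hx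
  obtain ⟨w', hw', e'⟩ := mem_tri_simplex.1 hx'
  exact hy (w, w') ⟨hw, hw'⟩ (e.trans e'.symm)

/-- The cone at `O` spanned by `t` and `B` is pointed and nondegenerate. -/
def ConePtd (O t B : R3) : Prop :=
  ∀ x y : ℝ, 0 ≤ x → 0 ≤ y → x • (t - O) + y • (B - O) = 0 → x = 0 ∧ y = 0

theorem NC.conePtd {O t B : R3} (h : NC O t B) : ConePtd O t B := fun x y _ _ e => h x y e

theorem pointed_seg {O g : R3} (h : g ≠ O) : ConePtd O g g := by
  intro x y hx hy e
  rw [← add_smul, smul_eq_zero] at e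
  rcases e with e | e
  · exact ⟨by linarith, by linarith⟩
  · exact absurd (sub_eq_zero.1 e) h

theorem mem_tri_vertex {O t B x : R3} : x ∈ tri O t B ↔
    ∃ i j : ℝ, 0 ≤ i ∧ 0 ≤ j ∧ i + j ≤ 1 ∧ x = O + (i • (t - O) + j • (B - O)) := by
  rw [mem_tri]
  constructor
  · rintro ⟨i, j, k, hi, hj, hk, h, rfl⟩
    refine ⟨j, k, hj, hk, by linarith, ?_⟩
    obtain rfl : i = 1 - j - k := by linarith
    module
  · rintro ⟨i, j, hi, hj, h, rfl⟩
    exact ⟨1 - i - j, i, j, by linarith, hi, hj, by ring, by module⟩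

/-- For triangles with a common vertex, meeting only there is an open condition on the tips. -/
theorem eventually_tri_vertex {O B B' : R3} {t₀ t₀' : R3} (h1 : ConePtd O t₀ B)
    (h2 : ConePtd O t₀' B') (h : ∀ x ∈ tri O t₀ B, x ∈ tri O t₀' B' → x = O) :
    ∀ᶠ y in 𝓝 (t₀, t₀'), ∀ x ∈ tri O y.1 B, x ∈ tri O y.2 B' → x = O := by
  have := (isCompact_stdSimplex ℝ (Fin 4)).eventually_forall_of_forall_eventually
    (x₀ := (t₀, t₀'))
    (P := fun (y : R3 × R3) (w : Fin 4 → ℝ) =>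
      w 0 • (y.1 - O) + w 1 • (B - O) ≠ w 2 • (y.2 - O) + w 3 • (B' - O)) (by
    rintro w ⟨hw0, hw1⟩
    rw [Fin.sum_univ_four] at hw1
    have c1 : ContinuousAt (fun z : (R3 × R3) × (Fin 4 → ℝ) =>
        z.2 0 • (z.1.1 - O) + z.2 1 • (B - O)) ((t₀, t₀'), w) := by fun_prop
    have c2 : ContinuousAt (fun z : (R3 × R3) × (Fin 4 → ℝ) =>
        z.2 2 • (z.1.2 - O) + z.2 3 • (B' - O)) ((t₀, t₀'), w) := by fun_prop
    refine (c1.ne_iff_eventually_ne c2).1 ?_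
    intro e
    simp only at e
    have := h (O + (w 0 • (t₀ - O) + w 1 • (B - O)))
      (mem_tri_vertex.2 ⟨_, _, hw0 0, hw0 1, by linarith [hw0 2, hw0 3], rfl⟩)
      (mem_tri_vertex.2 ⟨_, _, hw0 2, hw0 3, by linarith [hw0 0, hw0 1], by rw [e]⟩)
    have e0 : w 0 • (t₀ - O) + w 1 • (B - O) = 0 := by
      rwa [add_eq_left] at this
    obtain ⟨z0, z1⟩ := h1 _ _ (hw0 0) (hw0 1) e0
    obtain ⟨z2, z3⟩ := h2 _ _ (hw0 2) (hw0 3) (e ▸ e0)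
    linarith)
  filter_upwards [this] with y hy x hx hx'
  obtain ⟨i, j, hi, hj, hij, e⟩ := mem_tri_vertex.1 hx
  obtain ⟨i', j', hi', hj', hij', e'⟩ := mem_tri_vertex.1 hx'
  have e'' : i • (y.1 - O) + j • (B - O) = i' • (y.2 - O) + j' • (B' - O) :=
    add_left_cancel (e.symm.trans e')
  rcases eq_or_lt_of_le (show 0 ≤ i + j + i' + j' by linarith) with h0 | h0
  · obtain rfl : i = 0 := by linarith
    obtain rfl : j = 0 := by linarith
    simpa using e
  · exfalso
    set n := i + j + i' + j' with hn
    refine hy ![i / n, j / n, i' / n, j' / n] ⟨?_, ?_⟩ ?_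
    · intro m; fin_cases m
      · simpa using div_nonneg hi h0.le
      · simpa using div_nonneg hj h0.le
      · simpa using div_nonneg hi' h0.le
      · simpa using div_nonneg hj' h0.le
    · simp only [Fin.sum_univ_four, Matrix.cons_val]
      rw [← add_div, ← add_div, ← add_div, ← hn, div_self h0.ne']
    · have := congrArg (fun z => n⁻¹ • z) e''
      simp only [smul_add, smul_smul] at this
      simpa [div_eq_inv_mul] using this

/-! ### Perturbing slabs -/

theorem Ctx.reverse_not_mem {M : PolyLink} {P Q : R3} (hC : Ctx M P Q) : (Q, P) ∉ M := by
  intro h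
  have hne : P ≠ Q := hC.link.2.1 _ hC.mem
  have hne' : (P, Q) ≠ (Q, P) := by
    intro e; exact hne (Prod.mk.inj e).1
  have := hC.link.2.2.1 _ hC.mem _ h hne' (show pt P Q (1/2) ∈ _ from
    ⟨mem_seg.2 ⟨1/2, 1/2, by norm_num, by norm_num, by norm_num, by simp [pt]; norm_num⟩,
      mem_seg.2 ⟨1/2, 1/2, by norm_num, by norm_num, by norm_num,
        by simp [pt]; rw [add_comm]; norm_num⟩⟩)
  have h1 := this.1
  have hinj := pt_injective hC.neg
  rcases h1 with h1 | h1
  · have := @hinj (1/2) 0 (by rw [pt_zero]; exact h1); norm_num at this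
  · have := @hinj (1/2) 1 (by rw [pt_one]; exact h1); norm_num at this

/-- At most one of the endpoints of `PQ` is fixed by the involution. -/
theorem Ctx.not_both_fixed {M : PolyLink} {P Q : R3} (hC : Ctx M P Q) (h1 : tau P = P)
    (h2 : tau Q = Q) : False :=
  hC.reverse_not_mem (by simpa [h1, h2] using hC.symm _ hC.mem)

/-- An edge of the rest of the link meeting an endpoint of `PQ` ends there and avoids the other
endpoint. -/
theorem Ctx.rest_end {M : PolyLink} {P Q : R3} (hC : Ctx M P Q) {f : R3 × R3}
    (hf : f ∈ rest M P Q) :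
    (P ∈ segment ℝ f.1 f.2 → ∃ g, g ≠ P ∧ segment ℝ f.1 f.2 = tri P g g ∧
      Q ∉ segment ℝ f.1 f.2) ∧
    (Q ∈ segment ℝ f.1 f.2 → ∃ g, g ≠ Q ∧ segment ℝ f.1 f.2 = tri Q g g ∧
      P ∉ segment ℝ f.1 f.2) := by
  have hf' := hC.mem_rest.1 hf
  have htri : ∀ a b : R3, segment ℝ a b = tri a b b := by
    intro a b; unfold tri; rw [Set.pair_eq_singleton, convexHull_pair]
  have key := hC.link.2.2.1 _ hC.mem f hf'.1 hf'.2.1.symm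
  have hne := hC.link.2.1 f hf'.1
  have hboth : P ∈ segment ℝ f.1 f.2 → Q ∈ segment ℝ f.1 f.2 → False := by
    intro h1 h2
    have k1 := (key ⟨left_mem_segment _ _ _, h1⟩).2
    have k2 := (key ⟨right_mem_segment _ _ _, h2⟩).2
    have hPQ : P ≠ Q := hC.link.2.1 _ hC.mem
    simp only [mem_insert_iff, mem_singleton_iff] at k1 k2
    rcases k1 with k1 | k1 <;> rcases k2 with k2 | k2
    · exact hPQ (k1.trans k2.symm)
    · exact hf'.2.1 (Prod.ext k1.symm k2.symm)
    · refine hC.reverse_not_mem ?_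
      rw [k1, k2]; exact hf'.1
    · exact hPQ (k1.trans k2.symm)
  constructor
  · intro h
    have k := (key ⟨left_mem_segment _ _ _, h⟩).2
    simp only [mem_insert_iff, mem_singleton_iff] at k
    rcases k with k | k
    · exact ⟨f.2, by rw [k]; exact hne.symm, by rw [k, htri], hboth h⟩
    · exact ⟨f.1, by rw [k]; exact hne, by rw [k, segment_symm, htri], hboth h⟩
  · intro h
    have k := (key ⟨right_mem_segment _ _ _, h⟩).2
    simp only [mem_insert_iff, mem_singleton_iff] at k
    rcases k with k | k
    · exact ⟨f.2, by rw [k]; exact hne.symm, by rw [k, htri], fun h' => hboth h' h⟩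
    · exact ⟨f.1, by rw [k]; exact hne, by rw [k, segment_symm, htri], fun h' => hboth h' h⟩

theorem seg_eq_tri (a b : R3) : segment ℝ a b = tri a b b := by
  unfold tri; rw [Set.pair_eq_singleton, convexHull_pair]

theorem eventually_freeOf {M : PolyLink} {P Q : R3} (hC : Ctx M P Q) {u v s h k : ℝ}
    (hu : 0 ≤ u) (huv : u < v) (hv : v ≤ 1) (hk : 0 ≤ k)
    (hf : FreeOf (rest M P Q) P Q u v (tip P Q s h k)) :
    ∀ᶠ t in 𝓝 (tip P Q s h k), FreeOf (rest M P Q) P Q u v t := by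
  have hD := hC.neg
  have main : ∀ f ∈ rest M P Q, ∀ᶠ t in 𝓝 (tip P Q s h k), ∀ x ∈ slab P Q u v t,
      x ∈ segment ℝ f.1 f.2 → x = P ∨ x = Q := by
    intro f hfr
    have hf' : ∀ x ∈ slab P Q u v (tip P Q s h k), x ∈ segment ℝ f.1 f.2 → x = P ∨ x = Q :=
      fun x hx hx' => hf x hx (mem_carrier.2 ⟨f, hfr, hx'⟩)
    have hNC := NC_slab hD (s := s) (h := h) hk huv.ne
    by_cases hP : P ∈ segment ℝ f.1 f.2 ∧ u = 0
    · obtain ⟨hP, rfl⟩ := hP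
      obtain ⟨g, hg, hseg, hQ⟩ := (hC.rest_end hfr).1 hP
      rw [pt_zero] at hNC
      have := eventually_tri_vertex hNC.conePtd (pointed_seg hg) (by
        intro x hx hx'
        rcases hf' x (by unfold slab; rw [pt_zero]; exact hx) (by rw [hseg]; exact hx') with h | h
        · exact h
        · subst h; rw [hseg] at hQ; exact absurd hx' hQ)
      have := this.curry_nhds
      filter_upwards [this] with t ht x hx hx'
      left
      refine ht.self_of_nhds x ?_ ?_
      · unfold slab at hx; rwa [pt_zero] at hx
      · rwa [hseg] at hx'
    · by_cases hQ : Q ∈ segment ℝ f.1 f.2 ∧ v = 1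
      · obtain ⟨hQ, rfl⟩ := hQ
        obtain ⟨g, hg, hseg, hP'⟩ := (hC.rest_end hfr).2 hQ
        have hNC := NC_slab hD (s := s) (h := h) hk huv.ne'
        rw [pt_one] at hNC
        have := eventually_tri_vertex hNC.conePtd (pointed_seg hg) (by
          intro x hx hx'
          rcases hf' x (by unfold slab; rw [pt_one, tri_swap]; exact hx)
            (by rw [hseg]; exact hx') with h | h
          · subst h; rw [hseg] at hP'; exact absurd hx' hP'
          · exact h)
        have := this.curry_nhds
        filter_upwards [this] with t ht x hx hx'
        right
        refine ht.self_of_nhds x ?_ ?_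
        · unfold slab at hx; rwa [pt_one, tri_swap] at hx
        · rwa [hseg] at hx'
      · have := eventually_tri_disjoint (x₀ := tip P Q s h k) (a := fun _ => pt P Q u)
          (b := fun t => t) (c := fun _ => pt P Q v) (a' := fun _ => f.1) (b' := fun _ => f.2)
          (c' := fun _ => f.2) (by fun_prop) (by fun_prop) (by fun_prop) (by fun_prop)
          (by fun_prop) (by fun_prop) (by
            intro x hx hx'
            rw [← seg_eq_tri] at hx'
            have hx0 := hx
            rcases hf' x hx hx' with rfl | rfl
            · apply hP
              refine ⟨hx', le_antisymm ?_ hu⟩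
              rw [← pt_zero x Q] at hx0
              exact ((pt_mem_slab_iff (by simpa using hD) huv.le hk).1 (by simpa [slab] using hx)).1
            · apply hQ
              refine ⟨hx', le_antisymm hv ?_⟩
              exact ((pt_mem_slab_iff (P := P) (Q := x) (s := s) (h := h) (k := k) (r := 1) hD huv.le hk).1
                (by rw [pt_one]; exact hx)).2)
        filter_upwards [this] with t ht x hx hx'
        exact absurd (by rwa [← seg_eq_tri]) (ht x hx)
  have := (List.finite_toSet (rest M P Q)).eventually_all.2 main
  filter_upwards [this] with t ht x hx hx'
  obtain ⟨f, hf, hxf⟩ := mem_carrier.1 hx'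
  exact ht f hf x hx hxf

theorem eventually_tauFree {M : PolyLink} {P Q : R3} (hC : Ctx M P Q) {u v s h k u' v' s' h' k' : ℝ}
    (hu : 0 ≤ u) (huv : u < v) (hv : v ≤ 1) (hk : 0 ≤ k)
    (hu' : 0 ≤ u') (huv' : u' < v') (hv' : v' ≤ 1) (hk' : 0 ≤ k')
    (hf : TauFree P Q u v (tip P Q s h k) u' v' (tip P Q s' h' k')) :
    ∀ᶠ y in 𝓝 (tip P Q s h k, tip P Q s' h' k'), TauFree P Q u v y.1 u' v' y.2 := by
  have hD := hC.neg
  have hP0 : ∀ {u v s h k : ℝ}, 0 ≤ u → u < v → 0 ≤ k → P ∈ slab P Q u v (tip P Q s h k) →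
      u = 0 := by
    intro u v s h k hu huv hk hx
    exact le_antisymm ((pt_mem_slab_iff (r := 0) hD huv.le hk).1 (by rwa [pt_zero])).1 hu
  have hQ1 : ∀ {u v s h k : ℝ}, v ≤ 1 → u < v → 0 ≤ k → Q ∈ slab P Q u v (tip P Q s h k) →
      v = 1 := by
    intro u v s h k hu huv hk hx
    exact le_antisymm hu ((pt_mem_slab_iff (r := 1) hD huv.le hk).1 (by rwa [pt_one])).2
  have htau : Tendsto (fun y : R3 × R3 => (y.1, tau y.2))
      (𝓝 (tip P Q s h k, tip P Q s' h' k')) (𝓝 (tip P Q s h k, tau (tip P Q s' h' k'))) :=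
    (continuous_fst.prodMk (continuous_tau.comp continuous_snd)).tendsto _
  by_cases hx : ∃ x, x ∈ slab P Q u v (tip P Q s h k) ∧ tau x ∈ slab P Q u' v' (tip P Q s' h' k')
  · obtain ⟨x, hx, hx'⟩ := hx
    obtain ⟨hxe, hfix⟩ := hf x hx hx'
    rw [hfix] at hx'
    rcases hxe with rfl | rfl
    · obtain rfl := hP0 hu huv hk hx
      obtain rfl := hP0 hu' huv' hk' hx'
      have h1 := NC_slab hD (s := s) (h := h) hk huv.ne
      have h2 := (NC_slab hD (s := s') (h := h') hk' huv'.ne').tau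
      rw [pt_zero] at h1 h2
      rw [hfix] at h2
      have := eventually_tri_vertex h1.conePtd h2.conePtd (by
        intro y hy hy'
        obtain ⟨hye, hyf⟩ := hf y (by unfold slab; rwa [pt_zero]) (by
          unfold slab; rw [pt_zero, ← mem_tri_tau, hfix]; exact hy')
        rcases hye with h | h
        · exact h
        · subst h; exact (hC.not_both_fixed hfix hyf).elim)
      filter_upwards [htau.eventually this] with y hy z hz hz'
      have : z = x := by
        refine hy z (by unfold slab at hz; rwa [pt_zero] at hz) ?_
        unfold slab at hz'; rwa [pt_zero, ← mem_tri_tau, hfix] at hz'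
      subst this; exact ⟨Or.inl rfl, hfix⟩
    · obtain rfl := hQ1 hv huv hk hx
      obtain rfl := hQ1 hv' huv' hk' hx'
      have h1 := NC_slab hD (s := s) (h := h) hk huv.ne'
      have h2 := (NC_slab hD (s := s') (h := h') hk' huv'.ne).tau
      rw [pt_one] at h1 h2
      rw [hfix] at h2
      have := eventually_tri_vertex h1.conePtd h2.conePtd (by
        intro y hy hy'
        obtain ⟨hye, hyf⟩ := hf y (by unfold slab; rwa [pt_one, tri_swap]) (by
          unfold slab; rw [pt_one, ← mem_tri_tau, hfix, tri_swap]; exact hy')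
        rcases hye with h | h
        · subst h; exact (hC.not_both_fixed hyf hfix).elim
        · exact h)
      filter_upwards [htau.eventually this] with y hy z hz hz'
      have : z = x := by
        refine hy z (by unfold slab at hz; rwa [pt_one, tri_swap] at hz) ?_
        unfold slab at hz'; rwa [pt_one, ← mem_tri_tau, hfix, tri_swap] at hz'
      subst this; exact ⟨Or.inr rfl, hfix⟩
  · push Not at hx
    have := eventually_tri_disjoint (x₀ := (tip P Q s h k, tau (tip P Q s' h' k')))
      (a := fun _ => pt P Q u) (b := fun t => t.1) (c := fun _ => pt P Q v)
      (a' := fun _ => tau (pt P Q u')) (b' := fun t => t.2) (c' := fun _ => tau (pt P Q v'))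
      continuousAt_const continuousAt_fst continuousAt_const continuousAt_const continuousAt_snd
      continuousAt_const (by
        intro x hx1 hx2
        exact hx x hx1 (mem_tri_tau.1 hx2))
    filter_upwards [htau.eventually this] with y hy z hz hz'
    exact absurd (mem_tri_tau.2 hz') (hy z hz)

/-! ### Bumping teeth -/

/-- Move the height and the length of a tooth linearly. -/
def Tooth.bump (T : Tooth) (c d η : ℝ) : Tooth := ⟨T.u, T.v, T.s, T.h + η * c, T.k + η * d⟩

@[simp] theorem Tooth.bump_zero (T : Tooth) (η : ℝ) : T.bump 0 0 η = T := by
  simp [Tooth.bump]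

theorem Tooth.tendsto_bump (P Q : R3) (T : Tooth) (c d : ℝ) :
    Tendsto (fun η => (T.bump c d η).tp P Q) (𝓝 0) (𝓝 (T.tp P Q)) := by
  have : Continuous fun η => (T.bump c d η).tp P Q := by
    unfold Tooth.bump Tooth.tp tip; dsimp only; fun_prop
  have h := this.tendsto 0
  simpa [Tooth.bump] using h

/-- A possibly degenerate tooth. -/
structure Tooth.WOk (T : Tooth) : Prop where
  u0 : 0 ≤ T.u
  uv : T.u < T.v
  v1 : T.v ≤ 1
  k0 : 0 ≤ T.k

theorem Tooth.Ok.wOk {T : Tooth} (h : T.Ok) : T.WOk :=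
  ⟨h.u0, h.us.trans h.sv, h.v1, h.k0.le⟩

theorem eventually_freeOfT {M : PolyLink} {P Q : R3} (hC : Ctx M P Q) {T : Tooth} (hT : T.WOk)
    (h : FreeOfT (rest M P Q) P Q T) (c d : ℝ) :
    ∀ᶠ η in 𝓝[>] (0:ℝ), FreeOfT (rest M P Q) P Q (T.bump c d η) :=
  ((T.tendsto_bump P Q c d).mono_left nhdsWithin_le_nhds).eventually
    (eventually_freeOf hC hT.u0 hT.uv hT.v1 hT.k0 h)

theorem eventually_tauFreeT {M : PolyLink} {P Q : R3} (hC : Ctx M P Q) {T T' : Tooth}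
    (hT : T.WOk) (hT' : T'.WOk) (h : TauFreeT P Q T T') (c d c' d' : ℝ) :
    ∀ᶠ η in 𝓝[>] (0:ℝ), TauFreeT P Q (T.bump c d η) (T'.bump c' d' η) :=
  (((T.tendsto_bump P Q c d).prodMk_nhds (T'.tendsto_bump P Q c' d')).mono_left
    nhdsWithin_le_nhds).eventually
    (eventually_tauFree hC hT.u0 hT.uv hT.v1 hT.k0 hT'.u0 hT'.uv hT'.v1 hT'.k0 h)

theorem eventually_ne_bump {a b c d : ℝ} (h : a ≠ b) :
    ∀ᶠ η in 𝓝[>] (0:ℝ), a + η * c ≠ b + η * d := by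
  have h1 : ContinuousAt (fun η : ℝ => a + η * c) 0 := by fun_prop
  have h2 : ContinuousAt (fun η : ℝ => b + η * d) 0 := by fun_prop
  exact ((h1.ne_iff_eventually_ne h2).1 (by simpa using h)).filter_mono nhdsWithin_le_nhds

/-- Any tooth can be split by cutting off a small tooth on its right. -/
theorem Good.exists_split {M : PolyLink} {P Q : R3} (hC : Ctx M P Q) {T : Tooth} {r : List Tooth}
    (h : Good (rest M P Q) P Q (T :: r)) :
    ∃ T2 : Tooth, T2.v = T.v ∧ Good (rest M P Q) P Q ({T with v := T2.u} :: T2 :: r) := by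
  have hD := hC.neg
  have hT := h.ok T (by simp)
  obtain ⟨hu, hus, hsv, hv, hk⟩ := hT
  set w := (T.s + T.v) / 2 with hw
  have hsw : T.s < w := by rw [hw]; linarith
  have hwv : w < T.v := by rw [hw]; linarith
  set s' := (w + T.v) / 2 with hs'
  have hws : w < s' := by rw [hs']; linarith
  have hsv' : s' < T.v := by rw [hs']; linarith
  set T0 : Tooth := ⟨w, T.v, s', T.h, 0⟩ with hT0
  have hW0 : T0.WOk := ⟨by simp only [hT0]; linarith, hwv, hv, le_rfl⟩
  set T1 : Tooth := {T with v := w} with hT1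
  have hO1 : T1.Ok := ⟨hu, hus, hsw, hwv.le.trans hv, hk⟩
  have sub0 : slab P Q T0.u T0.v (T0.tp P Q) ⊆ slab P Q T.u T.v (T.tp P Q) := by
    have : T0.tp P Q = T.h • zhat := tip_zero P Q s' T.h
    rw [this]
    exact slab_zhat_subset hD hk.le hus.le hsv.le (hus.trans hsv) (by simp only [hT0]; linarith)
      hwv.le le_rfl
  have sub1 : slab P Q T1.u T1.v (T1.tp P Q) ⊆ slab P Q T.u T.v (T.tp P Q) :=
    slab_mono hD hk.le le_rfl (by simp only [hT1]; linarith) hwv.le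
  have free1 : FreeOfT (rest M P Q) P Q T1 := (h.free T (by simp)).mono sub1
  have ev1 := eventually_freeOfT hC hW0 ((h.free T (by simp)).mono sub0 :
    FreeOfT (rest M P Q) P Q T0) 1 1
  have ev2 := eventually_tauFreeT hC hW0 hW0 ((h.tau T (by simp) T (by simp)).mono sub0 sub0 :
    TauFreeT P Q T0 T0) 1 1 1 1
  have ev3 := eventually_tauFreeT hC hO1.wOk hW0 ((h.tau T (by simp) T (by simp)).mono sub1 sub0 :
    TauFreeT P Q T1 T0) 0 0 1 1
  have ev4 := (List.finite_toSet r).eventually_all.2 (fun (R : Tooth) (hR : R ∈ r) =>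
    (eventually_tauFreeT hC (h.ok R (by simp [hR])).wOk hW0
      ((h.tau R (by simp [hR]) T (by simp)).mono subset_rfl sub0 : TauFreeT P Q R T0) 0 0 1 1).and
    (eventually_ne_bump (c := 1) (d := 0) ((List.pairwise_cons.1 h.sep).1 R hR).1))
  obtain ⟨η, ⟨⟨⟨e1, e2⟩, e3⟩, e4⟩, hη : (0:ℝ) < η⟩ :=
    ((((ev1.and ev2).and ev3).and ev4).and self_mem_nhdsWithin).exists
  simp only [Tooth.bump_zero] at e3 e4
  refine ⟨T0.bump 1 1 η, rfl, ?_, ?_, ?_, ?_⟩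
  · intro R hR
    simp only [List.mem_cons] at hR
    rcases hR with rfl | rfl | hR
    · exact hO1
    · exact ⟨hW0.u0, hws, hsv', hv, by simp [Tooth.bump, hT0, hη]⟩
    · exact h.ok R (by simp [hR])
  · intro R hR
    simp only [List.mem_cons] at hR
    rcases hR with rfl | rfl | hR
    · exact free1
    · exact e1
    · exact h.free R (by simp [hR])
  · have hp := List.pairwise_cons.1 h.sep
    refine List.pairwise_cons.2 ⟨?_, List.pairwise_cons.2 ⟨?_, hp.2⟩⟩
    · intro R hR
      simp only [List.mem_cons] at hR
      rcases hR with rfl | hR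
      · exact ⟨by simp [Tooth.bump, hT0, hη.ne'], Or.inl le_rfl⟩
      · refine ⟨(hp.1 R hR).1, (hp.1 R hR).2.imp (fun h' => ?_) id⟩
        exact hwv.le.trans h'
    · intro R hR
      refine ⟨by simpa [Tooth.bump, hT0] using (e4 R hR).2, (hp.1 R hR).2.imp id (fun h' => ?_)⟩
      exact h'.trans (by simp only [Tooth.bump, hT0]; linarith)
  · have a11 : TauFreeT P Q T1 T1 := (h.tau T (by simp) T (by simp)).mono sub1 sub1
    have a1r : ∀ R ∈ r, TauFreeT P Q T1 R := fun R hR =>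
      (h.tau T (by simp) R (by simp [hR])).mono sub1 subset_rfl
    have a2r : ∀ R ∈ r, TauFreeT P Q (T0.bump 1 1 η) R := fun R hR => (e4 R hR).1.symm
    intro R hR R' hR'
    simp only [List.mem_cons] at hR hR'
    rcases hR with rfl | rfl | hR <;> rcases hR' with rfl | rfl | hR'
    · exact a11
    · exact e3
    · exact a1r _ hR'
    · exact e3.symm
    · exact e2
    · exact a2r _ hR'
    · exact (a1r _ hR).symm
    · exact (a2r _ hR).symm
    · exact h.tau R (by simp [hR]) R' (by simp [hR'])

/-! ### Reordering edges -/

theorem exists_move_tip {M : PolyLink} {P Q : R3} (hC : Ctx M P Q) {T : Tooth} {r : List Tooth}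
    (h : Good (rest M P Q) P Q (T :: r)) (hL : IsLink (state M P Q (T :: r))) :
    ∃ b c : R3, (T.tp P Q, pt P Q T.v) ≠ (tau (pt P Q T.v), tau (T.tp P Q)) ∧
      ∀ L : PolyLink, L.Perm (state M P Q (T :: r)) → AdmWtil (T.tp P Q) (pt P Q T.v) b c L := by
  obtain ⟨T2, hv, h2⟩ := h.exists_split hC
  refine ⟨_, _, ?_, fun L hp => ((splitR hC hv h h2).2 L hp (hL.perm hp.symm)).1⟩
  have := hL.1
  rw [state, edgesOf_cons, List.nodup_append, List.nodup_append] at this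
  have := this.2.1.1
  simp only [Tooth.edges, List.nodup_cons, List.mem_cons] at this
  tauto

/-- The pair of an edge of a tooth and its mirror image takes part in some move. -/
theorem exists_move {M : PolyLink} {P Q : R3} (hC : Ctx M P Q) {l : List Tooth}
    (h : Good (rest M P Q) P Q l) (hL : IsLink (state M P Q l)) {f : R3 × R3}
    (hf : f ∈ edgesOf P Q l) :
    ∃ a d b c : R3, (f = (a, d) ∨ f = (tau d, tau a)) ∧ (a, d) ≠ (tau d, tau a) ∧
      ∀ L : PolyLink, L.Perm (state M P Q l) → AdmWtil a d b c L := by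
  obtain ⟨T, hT, hf⟩ := List.mem_flatMap.1 hf
  obtain ⟨r, hr⟩ : ∃ r, l.Perm (T :: r) := by
    obtain ⟨A, B, rfl⟩ := List.append_of_mem hT
    exact ⟨A ++ B, List.perm_middle⟩
  have h' := h.perm hr
  have hL' := hL.perm (state_perm hr)
  have hm := h'.mirror hC.symm_rest
  have hp := state_mir M P Q (T :: r)
  rw [← rest_mirror M P Q] at hm
  rw [List.map_cons] at hm hp
  obtain ⟨b, c, hne, hadm⟩ := exists_move_tip hC h' hL'
  obtain ⟨b', c', hne', hadm'⟩ := exists_move_tip hC.mirror hm (hL'.perm hp.symm)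
  have hX : pt (tau Q) (tau P) T.mir.v = tau (pt P Q T.u) := by rw [tau_pt]; rfl
  rw [Tooth.tp_mir, hX, tau_tau, tau_tau] at hne'
  rw [Tooth.tp_mir, hX] at hadm'
  simp only [Tooth.edges, List.mem_cons, List.not_mem_nil, or_false] at hf
  rcases hf with hf | hf | hf | hf
  · exact ⟨_, _, b', c', Or.inr (by rw [hf, tau_tau, tau_tau]), by rwa [tau_tau, tau_tau],
      fun L hL => hadm' L ((hL.trans (state_perm hr)).trans hp.symm)⟩
  · exact ⟨_, _, b, c, Or.inl hf, hne, fun L hL => hadm L (hL.trans (state_perm hr))⟩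
  · exact ⟨_, _, b, c, Or.inr hf, hne, fun L hL => hadm L (hL.trans (state_perm hr))⟩
  · exact ⟨_, _, b', c', Or.inl hf, by rwa [tau_tau, tau_tau],
      fun L hL => hadm' L ((hL.trans (state_perm hr)).trans hp.symm)⟩

theorem reach_swap {a d b c : R3} {A B : PolyLink} {f g : R3 × R3}
    (hf : f = (a, d) ∨ f = (tau d, tau a)) (hne : (a, d) ≠ (tau d, tau a))
    (h : AdmWtil a d b c (A ++ f :: g :: B)) (h' : AdmWtil a d b c (A ++ g :: f :: B))
    (hm : (a, d) ∈ A ++ f :: g :: B) (hm' : (tau d, tau a) ∈ A ++ f :: g :: B)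
    (hnd : (A ++ f :: g :: B).Nodup) : Reach (A ++ f :: g :: B) (A ++ g :: f :: B) := by
  have hp : (A ++ f :: g :: B).Perm (A ++ g :: f :: B) := (List.Perm.swap _ _ _).append_left _
  have hfg : g ≠ f := by
    rw [List.nodup_append] at hnd
    have := hnd.2.1
    simp only [List.nodup_cons, List.mem_cons] at this
    tauto
  have hfA : f ∉ A := by
    rw [List.nodup_append] at hnd
    exact fun hA => hnd.2.2 f hA f (by simp) rfl
  have e0 : (A ++ f :: g :: B).erase f = (A ++ g :: f :: B).erase f := by
    rw [List.erase_append_right _ hfA, List.erase_append_right _ hfA, List.erase_cons_head,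
      List.erase_cons_tail (by simpa using hfg), List.erase_cons_head]
  have key : applyWtil a d b c (A ++ f :: g :: B) = applyWtil a d b c (A ++ g :: f :: B) := by
    refine applyWtil_congr ((List.mem_erase_of_ne hne.symm).2 hm')
      ((List.mem_erase_of_ne hne.symm).2 (hp.mem_iff.1 hm')) ?_
    rcases hf with rfl | rfl
    · rw [e0]
    · rw [List.erase_comm, e0, List.erase_comm]
  refine h.reach.trans ?_
  rw [key]
  exact h'.reach.symm

theorem reach_perm_aux {M : PolyLink} {P Q : R3} (hC : Ctx M P Q) {l : List Tooth}
    (h : Good (rest M P Q) P Q l) (hL : IsLink (state M P Q l)) {x y : PolyLink} (hxy : x.Perm y) :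
    ∀ A : PolyLink, (A ++ x).Perm (state M P Q l) → (∀ f ∈ x, f ∈ edgesOf P Q l) →
      Reach (A ++ x) (A ++ y) := by
  induction hxy with
  | nil => intro A _ _; exact Reach.refl _
  | cons f _ ih =>
    intro A hA hx
    have := ih (A ++ [f]) (by simpa using hA) (fun g hg => hx g (by simp [hg]))
    simpa using this
  | swap f g B =>
    intro A hA hx
    obtain ⟨a, d, b, c, hf, hne, hadm⟩ := exists_move hC h hL (hx g (by simp))
    have hA' : (A ++ f :: g :: B).Perm (state M P Q l) :=
      ((List.Perm.swap _ _ _).append_left _).trans hA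
    have hgm : g ∈ state M P Q l := hA.mem_iff.1 (by simp)
    have hsy : TauSymm (state M P Q l) := hC.symm_rest.append (symm_edgesOf P Q l)
    refine reach_swap hf hne (hadm _ hA) (hadm _ hA') (hA.mem_iff.2 ?_) (hA.mem_iff.2 ?_)
      (hA.nodup_iff.2 hL.1)
    · rcases hf with rfl | rfl
      · exact hgm
      · simpa using hsy _ hgm
    · rcases hf with rfl | rfl
      · simpa using hsy _ hgm
      · exact hgm
  | trans h1 h2 ih1 ih2 =>
    intro A hA hx
    exact (ih1 A hA hx).trans (ih2 A ((h1.symm.append_left _).trans hA)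
      (fun f hf => hx f (h1.mem_iff.2 hf)))

/-- A good family of teeth giving a link. -/
structure Nice (M : PolyLink) (P Q : R3) (l : List Tooth) : Prop where
  good : Good (rest M P Q) P Q l
  link : IsLink (state M P Q l)

theorem Nice.perm {M : PolyLink} {P Q : R3} {l l' : List Tooth} (h : Nice M P Q l)
    (hp : l.Perm l') : Nice M P Q l' := ⟨h.good.perm hp, h.link.perm (state_perm hp)⟩

/-- Two nice families of teeth give links related by moves, however the edges are listed. -/
structure Equi (M : PolyLink) (P Q : R3) (l l' : List Tooth) : Prop where
  nice : Nice M P Q l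
  nice' : Nice M P Q l'
  reach : ∀ x y : PolyLink, x.Perm (edgesOf P Q l) → y.Perm (edgesOf P Q l') →
    Reach (rest M P Q ++ x) (rest M P Q ++ y)

theorem Equi.symm {M : PolyLink} {P Q : R3} {l l' : List Tooth} (h : Equi M P Q l l') :
    Equi M P Q l' l := ⟨h.nice', h.nice, fun x y hx hy => (h.reach y x hy hx).symm⟩

theorem Equi.trans {M : PolyLink} {P Q : R3} {l l' l'' : List Tooth} (h : Equi M P Q l l')
    (h' : Equi M P Q l' l'') : Equi M P Q l l'' :=
  ⟨h.nice, h'.nice', fun x y hx hy => (h.reach x _ hx (List.Perm.refl _)).trans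
    (h'.reach _ y (List.Perm.refl _) hy)⟩

theorem Nice.equi_perm {M : PolyLink} {P Q : R3} (hC : Ctx M P Q) {l l' : List Tooth}
    (h : Nice M P Q l) (hp : l.Perm l') : Equi M P Q l l' := by
  refine ⟨h, h.perm hp, fun x y hx hy => ?_⟩
  have hxy : x.Perm y := hx.trans ((edgesOf_perm hp).trans hy.symm)
  exact reach_perm_aux hC h.good h.link hxy _ (hx.append_left _) (fun f hf => hx.mem_iff.1 hf)

theorem Equi.mirror {M : PolyLink} {P Q : R3} {l l' : List Tooth}
    (hC : Ctx M P Q) (h : Equi M P Q l l') :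
    Equi M (tau Q) (tau P) (l.map Tooth.mir) (l'.map Tooth.mir) := by
  have hN : ∀ {l}, Nice M P Q l → Nice M (tau Q) (tau P) (l.map Tooth.mir) := by
    intro l hl
    refine ⟨?_, hl.link.perm (state_mir M P Q l).symm⟩
    rw [rest_mirror]
    exact hl.good.mirror hC.symm_rest
  refine ⟨hN h.nice, hN h.nice', fun x y hx hy => ?_⟩
  rw [rest_mirror]
  exact h.reach x y (hx.trans (edgesOf_mir P Q l)) (hy.trans (edgesOf_mir P Q l'))

theorem applyE_append {a c b : R3} {A x : PolyLink} (h : (a, c) ∉ A) :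
    applyE a c b (A ++ x) = A ++ applyE a c b x := by
  unfold applyE; rw [List.erase_append_right _ h, List.append_assoc]

theorem applyWtil_append {a d b c : R3} {A x : PolyLink} (h1 : (a, d) ∉ A)
    (h2 : (tau d, tau a) ∉ A) (h3 : (b, d) ∉ A) (h4 : (tau d, tau b) ∉ A) :
    applyWtil a d b c (A ++ x) = A ++ applyWtil a d b c x := by
  unfold applyWtil applyEtil
  rw [applyE_append h1, applyE_append h2, applyE_append h3, applyE_append h4]

theorem Ctx.inner_not_mem {M : PolyLink} {P Q : R3} (hC : Ctx M P Q) {w : ℝ} (h0 : 0 < w)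
    (h1 : w < 1) (d : R3) : (pt P Q w, d) ∉ rest M P Q := by
  intro h
  have hm := hC.mem_rest.1 h
  have := hC.link.2.2.1 _ hC.mem _ hm.1 hm.2.1.symm (show pt P Q w ∈ _ from
    ⟨mem_seg.2 ⟨1 - w, w, by linarith, h0.le, by ring, rfl⟩, left_mem_segment _ _ _⟩)
  have hinj := pt_injective hC.neg
  rcases this.1 with h2 | h2
  · have := @hinj w 0 (by rw [pt_zero]; exact h2); linarith
  · have := @hinj w 1 (by rw [pt_one]; exact h2); linarith

theorem Equi.splitR {M : PolyLink} {P Q : R3} (hC : Ctx M P Q) {T T2 : Tooth} {r : List Tooth}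
    (hv : T2.v = T.v) (h : Nice M P Q (T :: r))
    (h2 : Good (rest M P Q) P Q ({T with v := T2.u} :: T2 :: r)) :
    Equi M P Q (T :: r) ({T with v := T2.u} :: T2 :: r) := by
  have hs := _root_.splitR hC hv h.good h2
  have hN : Nice M P Q ({T with v := T2.u} :: T2 :: r) := ⟨h2, hs.1.1 h.link⟩
  refine ⟨h, hN, fun x y hx hy => ?_⟩
  have hxs : (rest M P Q ++ x).Perm (state M P Q (T :: r)) := hx.append_left _
  obtain ⟨hadm, hperm⟩ := hs.2 _ hxs (h.link.perm hxs.symm)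
  have hrest : ∀ f ∈ edgesOf P Q (T :: r), f ∉ rest M P Q := by
    intro f hf hf'
    have := h.link.1
    rw [state, List.nodup_append] at this
    exact this.2.2 f hf' f hf rfl
  have hok1 := h2.ok {T with v := T2.u} (by simp)
  have hok2 := h2.ok T2 (by simp)
  have hw0 : 0 < T2.u := lt_of_le_of_lt hok1.u0 (hok1.us.trans hok1.sv)
  have hw1 : T2.u < 1 := lt_of_lt_of_le (hok2.us.trans hok2.sv) hok2.v1
  have hinner := hC.inner_not_mem hw0 hw1 (pt P Q T.v)
  rw [applyWtil_append (hrest _ (by simp [edgesOf_cons, Tooth.edges]))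
    (hrest _ (by simp [edgesOf_cons, Tooth.edges])) hinner
    (fun hm => hinner (by simpa using hC.symm_rest _ hm))] at hperm
  refine hadm.reach.trans ?_
  rw [applyWtil_append (hrest _ (by simp [edgesOf_cons, Tooth.edges]))
    (hrest _ (by simp [edgesOf_cons, Tooth.edges])) hinner
    (fun hm => hinner (by simpa using hC.symm_rest _ hm))]
  have hp' := (List.perm_append_left_iff _).1 hperm
  exact (hN.equi_perm hC (List.Perm.refl _)).reach _ _ hp' hy

theorem Equi.splitL {M : PolyLink} {P Q : R3} (hC : Ctx M P Q) {T T2 : Tooth} {r : List Tooth}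
    (hu : T2.u = T.u) (h : Nice M P Q (T :: r))
    (h2 : Good (rest M P Q) P Q ({T with u := T2.v} :: T2 :: r)) :
    Equi M P Q (T :: r) ({T with u := T2.v} :: T2 :: r) := by
  have hN : Nice M (tau Q) (tau P) ((T :: r).map Tooth.mir) :=
    ((h.equi_perm hC (List.Perm.refl _)).mirror hC).nice
  have hm := h2.mirror hC.symm_rest
  rw [← rest_mirror M P Q] at hm
  have := (Equi.splitR hC.mirror (T := T.mir) (T2 := T2.mir) (r := r.map Tooth.mir)
    (by simp [Tooth.mir, hu]) hN hm).mirror hC.mirror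
  simp only [tau_tau, List.map_cons, List.map_map] at this
  have e : Tooth.mir ∘ Tooth.mir = id := by
    funext T; simp
  rw [e, List.map_id] at this
  simpa [Tooth.mir] using this

theorem Equi.mergeR {M : PolyLink} {P Q : R3} (hC : Ctx M P Q) {T T2 : Tooth} {r : List Tooth}
    (hv : T2.v = T.v) (h : Good (rest M P Q) P Q (T :: r))
    (h2 : Nice M P Q ({T with v := T2.u} :: T2 :: r)) :
    Equi M P Q ({T with v := T2.u} :: T2 :: r) (T :: r) :=
  (Equi.splitR hC hv ⟨h, (_root_.splitR hC hv h h2.good).1.2 h2.link⟩ h2.good).symm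

theorem Equi.mergeL {M : PolyLink} {P Q : R3} (hC : Ctx M P Q) {T T2 : Tooth} {r : List Tooth}
    (hu : T2.u = T.u) (h : Good (rest M P Q) P Q (T :: r))
    (h2 : Nice M P Q ({T with u := T2.v} :: T2 :: r)) :
    Equi M P Q ({T with u := T2.v} :: T2 :: r) (T :: r) := by
  have hN := ((h2.equi_perm hC (List.Perm.refl _)).mirror hC).nice
  have hm := h.mirror hC.symm_rest
  rw [← rest_mirror M P Q] at hm
  have := (Equi.mergeR hC.mirror (T := T.mir) (T2 := T2.mir) (r := r.map Tooth.mir)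
    (by simp [Tooth.mir, hu]) hm hN).mirror hC.mirror
  simp only [tau_tau, List.map_cons, List.map_map] at this
  have e : Tooth.mir ∘ Tooth.mir = id := by
    funext T; simp
  rw [e, List.map_id] at this
  simpa [Tooth.mir] using this

/-- Build a good family from a cut of a tooth and a new tooth. -/
theorem Good.pair {B : PolyLink} {P Q : R3} {T T' : Tooth} {r : List Tooth}
    (hT : T.Ok) (hT' : T'.Ok) (hf : FreeOfT B P Q T) (hf' : FreeOfT B P Q T') (hs : Apart T T')
    (h1 : TauFreeT P Q T T) (h2 : TauFreeT P Q T T') (h3 : TauFreeT P Q T' T')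
    (hsr : ∀ R ∈ r, Apart T R) (hsr' : ∀ R ∈ r, Apart T' R)
    (htr : ∀ R ∈ r, TauFreeT P Q T R) (htr' : ∀ R ∈ r, TauFreeT P Q T' R)
    (hr : Good B P Q r) : Good B P Q (T :: T' :: r) where
  ok R hR := by
    simp only [List.mem_cons] at hR
    rcases hR with rfl | rfl | hR
    exacts [hT, hT', hr.ok R hR]
  free R hR := by
    simp only [List.mem_cons] at hR
    rcases hR with rfl | rfl | hR
    exacts [hf, hf', hr.free R hR]
  sep := by
    refine List.pairwise_cons.2 ⟨?_, List.pairwise_cons.2 ⟨hsr', hr.sep⟩⟩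
    intro R hR
    simp only [List.mem_cons] at hR
    rcases hR with rfl | hR
    exacts [hs, hsr R hR]
  tau R hR R' hR' := by
    simp only [List.mem_cons] at hR hR'
    rcases hR with rfl | rfl | hR <;> rcases hR' with rfl | rfl | hR'
    exacts [h1, h2, htr _ hR', h2.symm, h3, htr' _ hR', (htr _ hR).symm, (htr' _ hR).symm,
      hr.tau R hR R' hR']

theorem Good.tail {B : PolyLink} {P Q : R3} {T : Tooth} {r : List Tooth} (h : Good B P Q (T :: r)) :
    Good B P Q r :=
  ⟨fun R hR => h.ok R (by simp [hR]), fun R hR => h.free R (by simp [hR]),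
    (List.pairwise_cons.1 h.sep).2, fun R hR R' hR' => h.tau R (by simp [hR]) R' (by simp [hR'])⟩

theorem good_mid {M : PolyLink} {P Q : R3} (hC : Ctx M P Q) {T T' : Tooth} {r : List Tooth}
    (hG : Good (rest M P Q) P Q (T :: r)) (hG' : Good (rest M P Q) P Q (T' :: r)) (hu : T'.u = T.u)
    (hv : T'.v = T.v) {w : ℝ} (hw : T.s < w) (hw' : w < T'.s) (hh : T.h ≠ T'.h)
    (ht : TauFree P Q T.u w (T.tp P Q) w T.v (T'.tp P Q)) :
    Good (rest M P Q) P Q ({T with v := w} :: {T' with u := w} :: r) := by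
  have hD := hC.neg
  have hT := hG.ok T (by simp)
  have hT' := hG'.ok T' (by simp)
  have hwv : w < T.v := hv ▸ hw'.trans hT'.sv
  have huw : T.u < w := hT.us.trans hw
  have hs1 : slab P Q T.u w (T.tp P Q) ⊆ slab P Q T.u T.v (T.tp P Q) :=
    slab_mono hD hT.k0.le le_rfl huw.le hwv.le
  have hs2 : slab P Q w T'.v (T'.tp P Q) ⊆ slab P Q T'.u T'.v (T'.tp P Q) :=
    slab_mono hD hT'.k0.le (hu ▸ huw.le) (hv ▸ hwv.le) le_rfl
  have hp := List.pairwise_cons.1 hG.sep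
  have hp' := List.pairwise_cons.1 hG'.sep
  refine Good.pair ⟨hT.u0, hT.us, hw, hwv.le.trans hT.v1, hT.k0⟩
    ⟨hT.u0.trans huw.le, hw', hT'.sv, hT'.v1, hT'.k0⟩ ?_ ?_ ⟨hh, Or.inl le_rfl⟩ ?_ ?_ ?_ ?_ ?_
    ?_ ?_ hG.tail
  · exact (hG.free T (by simp)).mono hs1
  · exact (hG'.free T' (by simp)).mono hs2
  · exact (hG.tau T (by simp) T (by simp)).mono hs1 hs1
  · exact hv ▸ ht
  · exact (hG'.tau T' (by simp) T' (by simp)).mono hs2 hs2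
  · exact fun R hR => ⟨(hp.1 R hR).1, (hp.1 R hR).2.imp hwv.le.trans id⟩
  · exact fun R hR => ⟨(hp'.1 R hR).1, (hp'.1 R hR).2.imp id
      (fun h => h.trans (hu ▸ huw.le))⟩
  · exact fun R hR => (hG.tau T (by simp) R (by simp [hR])).mono hs1 subset_rfl
  · exact fun R hR => (hG'.tau T' (by simp) R (by simp [hR])).mono hs2 subset_rfl

/-- Replace a tooth by one with the same base and a star further to the right. -/
theorem Equi.swapRight {M : PolyLink} {P Q : R3} (hC : Ctx M P Q) {T T' : Tooth} {r : List Tooth}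
    (hN : Nice M P Q (T :: r)) (hG : Good (rest M P Q) P Q (T' :: r)) (hu : T'.u = T.u)
    (hv : T'.v = T.v) {w : ℝ} (hw : T.s < w) (hw' : w < T'.s) (hh : T.h ≠ T'.h)
    (ht : TauFree P Q T.u w (T.tp P Q) w T.v (T'.tp P Q)) : Equi M P Q (T :: r) (T' :: r) := by
  have hmid := good_mid hC hN.good hG hu hv hw hw' hh ht
  have h1 := Equi.splitR hC (T := T) (T2 := {T' with u := w}) hv hN hmid
  have h2 := h1.nice'.equi_perm hC (List.Perm.swap {T' with u := w} {T with v := w} r)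
  exact (h1.trans h2).trans (Equi.mergeL hC (T := T') (T2 := {T with v := w}) hu.symm hG h2.nice')

/-- Replace a tooth by one with the same base and a star further to the left. -/
theorem Equi.swapLeft {M : PolyLink} {P Q : R3} (hC : Ctx M P Q) {T T' : Tooth} {r : List Tooth}
    (hN : Nice M P Q (T :: r)) (hG : Good (rest M P Q) P Q (T' :: r)) (hu : T'.u = T.u)
    (hv : T'.v = T.v) {w : ℝ} (hw : T'.s < w) (hw' : w < T.s) (hh : T.h ≠ T'.h)
    (ht : TauFree P Q T.u w (T'.tp P Q) w T.v (T.tp P Q)) : Equi M P Q (T :: r) (T' :: r) := by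
  have hmid := good_mid hC hG hN.good hu.symm hv.symm hw hw' hh.symm (by rw [hu, hv]; exact ht)
  have h1 := Equi.splitL hC (T := T) (T2 := {T' with v := w}) hu hN
    (hmid.perm (List.Perm.swap _ _ r))
  have h2 := h1.nice'.equi_perm hC (List.Perm.swap {T' with v := w} {T with u := w} r)
  exact (h1.trans h2).trans (Equi.mergeR hC (T := T') (T2 := {T with u := w}) hv.symm hG h2.nice')

/-! ### Chains of moves -/

/-- A tooth which is good by itself. -/
structure Solo (B : PolyLink) (P Q : R3) (T : Tooth) : Prop where
  ok : T.Ok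
  free : FreeOfT B P Q T
  tauFree : TauFreeT P Q T T

/-- Two teeth which can occur together. -/
def Compat (P Q : R3) (T T' : Tooth) : Prop := Apart T T' ∧ TauFreeT P Q T T'

theorem Compat.symm {P Q : R3} {T T' : Tooth} (h : Compat P Q T T') : Compat P Q T' T :=
  ⟨h.1.symm, h.2.symm⟩

theorem good_iff {B : PolyLink} {P Q : R3} {l : List Tooth} :
    Good B P Q l ↔ (∀ T ∈ l, Solo B P Q T) ∧ l.Pairwise (Compat P Q) := by
  constructor
  · intro h
    refine ⟨fun T hT => ⟨h.ok T hT, h.free T hT, h.tau T hT T hT⟩, ?_⟩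
    exact h.sep.imp_of_mem fun hT hT' hs => ⟨hs, h.tau _ hT _ hT'⟩
  · rintro ⟨h1, h2⟩
    refine ⟨fun T hT => (h1 T hT).ok, fun T hT => (h1 T hT).free, h2.imp And.left, ?_⟩
    exact List.Pairwise.forall_of_forall_of_flip (R := TauFreeT P Q)
      (fun T hT => (h1 T hT).tauFree) (h2.imp And.right) (h2.imp fun h => h.2.symm)

theorem good_cons {B : PolyLink} {P Q : R3} {T : Tooth} {r : List Tooth} :
    Good B P Q (T :: r) ↔ Solo B P Q T ∧ (∀ R ∈ r, Compat P Q T R) ∧ Good B P Q r := by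
  simp only [good_iff, List.pairwise_cons, List.forall_mem_cons]
  tauto

/-- The data for replacing a tooth by another one with the same base. -/
structure Swappable (B : PolyLink) (P Q : R3) (T F : Tooth) : Prop where
  solo : Solo B P Q F
  u : F.u = T.u
  v : F.v = T.v
  s : T.s ≠ F.s
  h : T.h ≠ F.h
  tauFree : TauFreeT P Q T F

theorem Swappable.equi {M : PolyLink} {P Q : R3} (hC : Ctx M P Q) {T F : Tooth} {r : List Tooth}
    (hN : Nice M P Q (T :: r)) (hs : Swappable (rest M P Q) P Q T F)
    (hr : ∀ R ∈ r, Compat P Q F R) : Equi M P Q (T :: r) (F :: r) := by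
  have hD := hC.neg
  have hT := (good_cons.1 hN.good).1.ok
  have hF := hs.solo.ok
  have hG : Good (rest M P Q) P Q (F :: r) := good_cons.2 ⟨hs.solo, hr, hN.good.tail⟩
  have sub : ∀ {R : Tooth} {a b : ℝ}, R.Ok → R.u ≤ a → a ≤ b → b ≤ R.v →
      slab P Q a b (R.tp P Q) ⊆ slab P Q R.u R.v (R.tp P Q) :=
    fun hR h1 h2 h3 => slab_mono hD hR.k0.le h1 h2 h3
  have h1 := hs.u
  have h2 := hs.v
  rcases lt_or_gt_of_ne hs.s with h | h
  · refine Equi.swapRight hC hN hG hs.u hs.v (w := (T.s + F.s) / 2) (by linarith) (by linarith)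
      hs.h ?_
    have := hs.tauFree.mono (sub hT le_rfl (b := (T.s + F.s) / 2) ?_ ?_)
      (sub hF (a := (T.s + F.s) / 2) ?_ ?_ le_rfl)
    · rwa [hs.v] at this
    all_goals linarith [hT.us, hT.sv, hF.us, hF.sv]
  · refine Equi.swapLeft hC hN hG hs.u hs.v (w := (T.s + F.s) / 2) (by linarith) (by linarith)
      hs.h ?_
    have := hs.tauFree.symm.mono (sub hF le_rfl (b := (T.s + F.s) / 2) ?_ ?_)
      (sub hT (a := (T.s + F.s) / 2) ?_ ?_ le_rfl)
    · rwa [hs.u] at this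
    all_goals linarith [hT.us, hT.sv, hF.us, hF.sv]

theorem equi_swaps {M : PolyLink} {P Q : R3} (hC : Ctx M P Q) (pl : List (Tooth × Tooth)) :
    ∀ R : List Tooth, Nice M P Q (pl.map Prod.fst ++ R) →
      (∀ p ∈ pl, Swappable (rest M P Q) P Q p.1 p.2) →
      pl.Pairwise (fun p q => Compat P Q p.2 q.1 ∧ Compat P Q p.2 q.2) →
      (∀ p ∈ pl, ∀ r ∈ R, Compat P Q p.2 r) →
      Equi M P Q (pl.map Prod.fst ++ R) (pl.map Prod.snd ++ R) := by
  induction pl with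
  | nil => intro R hN _ _ _; exact hN.equi_perm hC (List.Perm.refl _)
  | cons p pl ih =>
    intro R hN hs hp hR
    have hp' := List.pairwise_cons.1 hp
    have h1 : Equi M P Q (p.1 :: (pl.map Prod.fst ++ R)) (p.2 :: (pl.map Prod.fst ++ R)) := by
      refine (hs p (by simp)).equi hC hN fun r hr => ?_
      rcases List.mem_append.1 hr with hr | hr
      · obtain ⟨q, hq, rfl⟩ := List.mem_map.1 hr
        exact (hp'.1 q hq).1
      · exact hR p (by simp) r hr
    have h2 := h1.nice'.equi_perm hC
      (List.perm_middle (l₁ := pl.map Prod.fst) (l₂ := R) (a := p.2)).symm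
    have h3 := ih (p.2 :: R) h2.nice' (fun q hq => hs q (by simp [hq])) hp'.2 (by
      intro q hq r hr
      rcases List.mem_cons.1 hr with rfl | hr
      · exact (hp'.1 q hq).2.symm
      · exact hR q (by simp [hq]) r hr)
    exact ((h1.trans h2).trans h3).trans (h3.nice'.equi_perm hC List.perm_middle)

/-- The teeth of `l` have consecutive bases filling `[x, y]`. -/
def Tiles : ℝ → ℝ → List Tooth → Prop
  | x, y, [] => x = y
  | x, y, t :: l => t.u = x ∧ t.u < t.v ∧ Tiles t.v y l

theorem tiles_append {x y : ℝ} {A B : List Tooth} :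
    Tiles x y (A ++ B) ↔ ∃ z, Tiles x z A ∧ Tiles z y B := by
  induction A generalizing x with
  | nil => simp [Tiles]
  | cons t A ih =>
    simp only [List.cons_append, Tiles, ih]
    constructor
    · rintro ⟨h1, h2, z, h3, h4⟩; exact ⟨z, ⟨h1, h2, h3⟩, h4⟩
    · rintro ⟨z, ⟨h1, h2, h3⟩, h4⟩; exact ⟨h1, h2, z, h3, h4⟩

theorem Tiles.le {x y : ℝ} {A : List Tooth} (h : Tiles x y A) : x ≤ y := by
  induction A generalizing x with
  | nil => exact le_of_eq h
  | cons t A ih => obtain ⟨rfl, h2, h3⟩ := h; exact h2.le.trans (ih h3)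

theorem Tiles.mem {x y : ℝ} {A : List Tooth} (h : Tiles x y A) {t : Tooth} (ht : t ∈ A) :
    x ≤ t.u ∧ t.u < t.v ∧ t.v ≤ y := by
  obtain ⟨A, B, rfl⟩ := List.append_of_mem ht
  obtain ⟨z, h1, rfl, h2, h3⟩ := tiles_append.1 h
  exact ⟨h1.le, h2, h3.le⟩

theorem Tiles.pairwise {x y : ℝ} {A : List Tooth} (h : Tiles x y A) :
    A.Pairwise (fun t t' => t.v ≤ t'.u) := by
  induction A generalizing x with
  | nil => exact List.Pairwise.nil
  | cons t A ih =>
    obtain ⟨rfl, h2, h3⟩ := h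
    exact List.pairwise_cons.2 ⟨fun t' ht' => (h3.mem ht').1, ih h3⟩

/-- The data for replacing a cut of the tooth `F` by the tile `t`. -/
structure Strippable (P Q : R3) (F t : Tooth) : Prop where
  h : F.h ≠ t.h
  left : F.u < t.u → F.s < t.u ∧ TauFree P Q F.u t.u (F.tp P Q) t.u t.v (t.tp P Q)
  eq : F.u = t.u → ∃ w, F.s < w ∧ w < t.s ∧ TauFree P Q F.u w (F.tp P Q) w t.v (t.tp P Q)

theorem equi_peel {M : PolyLink} {P Q : R3} (hC : Ctx M P Q) {F : Tooth} (ts : List Tooth) :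
    ∀ (x : ℝ) (R : List Tooth), Tiles F.u x ts → x ≤ F.v → Nice M P Q ({F with v := x} :: R) →
      (∀ t ∈ ts, Solo (rest M P Q) P Q t ∧ Strippable P Q F t) →
      ts.Pairwise (Compat P Q) → (∀ t ∈ ts, ∀ r ∈ R, Compat P Q t r) →
      Equi M P Q ({F with v := x} :: R) (ts ++ R) := by
  have hD := hC.neg
  induction ts using List.reverseRecOn with
  | nil =>
    intro x R ht hx hN
    have := (hN.good.ok {F with v := x} (by simp))
    have h1 := this.us.trans this.sv
    exact absurd (show F.u = x from ht) h1.ne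
  | append_singleton ts t ih =>
    intro x R ht hx hN hs hp hR
    obtain ⟨z, ht1, rfl, htuv, htx⟩ := tiles_append.1 ht
    have htx : t.v = x := htx
    subst htx
    obtain ⟨hsolo, hpeel⟩ := hs t (by simp)
    have hF := hN.good.ok {F with v := t.v} (by simp)
    obtain ⟨gF, gFR, gR⟩ := good_cons.1 hN.good
    rcases eq_or_lt_of_le ht1.le with he | hlt
    · obtain rfl : ts = [] := by
        cases ts with
        | nil => rfl
        | cons a ts => obtain ⟨h1, h2, h3⟩ := ht1; linarith [h3.le]
      obtain ⟨w, hw, hw', htw⟩ := hpeel.eq he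
      exact Equi.swapRight hC hN (good_cons.2 ⟨hsolo, hR t (by simp), gR⟩) he.symm rfl hw hw'
        hpeel.h htw
    · obtain ⟨hFs, htau⟩ := hpeel.left hlt
      have hsub : slab P Q F.u t.u (F.tp P Q) ⊆ slab P Q F.u t.v (F.tp P Q) :=
        slab_mono hD hF.k0.le le_rfl hlt.le htuv.le
      have hG : Good (rest M P Q) P Q ({F with v := t.u} :: t :: R) := by
        refine Good.pair ⟨hF.u0, hF.us, hFs, htuv.le.trans hF.v1, hF.k0⟩ hsolo.ok
          (gF.free.mono hsub) hsolo.free ⟨hpeel.h, Or.inl le_rfl⟩ (gF.tauFree.mono hsub hsub) htau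
          hsolo.tauFree ?_ (fun r hr => (hR t (by simp) r hr).1) ?_
          (fun r hr => (hR t (by simp) r hr).2) gR
        · exact fun r hr => ⟨(gFR r hr).1.1, (gFR r hr).1.2.imp htuv.le.trans id⟩
        · exact fun r hr => (gFR r hr).2.mono hsub subset_rfl
      have h1 := Equi.splitR hC (T := {F with v := t.v}) (T2 := t) rfl hN hG
      have hp' := List.pairwise_append.1 hp
      have h2 := ih t.u (t :: R) ht1 (htuv.le.trans hx) h1.nice' (fun a ha => hs a (by simp [ha]))
        hp'.1 (by
          intro a ha r hr
          rcases List.mem_cons.1 hr with rfl | hr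
          · exact hp'.2.2 a ha r (by simp)
          · exact hR a (by simp [ha]) r hr)
      simpa using h1.trans h2

/-- Replace each tooth by the tiles below it, from right to left. -/
theorem equi_blocks {M : PolyLink} {P Q : R3} (hC : Ctx M P Q) (bl : List (Tooth × List Tooth)) :
    ∀ R : List Tooth, Nice M P Q (bl.map Prod.fst ++ R) →
      (∀ b ∈ bl, Tiles b.1.u b.1.v b.2 ∧ ∀ t ∈ b.2, Strippable P Q b.1 t) →
      bl.Pairwise (fun b b' => ∀ t ∈ b'.2, Compat P Q t b.1) →
      (∀ t ∈ bl.flatMap Prod.snd ++ R, Solo (rest M P Q) P Q t) →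
      (bl.flatMap Prod.snd ++ R).Pairwise (Compat P Q) →
      Equi M P Q (bl.map Prod.fst ++ R) (bl.flatMap Prod.snd ++ R) := by
  induction bl using List.reverseRecOn with
  | nil => intro R hN _ _ _ _; exact hN.equi_perm hC (List.Perm.refl _)
  | append_singleton bl b ih =>
    intro R hN hb hp hs hT
    have hp' := List.pairwise_append.1 hp
    rw [List.flatMap_append, List.flatMap_singleton] at hs hT ⊢
    rw [List.map_append, List.map_singleton] at hN ⊢
    rw [List.append_assoc] at hT hN ⊢
    rw [List.append_assoc] at hs ⊢
    have h1 : Equi M P Q (bl.map Prod.fst ++ ([b.1] ++ R)) (b.1 :: (bl.map Prod.fst ++ R)) :=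
      hN.equi_perm hC List.perm_middle
    have hb1 := hb b (by simp)
    have hT2 := List.pairwise_append.1 (List.pairwise_append.1 hT).2.1
    have h2 : Equi M P Q (b.1 :: (bl.map Prod.fst ++ R)) (b.2 ++ (bl.map Prod.fst ++ R)) := by
      refine equi_peel hC b.2 b.1.v _ hb1.1 le_rfl h1.nice' (fun t ht => ⟨hs t (by simp [ht]),
        hb1.2 t ht⟩) hT2.1 ?_
      intro t ht r hr
      rcases List.mem_append.1 hr with hr | hr
      · obtain ⟨q, hq, rfl⟩ := List.mem_map.1 hr
        exact hp'.2.2 q hq b (by simp) t ht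
      · exact hT2.2.2 t ht r hr
    have h3 := h2.nice'.equi_perm hC (l' := bl.map Prod.fst ++ (b.2 ++ R)) (by
      rw [← List.append_assoc, ← List.append_assoc]
      exact List.perm_append_comm.append_right _)
    have h4 := ih (b.2 ++ R) h3.nice' (fun c hc => hb c (by simp [hc])) hp'.1 hs hT
    exact ((h1.trans h2).trans h3).trans h4

/-- Mutual position of segments towards points of the `z`-axis lying far out in direction `σ`. -/
structure High (P Q : R3) (σ : ℝ) : Prop where
  low : ∀ u v H u' v' h' : ℝ, 0 ≤ u' → u' ≤ v' → v' ≤ u → u ≤ v → v ≤ 1 → 0 < σ * H →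
    0 < σ * (H + h') → TauFree P Q u v (H • zhat) u' v' (h' • zhat)
  high : ∀ u v H u' v' h' : ℝ, 0 ≤ u → u ≤ v → v ≤ 1 → 0 ≤ u' → u' ≤ v' → v' ≤ 1 →
    0 < σ * H → 0 < σ * h' → TauFree P Q u v (H • zhat) u' v' (h' • zhat)

/-- A spike degenerated to the `z`-axis, free of the rest of the link. -/
structure Spike (B : PolyLink) (P Q : R3) (σ : ℝ) (t : Tooth) : Prop where
  wok : t.WOk
  s : t.s = (t.u + 3 * t.v) / 4
  k : t.k = 0
  free : FreeOfT B P Q t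
  h : 0 < σ * t.h

theorem eventually_list {α : Type*} {l : List α} {F : Filter ℝ} {p : α → ℝ → Prop}
    (h : ∀ a ∈ l, ∀ᶠ η in F, p a η) : ∀ᶠ η in F, ∀ a ∈ l, p a η := by
  have := (Filter.eventually_all_finite (l := F) (p := fun a η => p a η) l.finite_toSet).2 h
  exact this

/-- An auxiliary degenerate tooth `f` over the base of `T`, with apex projection close to the left
end of the first tile in `ts`. -/
structure Starter (T f : Tooth) (ts : List Tooth) : Prop where
  tiles : Tiles T.u T.v ts
  u : f.u = T.u
  v : f.v = T.v
  h : f.h = T.h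
  k : f.k = 0
  s : T.s ≠ f.s
  us : f.u < f.s
  sv : f.s < f.v
  mid : ∀ t ∈ ts, f.s < (t.u + t.v) / 2
  lt : ∀ t ∈ ts, f.u < t.u → f.s < t.u

theorem exists_starter {T : Tooth} {ts : List Tooth} (h : Tiles T.u T.v ts) (huv : T.u < T.v) :
    ∃ f, Starter T f ts := by
  cases ts with
  | nil => exact absurd h huv.ne
  | cons t ts =>
    obtain ⟨h1, h2, h3⟩ := h
    obtain ⟨s, hs1, hs2, hs3⟩ : ∃ s, t.u < s ∧ s < (t.u + t.v) / 2 ∧ T.s ≠ s := by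
      by_cases hc : T.s = (3 * t.u + t.v) / 4
      · exact ⟨(7 * t.u + t.v) / 8, by linarith, by linarith, by rw [hc]; intro h; linarith⟩
      · exact ⟨(3 * t.u + t.v) / 4, by linarith, by linarith, hc⟩
    have h4 := h3.le
    refine ⟨⟨T.u, T.v, s, T.h, 0⟩, ⟨h1, h2, h3⟩, rfl, rfl, rfl, rfl, hs3, ?_, ?_, ?_, ?_⟩
    · show T.u < s
      linarith
    · show s < T.v
      linarith
    · intro r hr
      rcases List.mem_cons.1 hr with rfl | hr
      · exact hs2
      · have := h3.mem hr
        show s < _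
        linarith
    · intro r hr hlt
      rcases List.mem_cons.1 hr with rfl | hr
      · exact absurd h1 hlt.ne'
      · have := h3.mem hr
        show s < _
        linarith

theorem exists_blocks : ∀ (l : List Tooth) (x y : ℝ) (tl : List Tooth), Tiles x y l → Tiles x y tl →
    (∀ T ∈ l, T.v ∈ tl.map Tooth.v) →
    ∃ tr : List (Tooth × Tooth × List Tooth), tr.map (fun b => b.1) = l ∧
      tr.flatMap (fun b => b.2.2) = tl ∧ ∀ b ∈ tr, Starter b.1 b.2.1 b.2.2
  | [], x, y, tl, h, h', _ => by
    cases tl with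
    | nil => exact ⟨[], rfl, rfl, by simp⟩
    | cons t tl =>
      have h1 : x = y := h
      have h2 := h'.mem (List.mem_cons_self (a := t) (l := tl))
      exfalso; linarith
  | T :: l, x, y, tl, h, h', hv => by
    obtain ⟨t, ht, htv⟩ := List.mem_map.1 (hv T List.mem_cons_self)
    obtain ⟨A, B, rfl⟩ := List.append_of_mem ht
    have e : A ++ t :: B = (A ++ [t]) ++ B := by simp
    rw [e] at h' hv ⊢
    obtain ⟨z, hA, hB⟩ := tiles_append.1 h'
    obtain ⟨z', -, hA2⟩ := tiles_append.1 hA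
    have hz : z = T.v := by
      have : t.v = z := hA2.2.2
      rw [← this, htv]
    subst hz
    obtain ⟨h1, h2, h3⟩ := h
    subst h1
    obtain ⟨tr, e1, e2, e3⟩ := exists_blocks l T.v y B h3 hB (by
      intro R hR
      have h5 := h3.mem hR
      have h4 := hv R (List.mem_cons_of_mem _ hR)
      rw [List.map_append, List.mem_append] at h4
      rcases h4 with h4 | h4
      · obtain ⟨r, hr, hrv⟩ := List.mem_map.1 h4
        have := hA.mem hr
        exfalso; linarith
      · exact h4)
    obtain ⟨f, hf⟩ := exists_starter hA h2
    refine ⟨(T, f, A ++ [t]) :: tr, by simp [e1], by simp [← e2], ?_⟩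
    intro b hb
    rcases List.mem_cons.1 hb with rfl | hb
    · exact hf
    · exact e3 b hb

theorem Tiles.map {g : Tooth → Tooth} (hu : ∀ t, (g t).u = t.u) (hv : ∀ t, (g t).v = t.v) :
    ∀ {l : List Tooth} {x y : ℝ}, Tiles x y l → Tiles x y (l.map g)
  | [], _, _, h => h
  | t :: l, x, y, h => by
    refine ⟨(hu t).trans h.1, ?_, ?_⟩
    · rw [hu, hv]; exact h.2.1
    · rw [hv]; exact Tiles.map hu hv h.2.2

theorem Starter.body_subset {P Q : R3} (hD : NegEdge (P, Q)) {T f : Tooth} {ts : List Tooth}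
    (hT : T.Ok) (hf : Starter T f ts) :
    slab P Q f.u f.v (f.tp P Q) ⊆ slab P Q T.u T.v (T.tp P Q) := by
  have h1 := hT.us
  have h2 := hT.sv
  unfold Tooth.tp
  rw [hf.k, hf.h, hf.u, hf.v, tip_zero]
  exact slab_zhat_subset hD hT.k0.le h1.le h2.le (h1.trans h2) le_rfl (h1.trans h2).le le_rfl

theorem Starter.wok {T f : Tooth} {ts : List Tooth} (hT : T.Ok) (hf : Starter T f ts) : f.WOk :=
  ⟨hf.u ▸ hT.u0, by rw [hf.u, hf.v]; exact hT.us.trans hT.sv, hf.v ▸ hT.v1, hf.k.ge⟩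

/-- The tooth over `t` used as target. -/
def Tooth.lift (t : Tooth) (η : ℝ) : Tooth := t.bump (1 + t.u) 1 η

theorem Tooth.tp_of_k {P Q : R3} {t : Tooth} (h : t.k = 0) : t.tp P Q = t.h • zhat := by
  rw [Tooth.tp, h, tip_zero]

theorem eventually_pos : ∀ᶠ η in 𝓝[>] (0:ℝ), 0 < η := eventually_mem_nhdsWithin

theorem Starter.swappable {M : PolyLink} {P Q : R3} (hC : Ctx M P Q) {T f : Tooth}
    {ts : List Tooth} (hT : Solo (rest M P Q) P Q T) (hf : Starter T f ts) :
    ∀ᶠ η in 𝓝[>] (0:ℝ), Swappable (rest M P Q) P Q T (f.bump 1 1 η) := by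
  have hw := hf.wok hT.ok
  have hb := hf.body_subset hC.neg hT.ok
  have e1 := eventually_freeOfT hC hw (FreeOf.mono hT.free hb) 1 1
  have e2 := eventually_tauFreeT hC hw hw (TauFree.mono hT.tauFree hb hb) 1 1 1 1
  have e3 := eventually_tauFreeT hC hT.ok.wOk hw (TauFree.mono hT.tauFree subset_rfl hb) 0 0 1 1
  filter_upwards [e1, e2, e3, eventually_pos] with η h1 h2 h3 h4
  rw [Tooth.bump_zero] at h3
  refine ⟨⟨⟨hw.u0, hf.us, hf.sv, hw.v1, ?_⟩, h1, h2⟩, hf.u, hf.v, hf.s, ?_, h3⟩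
  · simp only [Tooth.bump, hf.k]; linarith
  · simp only [Tooth.bump, hf.h]; linarith

theorem Starter.compat {M : PolyLink} {P Q : R3} (hC : Ctx M P Q) {T f T' f' : Tooth}
    {ts ts' : List Tooth} (hT : T.Ok) (hf : Starter T f ts) (hT' : T'.Ok) (hf' : Starter T' f' ts')
    (h : Compat P Q T T') :
    ∀ᶠ η in 𝓝[>] (0:ℝ), Compat P Q (f.bump 1 1 η) T' ∧
      Compat P Q (f.bump 1 1 η) (f'.bump 1 1 η) := by
  have hw := hf.wok hT
  have hw' := hf'.wok hT'
  have hb := hf.body_subset hC.neg hT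
  have hb' := hf'.body_subset hC.neg hT'
  have e2 := eventually_tauFreeT hC hw hw' (TauFree.mono h.2 hb hb') 1 1 1 1
  have e3 := eventually_tauFreeT hC hw hT'.wOk (TauFree.mono h.2 hb subset_rfl) 1 1 0 0
  have e4 := eventually_ne_bump (c := 1) (d := 0) h.1.1
  have e5 := eventually_ne_bump (c := 1) (d := 1) h.1.1
  filter_upwards [e2, e3, e4, e5] with η h2 h3 h4 h5
  rw [Tooth.bump_zero] at h3
  have hd := h.1.2
  refine ⟨⟨⟨?_, ?_⟩, h3⟩, ⟨⟨?_, ?_⟩, h2⟩⟩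
  · simp only [Tooth.bump, hf.h]; simpa using h4
  · simp only [Tooth.bump, hf.u, hf.v]; exact hd
  · simp only [Tooth.bump, hf.h, hf'.h]; exact h5
  · simp only [Tooth.bump, hf.u, hf.v, hf'.u, hf'.v]; exact hd

theorem Spike.solo {M : PolyLink} {P Q : R3} (hC : Ctx M P Q) {σ : ℝ} (hH : High P Q σ)
    {t : Tooth} (ht : Spike (rest M P Q) P Q σ t) :
    ∀ᶠ η in 𝓝[>] (0:ℝ), Solo (rest M P Q) P Q (t.lift η) := by
  have hw := ht.wok
  have e1 := eventually_freeOfT hC hw ht.free (1 + t.u) 1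
  have hl : TauFreeT P Q t t := by
    unfold TauFreeT
    rw [Tooth.tp_of_k ht.k]
    exact hH.high _ _ _ _ _ _ hw.u0 hw.uv.le hw.v1 hw.u0 hw.uv.le hw.v1 ht.h ht.h
  have e2 := eventually_tauFreeT hC hw hw hl (1 + t.u) 1 (1 + t.u) 1
  filter_upwards [e1, e2, eventually_pos] with η h1 h2 h4
  have := hw.uv
  refine ⟨⟨hw.u0, ?_, ?_, hw.v1, ?_⟩, h1, h2⟩
  · simp only [Tooth.lift, Tooth.bump, ht.s]; linarith
  · simp only [Tooth.lift, Tooth.bump, ht.s]; linarith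
  · simp only [Tooth.lift, Tooth.bump, ht.k]; linarith

theorem Spike.compat {M : PolyLink} {P Q : R3} (hC : Ctx M P Q) {σ : ℝ} (hH : High P Q σ)
    {t t' : Tooth} (ht : Spike (rest M P Q) P Q σ t) (ht' : Spike (rest M P Q) P Q σ t')
    (h : t.v ≤ t'.u) :
    ∀ᶠ η in 𝓝[>] (0:ℝ), Compat P Q (t.lift η) (t'.lift η) := by
  have hw := ht.wok
  have hw' := ht'.wok
  have hl : TauFreeT P Q t t' := by
    unfold TauFreeT
    rw [Tooth.tp_of_k ht.k, Tooth.tp_of_k ht'.k]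
    exact hH.high _ _ _ _ _ _ hw.u0 hw.uv.le hw.v1 hw'.u0 hw'.uv.le hw'.v1 ht.h ht'.h
  have e2 := eventually_tauFreeT hC hw hw' hl (1 + t.u) 1 (1 + t'.u) 1
  have e3 : ∀ᶠ η in 𝓝[>] (0:ℝ), t.h + η * (1 + t.u) ≠ t'.h + η * (1 + t'.u) := by
    by_cases hh : t.h = t'.h
    · filter_upwards [eventually_pos] with η h4 h5
      rw [hh] at h5
      have := hw.uv
      have : η * (1 + t.u) < η * (1 + t'.u) := mul_lt_mul_of_pos_left (by linarith) h4
      linarith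
    · exact eventually_ne_bump hh
  filter_upwards [e2, e3] with η h2 h3
  exact ⟨⟨h3, Or.inl h⟩, h2⟩

theorem Starter.strippable {M : PolyLink} {P Q : R3} (hC : Ctx M P Q) {σ : ℝ} (hH : High P Q σ)
    {T f t : Tooth} {ts : List Tooth} (hT : T.Ok) (hf : Starter T f ts) (ht : t ∈ ts)
    (hs : Spike (rest M P Q) P Q σ t) (h1 : 0 < σ * (t.h + T.h)) (h2 : T.h ≠ t.h) :
    ∀ᶠ η in 𝓝[>] (0:ℝ), Strippable P Q (f.bump 1 1 η) (t.lift η) := by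
  have hw := hf.wok hT
  have hws := hs.wok
  have hm := hf.mid t ht
  have huv := hws.uv
  have e1 : ∀ᶠ η in 𝓝[>] (0:ℝ), f.h + η * 1 ≠ t.h + η * (1 + t.u) := by
    rw [hf.h]; exact eventually_ne_bump h2
  have key : ∀ x : ℝ, f.u < x → t.u ≤ x → x < t.v → TauFree P Q f.u x (f.tp P Q) x t.v (t.tp P Q) := by
    intro x hx hx' hx2
    rw [Tooth.tp_of_k hf.k, Tooth.tp_of_k hs.k, hf.h]
    exact (hH.low _ _ _ _ _ _ hw.u0 hx.le le_rfl hx2.le hws.v1 hs.h h1).symm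
  have ev : ∀ x : ℝ, f.u < x → t.u ≤ x → x < t.v → ∀ᶠ η in 𝓝[>] (0:ℝ),
      TauFree P Q f.u x ((f.bump 1 1 η).tp P Q) x t.v ((t.lift η).tp P Q) := by
    intro x hx hx' hx2
    have hv := hws.v1
    exact eventually_tauFreeT hC (T := {f with v := x}) (T' := {t with u := x})
      ⟨hw.u0, hx, hx2.le.trans hv, hw.k0⟩ ⟨hws.u0.trans hx', hx2, hv, hws.k0⟩ (key x hx hx' hx2)
      1 1 (1 + t.u) 1
  have e2 : ∀ᶠ η in 𝓝[>] (0:ℝ), f.u < t.u →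
      TauFree P Q f.u t.u ((f.bump 1 1 η).tp P Q) t.u t.v ((t.lift η).tp P Q) := by
    by_cases hlt : f.u < t.u
    · filter_upwards [ev t.u hlt le_rfl huv] with η h _ using h
    · exact Eventually.of_forall fun η h => absurd h hlt
  have e3 : ∀ᶠ η in 𝓝[>] (0:ℝ), f.u = t.u →
      TauFree P Q f.u ((t.u + t.v) / 2) ((f.bump 1 1 η).tp P Q) ((t.u + t.v) / 2) t.v
        ((t.lift η).tp P Q) := by
    by_cases hlt : f.u = t.u
    · filter_upwards [ev ((t.u + t.v) / 2) (by linarith) (by linarith) (by linarith)] with η h _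
        using h
    · exact Eventually.of_forall fun η h => absurd h hlt
  filter_upwards [e1, e2, e3] with η h1 h2 h3
  refine ⟨h1, fun h => ⟨hf.lt t ht h, h2 h⟩, fun h => ⟨(t.u + t.v) / 2, hm, ?_, h3 h⟩⟩
  simp only [Tooth.lift, Tooth.bump, hs.s]; linarith

theorem Starter.compat_spike {M : PolyLink} {P Q : R3} (hC : Ctx M P Q) {σ : ℝ} (hH : High P Q σ)
    {T f t : Tooth} {ts : List Tooth} (hT : T.Ok) (hf : Starter T f ts) (hle : T.v ≤ t.u)
    (hs : Spike (rest M P Q) P Q σ t) (h1 : 0 < σ * (t.h + T.h)) (h2 : T.h ≠ t.h) :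
    ∀ᶠ η in 𝓝[>] (0:ℝ), Compat P Q (t.lift η) (f.bump 1 1 η) := by
  have hw := hf.wok hT
  have hws := hs.wok
  have hl : TauFreeT P Q t f := by
    unfold TauFreeT
    rw [Tooth.tp_of_k hf.k, Tooth.tp_of_k hs.k, hf.h, hf.v]
    refine hH.low _ _ _ _ _ _ hw.u0 ?_ hle hws.uv.le hws.v1 hs.h h1
    rw [← hf.v]; exact hw.uv.le
  have e2 := eventually_tauFreeT hC hws hw hl (1 + t.u) 1 1 1
  have e1 : ∀ᶠ η in 𝓝[>] (0:ℝ), t.h + η * (1 + t.u) ≠ f.h + η * 1 := by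
    rw [hf.h]; exact eventually_ne_bump h2.symm
  filter_upwards [e1, e2] with η h1 h2
  exact ⟨⟨h1, Or.inr (hf.v.trans_le hle)⟩, h2⟩

theorem eventually_equi {M : PolyLink} {P Q : R3} (hC : Ctx M P Q) {σ : ℝ} (hH : High P Q σ)
    {l tl : List Tooth} (hN : Nice M P Q l) (hl : Tiles 0 1 l) (htl : Tiles 0 1 tl)
    (hs : ∀ t ∈ tl, Spike (rest M P Q) P Q σ t)
    (hh : ∀ T ∈ l, ∀ t ∈ tl, 0 < σ * (t.h + T.h) ∧ T.h ≠ t.h)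
    (hv : ∀ T ∈ l, T.v ∈ tl.map Tooth.v) :
    ∀ᶠ η in 𝓝[>] (0:ℝ), Equi M P Q l (tl.map (fun t => t.lift η)) := by
  obtain ⟨tr, e1, e2, hst⟩ := exists_blocks l 0 1 tl hl htl hv
  obtain ⟨hsolo, hpw⟩ := good_iff.1 hN.good
  have mem1 : ∀ b ∈ tr, b.1 ∈ l := fun b hb => e1 ▸ List.mem_map_of_mem hb
  have mem2 : ∀ b ∈ tr, ∀ t ∈ b.2.2, t ∈ tl := fun b hb t ht =>
    e2 ▸ List.mem_flatMap.2 ⟨b, hb, ht⟩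
  have hok : ∀ b ∈ tr, b.1.Ok := fun b hb => (hsolo _ (mem1 b hb)).ok
  have ppw : tr.Pairwise (fun b b' => Compat P Q b.1 b'.1) := by
    rw [← e1, List.pairwise_map] at hpw; exact hpw
  have tpw : tr.Pairwise (fun b b' => b.1.v ≤ b'.1.u) := by
    have := hl.pairwise
    rw [← e1, List.pairwise_map] at this; exact this
  have a1 : ∀ᶠ η in 𝓝[>] (0:ℝ), ∀ b ∈ tr,
      Swappable (rest M P Q) P Q b.1 (b.2.1.bump 1 1 η) :=
    eventually_list fun b hb => (hst b hb).swappable hC (hsolo _ (mem1 b hb))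
  have a2 : ∀ᶠ η in 𝓝[>] (0:ℝ), ∀ b ∈ tr, ∀ b' ∈ tr, Compat P Q b.1 b'.1 →
      Compat P Q (b.2.1.bump 1 1 η) b'.1 ∧
        Compat P Q (b.2.1.bump 1 1 η) (b'.2.1.bump 1 1 η) :=
    eventually_list fun b hb => eventually_list fun b' hb' => by
      by_cases hc : Compat P Q b.1 b'.1
      · filter_upwards [(hst b hb).compat hC (hok b hb) (hok b' hb') (hst b' hb') hc] with η h _
          using h
      · exact Eventually.of_forall fun η h => absurd h hc
  have a3 : ∀ᶠ η in 𝓝[>] (0:ℝ), ∀ t ∈ tl, Solo (rest M P Q) P Q (t.lift η) :=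
    eventually_list fun t ht => (hs t ht).solo hC hH
  have a4 : ∀ᶠ η in 𝓝[>] (0:ℝ), ∀ t ∈ tl, ∀ t' ∈ tl, t.v ≤ t'.u →
      Compat P Q (t.lift η) (t'.lift η) :=
    eventually_list fun t ht => eventually_list fun t' ht' => by
      by_cases hc : t.v ≤ t'.u
      · filter_upwards [(hs t ht).compat hC hH (hs t' ht') hc] with η h _ using h
      · exact Eventually.of_forall fun η h => absurd h hc
  have a5 : ∀ᶠ η in 𝓝[>] (0:ℝ), ∀ b ∈ tr, ∀ t ∈ b.2.2,
      Strippable P Q (b.2.1.bump 1 1 η) (t.lift η) :=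
    eventually_list fun b hb => eventually_list fun t ht => by
      have hb' := hh _ (mem1 b hb) t (mem2 b hb t ht)
      exact (hst b hb).strippable hC hH (hok b hb) ht (hs t (mem2 b hb t ht)) hb'.1 hb'.2
  have a6 : ∀ᶠ η in 𝓝[>] (0:ℝ), ∀ b ∈ tr, ∀ t ∈ tl, b.1.v ≤ t.u →
      Compat P Q (t.lift η) (b.2.1.bump 1 1 η) :=
    eventually_list fun b hb => eventually_list fun t ht => by
      by_cases hc : b.1.v ≤ t.u
      · have hb' := hh _ (mem1 b hb) t ht
        filter_upwards [(hst b hb).compat_spike hC hH (hok b hb) hc (hs t ht) hb'.1 hb'.2]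
          with η h _ using h
      · exact Eventually.of_forall fun η h => absurd h hc
  filter_upwards [a1, a2, a3, a4, a5, a6] with η a1 a2 a3 a4 a5 a6
  have E1 : Equi M P Q l (tr.map (fun b => b.2.1.bump 1 1 η)) := by
    have := equi_swaps hC (tr.map (fun b => (b.1, b.2.1.bump 1 1 η))) []
      (by simpa [Function.comp_def, e1] using hN)
      (by
        intro p hp
        obtain ⟨b, hb, rfl⟩ := List.mem_map.1 hp
        exact a1 b hb)
      (by
        rw [List.pairwise_map]
        exact ppw.imp_of_mem fun hb hb' h => a2 _ hb _ hb' h)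
      (by simp)
    simpa [Function.comp_def, e1] using this
  have hfm : (tr.map (fun b => (b.2.1.bump 1 1 η, b.2.2.map (fun t => t.lift η)))).flatMap Prod.snd
      = tl.map (fun t => t.lift η) := by
    rw [List.flatMap_map, ← e2, List.map_flatMap]
  have E2 := equi_blocks hC (tr.map (fun b => (b.2.1.bump 1 1 η, b.2.2.map (fun t => t.lift η)))) []
    (by simpa [Function.comp_def] using E1.nice')
    (by
      intro p hp
      obtain ⟨b, hb, rfl⟩ := List.mem_map.1 hp
      refine ⟨?_, ?_⟩
      · have := (hst b hb).tiles
        rw [← (hst b hb).u, ← (hst b hb).v] at this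
        exact this.map (g := fun t => t.lift η) (fun _ => rfl) (fun _ => rfl)
      · intro t ht
        obtain ⟨t, ht0, rfl⟩ := List.mem_map.1 ht
        exact a5 b hb t ht0)
    (by
      rw [List.pairwise_map]
      refine tpw.imp_of_mem fun {b b'} hb hb' h t ht => ?_
      obtain ⟨t, ht0, rfl⟩ := List.mem_map.1 ht
      exact a6 b hb t (mem2 b' hb' t ht0) (h.trans ((hst b' hb').tiles.mem ht0).1))
    (by
      rw [hfm, List.append_nil]
      intro t ht
      obtain ⟨t, ht0, rfl⟩ := List.mem_map.1 ht
      exact a3 t ht0)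
    (by
      rw [hfm, List.append_nil, List.pairwise_map]
      exact htl.pairwise.imp_of_mem fun ht ht' h => a4 _ ht _ ht' h)
  rw [hfm, List.append_nil, List.append_nil] at E2
  refine E1.trans ?_
  simpa [Function.comp_def] using E2

theorem mem_slab_zhat {P Q : R3} {u v H : ℝ} {x : R3} (huv : u ≤ v)
    (hx : x ∈ slab P Q u v (H • zhat)) :
    ∃ s c : ℝ, u ≤ s ∧ s ≤ v ∧ 0 ≤ c ∧ c ≤ 1 ∧ x = (1 - c) • pt P Q s + (c * H) • zhat := by
  rw [← tip_zero P Q u H, mem_slab] at hx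
  obtain ⟨i, j, l, hi, hj, hl, hs, rfl⟩ := hx
  by_cases h0 : i + l = 0
  · have hi0 : i = 0 := by linarith
    have hl0 : l = 0 := by linarith
    have hj1 : j = 1 := by linarith
    exact ⟨u, 1, le_rfl, huv, by norm_num, le_rfl, by simp [hi0, hl0, hj1]⟩
  · have hpos : 0 < i + l := lt_of_le_of_ne (by linarith) (Ne.symm h0)
    refine ⟨(i * u + l * v) / (i + l), j, ?_, ?_, hj, by linarith, ?_⟩
    · rw [le_div_iff₀ hpos]; nlinarith
    · rw [div_le_iff₀ hpos]; nlinarith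
    · have hj' : 1 - j = i + l := by linarith
      rw [hj', pt, smul_add, smul_smul, smul_smul]
      congr 2
      · congr 1
        field_simp
        ring
      · congr 1
        field_simp
        ring
      · ring

theorem pt_mem_segment {P Q : R3} {s : ℝ} (h0 : 0 ≤ s) (h1 : s ≤ 1) : pt P Q s ∈ segment ℝ P Q :=
  ⟨1 - s, s, by linarith, h0, by ring, rfl⟩

theorem Ctx.end_of_inter {M : PolyLink} {P Q : R3} (hC : Ctx M P Q) {x : R3}
    (hx : x ∈ segment ℝ P Q) (hx' : tau x ∈ segment ℝ P Q) : (x = P ∨ x = Q) ∧ tau x = x := by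
  have h2 : x ∈ segment ℝ (tau Q) (tau P) := by
    rw [segment_symm, ← tau_tau x, tau_mem_seg]; exact hx'
  have := hC.link.2.2.1 _ hC.mem _ (hC.symm _ hC.mem) hC.ne ⟨hx, h2⟩
  obtain ⟨h3, h4⟩ := this
  simp only [mem_insert_iff, mem_singleton_iff] at h3 h4
  refine ⟨h3, ?_⟩
  have hne := hC.ne
  rcases h3 with rfl | rfl <;> rcases h4 with h4 | h4
  · exact absurd (by rw [← h4]; congr 1; rw [h4, tau_tau]) hne
  · exact h4.symm
  · exact h4.symm
  · exact absurd (by rw [← h4]; congr 1; rw [h4, tau_tau]) hne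

theorem tauFree_point {P Q : R3} (hD : NegEdge (P, Q)) {σ : ℝ}
    (hd : 0 ≤ (Q.1 - P.1) * (Q.2.1 - P.2.1))
    (hσ : ∀ s, 0 ≤ s → s ≤ 1 → (pt P Q s).1 = 0 → 0 ≤ σ * (pt P Q s).2.2)
    {s s' c c' H h' : ℝ} (hs' : 0 ≤ s') (hss : s' ≤ s) (hs : s ≤ 1) (hc : 0 ≤ c) (hc1 : c ≤ 1)
    (hc' : 0 ≤ c') (hc1' : c' ≤ 1) (hH : 0 < σ * H) (hHh : 0 < σ * (H + h'))
    (h : tau ((1 - c) • pt P Q s + (c * H) • zhat) = (1 - c') • pt P Q s' + (c' * h') • zhat) :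
    c = 0 ∧ c' = 0 := by
  obtain ⟨P1, P2, P3⟩ := P
  obtain ⟨Q1, Q2, Q3⟩ := Q
  simp only [NegEdge, cross2, proj, tau, pt, zhat, Prod.smul_mk, Prod.mk_add_mk, smul_eq_mul,
    Prod.mk.injEq] at hD hd hσ h
  obtain ⟨e1, e2, e3⟩ := h
  obtain ⟨m, hm⟩ : ∃ m, m = 1 - c := ⟨_, rfl⟩
  obtain ⟨m', hm'⟩ : ∃ m, m = 1 - c' := ⟨_, rfl⟩
  rw [← hm, ← hm'] at e1 e2 e3
  obtain ⟨a, ha⟩ : ∃ a, a = (1 - s) * P1 + s * Q1 := ⟨_, rfl⟩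
  obtain ⟨a', ha'⟩ : ∃ a, a = (1 - s') * P1 + s' * Q1 := ⟨_, rfl⟩
  have f1 : m * a + m' * a' = 0 := by rw [ha, ha']; linarith
  have f2 : (m' - m) * (P1 * Q2 - P2 * Q1) = -2 * (m * a * (Q2 - P2)) := by
    rw [ha]
    linear_combination (-(Q2 - P2)) * e1 + (Q1 - P1) * e2
  have m0 : 0 ≤ m := by linarith
  have m0' : 0 ≤ m' := by linarith
  have mpos : 0 < m := by
    rcases m0.eq_or_lt with h0 | h0
    · rw [← h0] at f2
      have : m' = 0 := by
        rcases mul_eq_zero.1 (show m' * (P1 * Q2 - P2 * Q1) = 0 by linarith) with h | h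
        · exact h
        · exact absurd h hD.ne
      have hc1 : c = 1 := by linarith
      have hc1' : c' = 1 := by linarith
      rw [← h0, this, hc1, hc1'] at e3
      have : H + h' = 0 := by linarith
      rw [this] at hHh; simp at hHh
    · exact h0
  have f3 : a * (m + m') = m' * ((s - s') * (Q1 - P1)) := by
    rw [ha, ha'] at f1
    rw [ha]; linear_combination f1
  have hmm : 0 < m + m' := by linarith
  have f4 : 0 ≤ a * (Q2 - P2) * (m + m') := by
    have : a * (Q2 - P2) * (m + m') = m' * (s - s') * ((Q1 - P1) * (Q2 - P2)) := by
      linear_combination (Q2 - P2) * f3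
    rw [this]
    exact mul_nonneg (mul_nonneg m0' (by linarith)) hd
  have f5 : 0 ≤ a * (Q2 - P2) := nonneg_of_mul_nonneg_left f4 hmm
  have f6 : m ≤ m' := by
    have : 0 ≤ m * (a * (Q2 - P2)) := mul_nonneg m0 f5
    by_contra hlt
    push Not at hlt
    have := mul_pos_of_neg_of_neg (sub_neg.2 hlt) hD
    nlinarith
  have hcc : c' ≤ c := by linarith
  have g := hσ ((m * s + m' * s') / (m + m')) (by
    have : 0 ≤ s := hs'.trans hss
    positivity) (by rw [div_le_one hmm]; nlinarith) (by
    have : (1 - (m * s + m' * s') / (m + m')) * P1 + (m * s + m' * s') / (m + m') * Q1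
      = (m * a + m' * a') / (m + m') := by
      rw [ha, ha']; field_simp; ring
    rw [this, f1, zero_div])
  have g2 : (m + m') * (σ * ((1 - (m * s + m' * s') / (m + m')) * P3
      + (m * s + m' * s') / (m + m') * Q3)) = - σ * (c * H + c' * h') := by
    have : (m + m') * (σ * ((1 - (m * s + m' * s') / (m + m')) * P3
      + (m * s + m' * s') / (m + m') * Q3)) =
      σ * (m * ((1 - s) * P3 + s * Q3) + m' * ((1 - s') * P3 + s' * Q3)) := by
      field_simp; ring
    rw [this]
    linear_combination (-σ) * e3
  have g3 : 0 ≤ - σ * (c * H + c' * h') := by rw [← g2]; positivity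
  have g4 : c = 0 := by
    by_contra hne
    have hcp : 0 < c := lt_of_le_of_ne hc (Ne.symm hne)
    have := mul_pos hcp hH
    have := mul_pos hcp hHh
    rcases le_total 0 (σ * h') with h0 | h0
    · have := mul_nonneg hc' h0
      linarith
    · have := mul_le_mul_of_nonpos_right hcc h0
      linarith
  exact ⟨g4, by linarith⟩

theorem exists_high {M : PolyLink} {P Q : R3} (hC : Ctx M P Q)
    (hd : 0 ≤ (Q.1 - P.1) * (Q.2.1 - P.2.1)) : ∃ σ : ℝ, (σ = 1 ∨ σ = -1) ∧ High P Q σ := by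
  have hD := hC.neg
  obtain ⟨σ, h1, hσ⟩ : ∃ σ : ℝ, (σ = 1 ∨ σ = -1) ∧
      ∀ s, 0 ≤ s → s ≤ 1 → (pt P Q s).1 = 0 → 0 ≤ σ * (pt P Q s).2.2 := by
    by_cases hc : ∀ s, 0 ≤ s → s ≤ 1 → (pt P Q s).1 = 0 → 0 ≤ 1 * (pt P Q s).2.2
    · exact ⟨1, Or.inl rfl, hc⟩
    · push Not at hc
      obtain ⟨s, -, -, h3, h4⟩ := hc
      refine ⟨-1, Or.inr rfl, fun r _ _ h5 => ?_⟩
      have : r = s := by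
        by_contra hne
        obtain ⟨P1, P2, P3⟩ := P
        obtain ⟨Q1, Q2, Q3⟩ := Q
        simp only [NegEdge, cross2, proj, pt, Prod.smul_mk, Prod.mk_add_mk, smul_eq_mul]
          at hD h3 h5
        have h6 : (r - s) * (Q1 - P1) = 0 := by linarith
        have h7 : Q1 - P1 = 0 := (mul_eq_zero.1 h6).resolve_left (sub_ne_zero.2 hne)
        have h8 : Q1 = P1 := by linarith
        rw [h8] at h5 hD
        have h9 : P1 = 0 := by linarith
        rw [h9] at hD
        simp at hD
      rw [this]; linarith
  refine ⟨σ, h1, ?_⟩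
  have key : ∀ {s s' c c' H h' : ℝ} {x : R3}, 0 ≤ s' → s' ≤ s → s ≤ 1 → 0 ≤ c → c ≤ 1 →
      0 ≤ c' → c' ≤ 1 → 0 < σ * H → 0 < σ * (H + h') → x = (1 - c) • pt P Q s + (c * H) • zhat →
      tau x = (1 - c') • pt P Q s' + (c' * h') • zhat → (x = P ∨ x = Q) ∧ tau x = x := by
    intro s s' c c' H h' x a1 a2 a3 a4 a5 a6 a7 a8 a9 hx hx'
    rw [hx] at hx'
    obtain ⟨rfl, rfl⟩ := tauFree_point hD hd hσ a1 a2 a3 a4 a5 a6 a7 a8 a9 hx'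
    simp only [sub_zero, one_smul, zero_mul, zero_smul, add_zero] at hx hx'
    rw [hx]
    refine hC.end_of_inter (pt_mem_segment (by linarith) a3) ?_
    rw [hx']; exact pt_mem_segment a1 (by linarith)
  constructor
  · intro u v H u' v' h' a1 a2 a3 a4 a5 a6 a7 x hx hx'
    obtain ⟨s, c, b1, b2, b3, b4, b5⟩ := mem_slab_zhat a4 hx
    obtain ⟨s', c', b1', b2', b3', b4', b5'⟩ := mem_slab_zhat a2 hx'
    exact key (by linarith) (by linarith) (by linarith) b3 b4 b3' b4' a6 a7 b5 b5'
  · intro u v H u' v' h' a1 a2 a3 a4 a5 a6 a7 a8 x hx hx'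
    obtain ⟨s, c, b1, b2, b3, b4, b5⟩ := mem_slab_zhat a2 hx
    obtain ⟨s', c', b1', b2', b3', b4', b5'⟩ := mem_slab_zhat a5 hx'
    rcases le_total s' s with hle | hle
    · exact key (by linarith) hle (by linarith) b3 b4 b3' b4' a7 (by linarith) b5 b5'
    · have := key (H := h') (h' := H) (x := tau x) (by linarith) hle (by linarith) b3' b4' b3 b4 a8
        (by linarith) b5' (by rw [tau_tau]; exact b5)
      rw [tau_tau] at this
      exact ⟨by rw [this.2]; exact this.1, this.2.symm⟩

theorem Spike.sub {B : PolyLink} {P Q : R3} (hD : NegEdge (P, Q)) {σ : ℝ} {t : Tooth}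
    (h : Spike B P Q σ t) {a b : ℝ} (ha : t.u ≤ a) (hab : a < b) (hb : b ≤ t.v) :
    Spike B P Q σ ⟨a, b, (a + 3 * b) / 4, t.h, 0⟩ where
  wok := ⟨h.wok.u0.trans ha, hab, hb.trans h.wok.v1, le_rfl⟩
  s := rfl
  k := rfl
  free := by
    have := h.free
    unfold FreeOfT at this ⊢
    rw [Tooth.tp_of_k h.k] at this
    rw [Tooth.tp_of_k rfl]
    refine this.mono ?_
    rw [← tip_zero P Q 0]
    exact slab_mono hD le_rfl ha hab.le hb
  h := h.h

theorem exists_refine {B : PolyLink} {P Q : R3} (hD : NegEdge (P, Q)) {σ p : ℝ} :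
    ∀ (tl : List Tooth) (x y : ℝ), Tiles x y tl → (∀ t ∈ tl, Spike B P Q σ t) → x < p → p ≤ y →
    ∃ tl', Tiles x y tl' ∧ (∀ t ∈ tl', Spike B P Q σ t) ∧ (∀ t ∈ tl', t.h ∈ tl.map Tooth.h) ∧
      tl.map Tooth.v ⊆ tl'.map Tooth.v ∧ p ∈ tl'.map Tooth.v
  | [], x, y, h, _, hx, hy => by
    have : x = y := h
    exfalso; linarith
  | t :: tl, x, y, h, hs, hx, hy => by
    obtain ⟨rfl, h1, h2⟩ := h
    have hst := hs t List.mem_cons_self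
    have hstl : ∀ r ∈ tl, Spike B P Q σ r := fun r hr => hs r (List.mem_cons_of_mem _ hr)
    rcases lt_trichotomy p t.v with hp | hp | hp
    · refine ⟨⟨t.u, p, (t.u + 3 * p) / 4, t.h, 0⟩ :: ⟨p, t.v, (p + 3 * t.v) / 4, t.h, 0⟩ :: tl,
        ⟨rfl, hx, rfl, hp, h2⟩, ?_, ?_, ?_, ?_⟩
      · simp only [List.forall_mem_cons]
        exact ⟨hst.sub hD le_rfl hx hp.le, hst.sub hD hx.le hp le_rfl, hstl⟩
      · simp only [List.forall_mem_cons, List.map_cons]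
        exact ⟨by simp, by simp, fun r hr => List.mem_cons_of_mem _ (List.mem_map_of_mem hr)⟩
      · simp only [List.map_cons]
        exact List.subset_cons_self _ _
      · simp
    · exact ⟨t :: tl, ⟨rfl, h1, h2⟩, hs, fun r hr => List.mem_map_of_mem hr, fun _ h => h,
        by simp [hp]⟩
    · obtain ⟨tl', a1, a2, a3, a4, a5⟩ := exists_refine hD tl t.v y h2 hstl hp hy
      refine ⟨t :: tl', ⟨rfl, h1, a1⟩, ?_, ?_, ?_, ?_⟩
      · simp only [List.forall_mem_cons]; exact ⟨hst, a2⟩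
      · simp only [List.forall_mem_cons, List.map_cons]
        exact ⟨by simp, fun r hr => List.mem_cons_of_mem _ (a3 r hr)⟩
      · simp only [List.map_cons]
        exact List.cons_subset_cons _ a4
      · exact List.mem_cons_of_mem _ a5

theorem exists_refine_list {B : PolyLink} {P Q : R3} (hD : NegEdge (P, Q)) {σ : ℝ}
    {x y : ℝ} : ∀ (ps : List ℝ) (tl : List Tooth), Tiles x y tl → (∀ t ∈ tl, Spike B P Q σ t) →
    (∀ p ∈ ps, x < p ∧ p ≤ y) →
    ∃ tl', Tiles x y tl' ∧ (∀ t ∈ tl', Spike B P Q σ t) ∧ (∀ t ∈ tl', t.h ∈ tl.map Tooth.h) ∧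
      tl.map Tooth.v ⊆ tl'.map Tooth.v ∧ ∀ p ∈ ps, p ∈ tl'.map Tooth.v
  | [], tl, h, hs, _ => ⟨tl, h, hs, fun _ hr => List.mem_map_of_mem hr, fun _ h => h, by simp⟩
  | p :: ps, tl, h, hs, hp => by
    obtain ⟨tl₁, a1, a2, a3, a4, a5⟩ := exists_refine hD tl x y h hs
      (hp p List.mem_cons_self).1 (hp p List.mem_cons_self).2
    obtain ⟨tl₂, b1, b2, b3, b4, b5⟩ := exists_refine_list hD ps tl₁ a1 a2
      (fun q hq => hp q (List.mem_cons_of_mem _ hq))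
    refine ⟨tl₂, b1, b2, ?_, fun q hq => b4 (a4 hq), ?_⟩
    · intro t ht
      obtain ⟨r, hr, e⟩ := List.mem_map.1 (b3 t ht)
      rw [← e]; exact a3 r hr
    · simp only [List.forall_mem_cons]
      exact ⟨b4 a5, b5⟩

theorem mem_slab_self {P Q : R3} {s H : ℝ} {x : R3} :
    x ∈ slab P Q s s (H • zhat) → ∃ c : ℝ, 0 ≤ c ∧ c ≤ 1 ∧
      x = (1 - c) • pt P Q s + (c * H) • zhat := by
  intro h
  obtain ⟨r, c, h1, h2, h3, h4, h5⟩ := mem_slab_zhat le_rfl h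
  have : r = s := le_antisymm h2 h1
  exact ⟨c, h3, h4, this ▸ h5⟩

theorem proj_pt_ne {P Q : R3} (hD : NegEdge (P, Q)) (s : ℝ) :
    ¬ ((pt P Q s).1 = 0 ∧ (pt P Q s).2.1 = 0) := by
  rintro ⟨h1, h2⟩
  obtain ⟨P1, P2, P3⟩ := P
  obtain ⟨Q1, Q2, Q3⟩ := Q
  simp only [NegEdge, cross2, proj, pt, Prod.smul_mk, Prod.mk_add_mk, smul_eq_mul] at hD h1 h2
  have : P1 * Q2 - P2 * Q1 = 0 := by
    linear_combination (Q2 - P2) * h1 - (Q1 - P1) * h2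
  linarith

theorem exists_forall_ne {α : Type*} [Inhabited α] {p : α → Prop}
    (h : ∀ a b, ¬ p a → ¬ p b → a = b) : ∃ a, ∀ b, b ≠ a → p b := by
  by_cases hc : ∃ a, ¬ p a
  · obtain ⟨a, ha⟩ := hc
    refine ⟨a, fun b hb => ?_⟩
    by_contra hb'
    exact hb (h b a hb' ha)
  · push Not at hc
    exact ⟨default, fun b _ => hc b⟩

/-- Near a point off the segment `f`, all but one choice of axis point gives a free triangle. -/
theorem local_free_off {P Q : R3} (hD : NegEdge (P, Q)) {f : R3 × R3}
    (hf : cross2 (proj f.1) (proj f.2) ≠ 0) {s : ℝ} (hs : pt P Q s ∉ segment ℝ f.1 f.2) :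
    ∃ H₀ : ℝ, ∀ H, H ≠ H₀ → ∀ᶠ p : ℝ × ℝ in 𝓝 (s, s),
      ∀ x ∈ slab P Q p.1 p.2 (H • zhat), x ∉ segment ℝ f.1 f.2 := by
  have cpt : Continuous (pt P Q) := by unfold pt; fun_prop
  obtain ⟨H₀, hH⟩ := exists_forall_ne
    (p := fun H : ℝ => ∀ x ∈ slab P Q s s (H • zhat), x ∉ segment ℝ f.1 f.2) (by
    intro H H' h h'
    push Not at h h'
    obtain ⟨x, hx, hxf⟩ := h
    obtain ⟨x', hx', hxf'⟩ := h'
    obtain ⟨c, c0, c1, rfl⟩ := mem_slab_self hx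
    obtain ⟨c', c0', c1', rfl⟩ := mem_slab_self hx'
    have hc : c ≠ 0 := by rintro rfl; simp at hxf; exact hs hxf
    obtain ⟨i, j, hi, hj, hij, e⟩ := hxf
    obtain ⟨i', j', hi', hj', hij', e'⟩ := hxf'
    have hi : i = 1 - j := by linarith
    have hi' : i' = 1 - j' := by linarith
    subst hi hi'
    have hp := proj_pt_ne hD s
    obtain ⟨⟨f1, f2, f3⟩, ⟨g1, g2, g3⟩⟩ := f
    generalize pt P Q s = A at *
    obtain ⟨a1, a2, a3⟩ := A
    simp only [cross2, proj, zhat, Prod.smul_mk, Prod.mk_add_mk, smul_eq_mul,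
      Prod.mk.injEq] at *
    obtain ⟨e1, e2, e3⟩ := e
    obtain ⟨e1', e2', e3'⟩ := e'
    have hj : j' = j := by
      have : (j' - j) * (f1 * g2 - f2 * g1) = 0 := by
        have : (j' - j) * (f1 * g2 - f2 * g1) = ((1 - j) * f1 + j * g1) * ((1 - j') * f2 + j' * g2)
          - ((1 - j) * f2 + j * g2) * ((1 - j') * f1 + j' * g1) := by ring
        rw [this, e1, e2, e1', e2']; ring
      have := (mul_eq_zero.1 this).resolve_right hf
      linarith
    subst hj
    have hcc : c = c' := by
      by_contra hne
      have h1 : (c - c') * a1 = 0 := by linarith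
      have h2 : (c - c') * a2 = 0 := by linarith
      exact hp ⟨(mul_eq_zero.1 h1).resolve_left (sub_ne_zero.2 hne),
        (mul_eq_zero.1 h2).resolve_left (sub_ne_zero.2 hne)⟩
    subst hcc
    have : c * (H - H') = 0 := by linarith
    have := (mul_eq_zero.1 this).resolve_left hc
    linarith)
  refine ⟨H₀, fun H hne => ?_⟩
  have := eventually_tri_disjoint (x₀ := (s, s)) (a := fun p : ℝ × ℝ => pt P Q p.1)
    (b := fun _ => H • zhat) (c := fun p => pt P Q p.2) (a' := fun _ => f.1) (b' := fun _ => f.2)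
    (c' := fun _ => f.2) (by fun_prop) (by fun_prop) (by fun_prop) (by fun_prop) (by fun_prop)
    (by fun_prop) (by
      intro x hx
      rw [← seg_eq_tri]
      exact hH H hne x hx)
  filter_upwards [this] with p hp x hx
  rw [seg_eq_tri]
  exact hp x hx

theorem cone_unique {O O' g : R3}
    (hlin : ∀ a b c : ℝ, a • O + b • O' + c • zhat = 0 → a = 0 ∧ b = 0 ∧ c = 0)
    (hng : ∀ i : ℝ, 0 ≤ i → g - O ≠ i • (O' - O)) :
    ∃ H₀ : ℝ, ∀ H, H ≠ H₀ → ∀ i j : ℝ, 0 ≤ i → 0 ≤ j →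
      g - O ≠ i • (O' - O) + j • (H • zhat - O) := by
  refine exists_forall_ne fun H H' h h' => ?_
  push Not at h h'
  obtain ⟨i, j, hi, hj, e⟩ := h
  obtain ⟨i', j', hi', hj', e'⟩ := h'
  have := hlin (- (i - i') - (j - j')) (i - i') (j * H - j' * H') (by
    have h0 : (i • (O' - O) + j • (H • zhat - O)) - (i' • (O' - O) + j' • (H' • zhat - O)) = 0 := by
      rw [← e, ← e', sub_self]
    rw [← h0]; module)
  obtain ⟨h1, h2, h3⟩ := this
  have hjj : j = j' := by linarith
  subst hjj
  have hj0 : j ≠ 0 := by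
    rintro rfl
    exact hng i hi (by simpa using e)
  have : j * (H - H') = 0 := by linarith
  have := (mul_eq_zero.1 this).resolve_left hj0
  linarith

theorem cone_free {O O' g : R3} {H : ℝ}
    (h : ∀ i j : ℝ, 0 ≤ i → 0 ≤ j → g - O ≠ i • (O' - O) + j • (H • zhat - O))
    {x : R3} (hx : x ∈ tri O g g) {r c : ℝ} (hr : 0 ≤ r) (hc : 0 ≤ c) (hc1 : c ≤ 1)
    (e : x = (1 - c) • pt O O' r + (c * H) • zhat) : x = O := by
  obtain ⟨i, j, hi, hj, hij, e'⟩ := mem_tri_vertex.1 hx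
  have h0 : (i + j) • (g - O) = ((1 - c) * r) • (O' - O) + c • (H • zhat - O) := by
    have : (i + j) • (g - O) = x - O := by rw [e']; module
    rw [this, e, pt]; module
  by_cases hp : i + j = 0
  · rw [e', ← add_smul, hp, zero_smul, add_zero]
  · exfalso
    have hpos : 0 < i + j := lt_of_le_of_ne (by linarith) (Ne.symm hp)
    refine h ((i + j)⁻¹ * ((1 - c) * r)) ((i + j)⁻¹ * c) ?_ (by positivity) ?_
    · have : 0 ≤ 1 - c := by linarith
      positivity
    · rw [mul_smul, mul_smul (i + j)⁻¹ c, ← smul_add, ← h0, smul_smul, inv_mul_cancel₀ hp, one_smul]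

/-- An edge of the rest of the link at an endpoint of `PQ` does not continue along `PQ`. -/
theorem not_along {O O' g : R3} (hg : g ≠ O) (hO' : O' ∉ tri O g g)
    (hi : ∀ x ∈ segment ℝ O O', x ∈ tri O g g → x = O ∨ x = O') (i : ℝ) (h0 : 0 ≤ i) :
    g - O ≠ i • (O' - O) := by
  intro e
  have hgt : g = O + i • (O' - O) := by rw [← e]; abel
  have gm : g ∈ tri O g g := by rw [← seg_eq_tri]; exact right_mem_segment ℝ O g
  rcases le_total i 1 with h1 | h1
  · have : g ∈ segment ℝ O O' := ⟨1 - i, i, by linarith, h0, by ring, by rw [hgt]; module⟩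
    rcases hi g this gm with h | h
    · exact hg h
    · exact hO' (h ▸ gm)
  · apply hO'
    rw [← seg_eq_tri]
    have hi0 : i ≠ 0 := by linarith
    refine ⟨1 - i⁻¹, i⁻¹, by have := inv_le_one_of_one_le₀ h1; linarith, by positivity, by ring, ?_⟩
    have : i⁻¹ • g = i⁻¹ • O + (O' - O) := by
      rw [hgt, smul_add, smul_smul, inv_mul_cancel₀ hi0, one_smul]
    rw [this]; module

theorem local_free_edge {M : PolyLink} {P Q : R3} (hC : Ctx M P Q) {f : R3 × R3}
    (hf : f ∈ rest M P Q) {s : ℝ} (h0 : 0 ≤ s) (h1 : s ≤ 1) :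
    ∃ H₀ : ℝ, ∀ H, H ≠ H₀ → ∀ᶠ p : ℝ × ℝ in 𝓝 (s, s), 0 ≤ p.1 → p.1 < p.2 → p.2 ≤ 1 →
      ∀ x ∈ slab P Q p.1 p.2 (H • zhat), x ∈ segment ℝ f.1 f.2 → x = P ∨ x = Q := by
  have hD := hC.neg
  have hf' := hC.mem_rest.1 hf
  by_cases hs : pt P Q s ∈ segment ℝ f.1 f.2
  · have hinner : ∀ x ∈ segment ℝ P Q, x ∈ segment ℝ f.1 f.2 → x = P ∨ x = Q := by
      intro x hx hx'
      simpa using (hC.link.2.2.1 _ hC.mem _ hf'.1 (Ne.symm hf'.2.1) ⟨hx, hx'⟩).1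
    rcases hinner _ (pt_mem_segment h0 h1) hs with hP | hP
    · rw [hP] at hs
      obtain ⟨g, hg, hseg, hQ⟩ := (hC.rest_end hf).1 hs
      rw [hseg] at hQ hinner ⊢
      obtain ⟨H₀, hH⟩ := cone_unique (fun a b c h => coord_zero hD h) (not_along hg hQ hinner)
      refine ⟨H₀, fun H hne => Eventually.of_forall fun p p0 p1 p2 x hx hxf => Or.inl ?_⟩
      obtain ⟨r, c, b1, b2, b3, b4, b5⟩ := mem_slab_zhat p1.le hx
      exact cone_free (hH H hne) hxf (p0.trans b1) b3 b4 b5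
    · rw [hP] at hs
      obtain ⟨g, hg, hseg, hQ⟩ := (hC.rest_end hf).2 hs
      rw [hseg] at hQ hinner ⊢
      obtain ⟨H₀, hH⟩ := cone_unique (O := Q) (O' := P)
        (fun a b c h => by
          have := coord_zero hD (a := b) (b := a) (c := c) (by rw [← h]; abel)
          exact ⟨this.2.1, this.1, this.2.2⟩)
        (not_along hg hQ (by
          intro x hx hx'
          rw [segment_symm] at hx
          exact (hinner x hx hx').symm))
      refine ⟨H₀, fun H hne => Eventually.of_forall fun p p0 p1 p2 x hx hxf => Or.inr ?_⟩
      obtain ⟨r, c, b1, b2, b3, b4, b5⟩ := mem_slab_zhat p1.le hx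
      refine cone_free (r := 1 - r) (hH H hne) hxf (by linarith) b3 b4 ?_
      rw [b5, pt, pt]; module
  · obtain ⟨H₀, hH⟩ := local_free_off hD (hC.gen f hf'.1) hs
    refine ⟨H₀, fun H hne => ?_⟩
    filter_upwards [hH H hne] with p hp _ _ _ x hx hx'
    exact absurd hx' (hp x hx)

theorem local_free {M : PolyLink} {P Q : R3} (hC : Ctx M P Q) {σ : ℝ} (hσ : σ = 1 ∨ σ = -1) (C : ℝ)
    {s : ℝ} (h0 : 0 ≤ s) (h1 : s ≤ 1) :
    ∃ H : ℝ, C < σ * H ∧ ∀ᶠ p : ℝ × ℝ in 𝓝 (s, s), 0 ≤ p.1 → p.1 < p.2 → p.2 ≤ 1 →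
      FreeOf (rest M P Q) P Q p.1 p.2 (H • zhat) := by
  have : ∀ f : R3 × R3, ∃ H₀ : ℝ, f ∈ rest M P Q → ∀ H, H ≠ H₀ → ∀ᶠ p : ℝ × ℝ in 𝓝 (s, s),
      0 ≤ p.1 → p.1 < p.2 → p.2 ≤ 1 →
      ∀ x ∈ slab P Q p.1 p.2 (H • zhat), x ∈ segment ℝ f.1 f.2 → x = P ∨ x = Q := by
    intro f
    by_cases hf : f ∈ rest M P Q
    · obtain ⟨H₀, h⟩ := local_free_edge hC hf h0 h1
      exact ⟨H₀, fun _ => h⟩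
    · exact ⟨0, fun h => absurd h hf⟩
  choose bad hbad using this
  have hinf : {H : ℝ | C < σ * H}.Infinite := by
    rcases hσ with rfl | rfl
    · have : {H : ℝ | C < 1 * H} = Ioi C := by ext H; simp
      rw [this]; exact Set.Ioi_infinite _
    · have : {H : ℝ | C < -1 * H} = Iio (-C) := by ext H; simp; constructor <;> intro h <;> linarith
      rw [this]; exact Set.Iio_infinite _
  obtain ⟨H, hH, hH'⟩ := (hinf.sdiff ((rest M P Q).map bad).finite_toSet).nonempty
  refine ⟨H, hH, ?_⟩
  have := (Filter.eventually_all_finite (l := 𝓝 (s, s)) (rest M P Q).finite_toSet).2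
    (fun f hf => hbad f hf H (fun e => hH' (by
      simp only [Set.mem_ofPred_eq]
      rw [e]; exact List.mem_map_of_mem hf)))
  filter_upwards [this] with p hp p0 p1 p2 x hx hx'
  obtain ⟨f, hf, hxf⟩ := mem_carrier.1 hx'
  exact hp f hf p0 p1 p2 x hx hxf

theorem exists_tiling {M : PolyLink} {P Q : R3} (hC : Ctx M P Q) {σ : ℝ} (hσ : σ = 1 ∨ σ = -1)
    {C : ℝ} (hC0 : 0 ≤ C) :
    ∃ tl, Tiles 0 1 tl ∧ ∀ t ∈ tl, Spike (rest M P Q) P Q σ t ∧ C < σ * t.h := by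
  have hloc : ∀ s : Icc (0:ℝ) 1, ∃ H ε : ℝ, C < σ * H ∧ 0 < ε ∧ ∀ a b : ℝ, 0 ≤ a → a < b → b ≤ 1 →
      dist a s < ε → dist b s < ε → FreeOf (rest M P Q) P Q a b (H • zhat) := by
    intro s
    obtain ⟨H, h1, h2⟩ := local_free hC hσ C s.2.1 s.2.2
    obtain ⟨ε, e1, e2⟩ := Metric.eventually_nhds_iff.1 h2
    refine ⟨H, ε, h1, e1, fun a b h3 h4 h5 h6 h7 => ?_⟩
    exact e2 (y := (a, b)) (by rw [Prod.dist_eq]; exact max_lt h6 h7) h3 h4 h5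
  choose H ε h1 h2 h3 using hloc
  obtain ⟨t, t0, tm, ⟨m, tM⟩, tc⟩ := exists_monotone_Icc_subset_open_cover_Icc (zero_le_one' ℝ)
    (c := fun s : Icc (0:ℝ) 1 => Metric.ball s (ε s)) (fun s => Metric.isOpen_ball)
    (fun s _ => mem_iUnion.2 ⟨s, Metric.mem_ball_self (h2 s)⟩)
  have main : ∀ n, ∃ tl, Tiles 0 (t n) tl ∧
      ∀ r ∈ tl, Spike (rest M P Q) P Q σ r ∧ C < σ * r.h := by
    intro n
    induction n with
    | zero => exact ⟨[], by show (0:ℝ) = t 0; rw [t0], by simp⟩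
    | succ n ih =>
      obtain ⟨tl, a1, a2⟩ := ih
      have hle : (t n : ℝ) ≤ t (n + 1) := tm (Nat.le_succ n)
      rcases hle.eq_or_lt with he | hlt
      · exact ⟨tl, he ▸ a1, a2⟩
      · obtain ⟨s, hs⟩ := tc n
        have d1 : dist (t n : ℝ) s < ε s := hs ⟨le_rfl, hle⟩
        have d2 : dist (t (n + 1) : ℝ) s < ε s := hs ⟨hle, le_rfl⟩
        have hfree := h3 s _ _ (t n).2.1 hlt (t (n + 1)).2.2 d1 d2
        refine ⟨tl ++ [⟨t n, t (n + 1), (t n + 3 * t (n + 1)) / 4, H s, 0⟩],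
          tiles_append.2 ⟨_, a1, ⟨rfl, hlt, ?_⟩⟩, ?_⟩
        · show (t (n + 1) : ℝ) = t (n + 1)
          rfl
        intro r hr
        rcases List.mem_append.1 hr with hr | hr
        · exact a2 r hr
        · rw [List.mem_singleton] at hr
          subst hr
          refine ⟨⟨⟨(t n).2.1, hlt, (t (n + 1)).2.2, le_rfl⟩, rfl, rfl, ?_, hC0.trans_lt (h1 s)⟩, h1 s⟩
          unfold FreeOfT
          rw [Tooth.tp_of_k rfl]
          exact hfree
  obtain ⟨tl, a1, a2⟩ := main m
  rw [tM m le_rfl] at a1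
  exact ⟨tl, a1, a2⟩

theorem exists_bound (l : List Tooth) : ∃ C : ℝ, 0 ≤ C ∧ ∀ T ∈ l, |T.h| ≤ C := by
  obtain ⟨C, hC⟩ := ((l.map fun T => |T.h|).finite_toSet).bddAbove
  exact ⟨max C 0, le_max_right _ _, fun T hT =>
    (hC (show |T.h| ∈ l.map fun T => |T.h| from List.mem_map_of_mem (f := fun T : Tooth => |T.h|) hT)).trans
      (le_max_left _ _)⟩

theorem equi_of_tiles_aux {M : PolyLink} {P Q : R3} (hC : Ctx M P Q)
    (hd : 0 ≤ (Q.1 - P.1) * (Q.2.1 - P.2.1)) {l l' : List Tooth} (hN : Nice M P Q l)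
    (hl : Tiles 0 1 l) (hN' : Nice M P Q l') (hl' : Tiles 0 1 l') : Equi M P Q l l' := by
  obtain ⟨σ, hσ, hH⟩ := exists_high hC hd
  obtain ⟨C, hC0, hb⟩ := exists_bound (l ++ l')
  obtain ⟨tl₀, ht₀, hs₀⟩ := exists_tiling hC hσ hC0
  have hpos : ∀ {l : List Tooth}, Tiles 0 1 l → ∀ T ∈ l, 0 < T.v ∧ T.v ≤ 1 := by
    intro l hl T hT
    have := hl.mem hT
    exact ⟨by linarith, this.2.2⟩
  obtain ⟨tl, ht, hs, hh, -, hv⟩ := exists_refine_list hC.neg ((l ++ l').map Tooth.v) tl₀ ht₀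
    (fun t h => (hs₀ t h).1) (by
      intro p hp
      obtain ⟨T, hT, rfl⟩ := List.mem_map.1 hp
      rcases List.mem_append.1 hT with hT | hT
      · exact hpos hl T hT
      · exact hpos hl' T hT)
  have hheight : ∀ T ∈ l ++ l', ∀ t ∈ tl, 0 < σ * (t.h + T.h) ∧ T.h ≠ t.h := by
    intro T hT t htl
    obtain ⟨t₀, h₀, e⟩ := List.mem_map.1 (hh t htl)
    have h1 := (hs₀ t₀ h₀).2
    have h2 := abs_le.1 (hb T hT)
    rw [e] at h1
    rcases hσ with rfl | rfl
    · exact ⟨by linarith, fun h => by linarith⟩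
    · exact ⟨by linarith, fun h => by linarith⟩
  have e1 := eventually_equi hC hH hN hl ht hs
    (fun T hT => hheight T (List.mem_append_left _ hT))
    (fun T hT => hv _ (List.mem_map_of_mem (List.mem_append_left _ hT)))
  have e2 := eventually_equi hC hH hN' hl' ht hs
    (fun T hT => hheight T (List.mem_append_right _ hT))
    (fun T hT => hv _ (List.mem_map_of_mem (List.mem_append_right _ hT)))
  obtain ⟨η, h1, h2⟩ := (e1.and e2).exists
  exact h1.trans h2.symm

theorem Tiles.mirror : ∀ {l : List Tooth} {x y : ℝ}, Tiles x y l →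
    Tiles (1 - y) (1 - x) (l.map Tooth.mir).reverse
  | [], x, y, h => by
    have h : x = y := h
    show 1 - y = 1 - x
    rw [h]
  | T :: l, x, y, h => by
    rw [List.map_cons, List.reverse_cons, tiles_append]
    refine ⟨1 - T.v, h.2.2.mirror, rfl, ?_, ?_⟩
    · show 1 - T.v < 1 - T.u
      linarith [h.2.1]
    · show 1 - T.u = 1 - x
      rw [h.1]

theorem equi_of_tiles {M : PolyLink} {P Q : R3} (hC : Ctx M P Q)
    {l l' : List Tooth} (hN : Nice M P Q l)
    (hl : Tiles 0 1 l) (hN' : Nice M P Q l') (hl' : Tiles 0 1 l') : Equi M P Q l l' := by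
  rcases le_total 0 ((Q.1 - P.1) * (Q.2.1 - P.2.1)) with hd | hd
  · exact equi_of_tiles_aux hC hd hN hl hN' hl'
  · have hmt : ∀ {l : List Tooth}, Tiles 0 1 l → Tiles 0 1 (l.map Tooth.mir).reverse := by
      intro l h
      simpa using h.mirror
    have hmn : ∀ {l : List Tooth}, Nice M P Q l → Nice M (tau Q) (tau P) (l.map Tooth.mir) :=
      fun h => ((h.equi_perm hC (List.Perm.refl _)).mirror hC).nice
    have hp : ∀ l : List Tooth, (l.map Tooth.mir).Perm (l.map Tooth.mir).reverse :=
      fun l => (List.reverse_perm _).symm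
    have hN1 := (hmn hN).equi_perm hC.mirror (hp l)
    have hN2 := (hmn hN').equi_perm hC.mirror (hp l')
    have E := equi_of_tiles_aux hC.mirror (by simp only [tau]; linarith) hN1.nice' (hmt hl)
      hN2.nice' (hmt hl')
    have := ((hN1.trans E).trans hN2.symm).mirror hC.mirror
    simpa [tau_tau, Function.comp_def] using this

/-- Moving along a direction leaving the positive orthant, one first meets its boundary. -/
theorem exists_exit {ι : Type*} [Fintype ι] {g c : ι → ℝ} (hg : ∀ i, 0 < g i) (hc : ∃ i, c i < 0) :
    ∃ r : ℝ, 0 < r ∧ (∀ i, 0 ≤ g i + r * c i) ∧ ∃ i, g i + r * c i = 0 := by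
  classical
  obtain ⟨i₀, hi₀, hmin⟩ := Finset.exists_min_image (Finset.univ.filter fun i => c i < 0)
    (fun i => g i / (- c i)) (by obtain ⟨i, hi⟩ := hc; exact ⟨i, by simpa using hi⟩)
  have h0 : c i₀ < 0 := by simpa using hi₀
  have hr : 0 < g i₀ / (- c i₀) := div_pos (hg i₀) (by linarith)
  refine ⟨g i₀ / (- c i₀), hr, fun i => ?_, i₀, ?_⟩
  · by_cases hi : c i < 0
    · have := hmin i (by simpa using hi)
      rw [le_div_iff₀ (by linarith)] at this
      linarith
    · have := mul_nonneg hr.le (not_lt.1 hi)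
      linarith [hg i]
  · have := h0.ne
    field_simp
    ring

/-- A plane and its mirror image share a direction. -/
theorem exists_common_direction {U V : R3}
    (h : ∀ a b : ℝ, a • U + b • V = 0 → a = 0 ∧ b = 0) :
    ∃ a b a' b' : ℝ, (a ≠ 0 ∨ b ≠ 0) ∧
      tau (a • U + b • V) = a' • U + b' • V := by
  have hni : ¬ LinearIndependent ℝ ![tau U, tau V, U, V] := by
    intro hli
    have := hli.fintype_card_le_finrank
    simp at this
  obtain ⟨w, hw, i, hi⟩ := Fintype.not_linearIndependent_iff.1 hni
  simp only [Fin.sum_univ_four, Matrix.cons_val_zero, Matrix.cons_val_one, Matrix.cons_val] at hw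
  have h1 : tau (w 0 • U + w 1 • V) = (- w 2) • U + (- w 3) • V := by
    rw [tau_add, tau_smul, tau_smul]
    rw [← sub_eq_zero, ← hw]
    module
  have h0 : ∀ a b : ℝ, a = 0 → b = 0 → a • U + b • V = 0 := by
    rintro a b rfl rfl; simp
  have t0 : tau 0 = 0 := by simp [tau]
  refine ⟨w 0, w 1, - w 2, - w 3, ?_, h1⟩
  by_contra hc
  push Not at hc
  rw [h0 _ _ hc.1 hc.2, t0] at h1
  obtain ⟨h2, h3⟩ := h _ _ h1.symm
  fin_cases i
  · exact hi hc.1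
  · exact hi hc.2
  · exact hi (neg_eq_zero.1 h2)
  · exact hi (neg_eq_zero.1 h3)

theorem tauFree_self {M : PolyLink} {P Q : R3} (hC : Ctx M P Q) {u v : ℝ} {q : R3} (hu : 0 ≤ u)
    (huv : u ≤ v) (hv : v ≤ 1) (hnc : NC (pt P Q u) q (pt P Q v))
    (h1 : ∀ x ∈ slab P Q u v q, tau x ∈ segment ℝ (pt P Q u) (pt P Q v) →
      x ∈ segment ℝ (pt P Q u) (pt P Q v))
    (h2 : ∀ x, x ∈ segment ℝ (pt P Q u) q ∨ x ∈ segment ℝ q (pt P Q v) →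
      tau x ∈ slab P Q u v q → tau x ∈ segment ℝ (pt P Q u) (pt P Q v)) :
    TauFree P Q u v q u v q := by
  have hsub : segment ℝ (pt P Q u) (pt P Q v) ⊆ segment ℝ P Q :=
    (convex_segment P Q).segment_subset (pt_mem_segment hu (huv.trans hv))
      (pt_mem_segment (hu.trans huv) hv)
  have hK : ∀ x ∈ slab P Q u v q, tau x ∈ slab P Q u v q →
      (x ∈ segment ℝ (pt P Q u) (pt P Q v) ∨ x ∈ segment ℝ (pt P Q u) q ∨
        x ∈ segment ℝ q (pt P Q v)) → (x = P ∨ x = Q) ∧ tau x = x := by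
    intro x hx hx' hb
    rcases hb with hb | hb
    · exact hC.end_of_inter (hsub hb) (hsub (h1 _ hx' (by rwa [tau_tau])))
    · have h3 := h2 x hb hx'
      exact hC.end_of_inter (hsub (h1 x hx h3)) (hsub h3)
  have hK' : ∀ x ∈ slab P Q u v q, tau x ∈ slab P Q u v q →
      (tau x ∈ segment ℝ (pt P Q u) (pt P Q v) ∨ tau x ∈ segment ℝ (pt P Q u) q ∨
        tau x ∈ segment ℝ q (pt P Q v)) → (x = P ∨ x = Q) ∧ tau x = x := by
    intro x hx hx' hb
    have := hK (tau x) hx' (by rwa [tau_tau]) hb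
    rw [tau_tau] at this
    exact ⟨by rw [this.2]; exact this.1, this.2.symm⟩
  generalize hA : pt P Q u = A at *
  generalize hB : pt P Q v = B at *
  have hsl : slab P Q u v q = tri A q B := by rw [slab, hA, hB]
  rw [hsl] at h1 h2 hK hK'
  have bdry : ∀ i j : ℝ, 0 ≤ i → 0 ≤ j → i + j ≤ 1 → (i = 0 ∨ j = 0 ∨ 1 - i - j = 0) →
      (A + (i • (q - A) + j • (B - A)) ∈ segment ℝ A B ∨
        A + (i • (q - A) + j • (B - A)) ∈ segment ℝ A q ∨
        A + (i • (q - A) + j • (B - A)) ∈ segment ℝ q B) := by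
    rintro i j hi hj hij (rfl | rfl | h)
    · exact Or.inl ⟨1 - j, j, by linarith, hj, by ring, by module⟩
    · exact Or.inr (Or.inl ⟨1 - i, i, by linarith, hi, by ring, by module⟩)
    · have hj' : j = 1 - i := by linarith
      subst hj'
      exact Or.inr (Or.inr ⟨i, 1 - i, hi, hj, by ring, by module⟩)
  have hlin : ∀ a b : ℝ, a • (q - A) + b • (B - A) = 0 → a = 0 ∧ b = 0 := by
    intro a b h
    have := hnc.coeff (i := 1 - a - b) (j := a) (k := b) (i' := 1) (j' := 0) (k' := 0) (by ring)
      (by ring) (by rw [← sub_eq_zero, ← h]; module)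
    exact ⟨this.2.1, this.2.2⟩
  obtain ⟨a, b, a', b', hab, hdir⟩ := exists_common_direction hlin
  intro x hx hx'
  rw [hsl] at hx hx'
  obtain ⟨i, j, hi, hj, hij, e⟩ := mem_tri_vertex.1 hx
  obtain ⟨i', j', hi', hj', hij', e'⟩ := mem_tri_vertex.1 hx'
  by_cases hb : i = 0 ∨ j = 0 ∨ 1 - i - j = 0
  · exact hK x hx hx' (by rw [e]; exact bdry i j hi hj hij hb)
  by_cases hb' : i' = 0 ∨ j' = 0 ∨ 1 - i' - j' = 0
  · exact hK' x hx hx' (by rw [e']; exact bdry i' j' hi' hj' hij' hb')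
  exfalso
  push Not at hb hb'
  have pos : ∀ {r : ℝ}, 0 ≤ r → r ≠ 0 → 0 < r := fun h h' => lt_of_le_of_ne h (Ne.symm h')
  have exit : ∀ ε : ℝ, ε ≠ 0 → ∃ r : ℝ, 0 < r ∧
      (x + (r * ε) • (a • (q - A) + b • (B - A)) = P ∨
        x + (r * ε) • (a • (q - A) + b • (B - A)) = Q) ∧
      tau (x + (r * ε) • (a • (q - A) + b • (B - A))) =
        x + (r * ε) • (a • (q - A) + b • (B - A)) := by
    intro ε hε
    obtain ⟨r, hr, hall, n, hn⟩ := exists_exit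
      (g := ![i, j, 1 - i - j, i', j', 1 - i' - j'])
      (c := ![ε * a, ε * b, ε * (-a - b), ε * a', ε * b', ε * (-a' - b')])
      (by
        intro n
        fin_cases n
        · exact pos hi hb.1
        · exact pos hj hb.2.1
        · exact pos (r := 1 - i - j) (by linarith) hb.2.2
        · exact pos hi' hb'.1
        · exact pos hj' hb'.2.1
        · exact pos (r := 1 - i' - j') (by linarith) hb'.2.2)
      (by
        by_contra hcon
        push Not at hcon
        have c0 : 0 ≤ ε * a := hcon 0
        have c1 : 0 ≤ ε * b := hcon 1
        have c2 : 0 ≤ ε * (-a - b) := hcon 2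
        have d0 : ε * a = 0 := by linarith
        have d1 : ε * b = 0 := by linarith
        rcases hab with h | h
        · exact h ((mul_eq_zero.1 d0).resolve_left hε)
        · exact h ((mul_eq_zero.1 d1).resolve_left hε))
    have k0 : 0 ≤ i + r * (ε * a) := hall 0
    have k1 : 0 ≤ j + r * (ε * b) := hall 1
    have k2 : 0 ≤ 1 - i - j + r * (ε * (-a - b)) := hall 2
    have k3 : 0 ≤ i' + r * (ε * a') := hall 3
    have k4 : 0 ≤ j' + r * (ε * b') := hall 4
    have k5 : 0 ≤ 1 - i' - j' + r * (ε * (-a' - b')) := hall 5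
    have f1 : x + (r * ε) • (a • (q - A) + b • (B - A)) =
        A + ((i + r * (ε * a)) • (q - A) + (j + r * (ε * b)) • (B - A)) := by
      rw [e]; module
    have f2 : tau (x + (r * ε) • (a • (q - A) + b • (B - A))) =
        A + ((i' + r * (ε * a')) • (q - A) + (j' + r * (ε * b')) • (B - A)) := by
      rw [tau_add, tau_smul, hdir, e']; module
    have m1 := mem_tri_vertex.2 ⟨_, _, k0, k1, by linarith, f1⟩
    have m2 := mem_tri_vertex.2 ⟨_, _, k3, k4, by linarith, f2⟩
    refine ⟨r, hr, ?_⟩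
    have hcase : (i + r * (ε * a) = 0 ∨ j + r * (ε * b) = 0 ∨
          1 - (i + r * (ε * a)) - (j + r * (ε * b)) = 0) ∨
        (i' + r * (ε * a') = 0 ∨ j' + r * (ε * b') = 0 ∨
          1 - (i' + r * (ε * a')) - (j' + r * (ε * b')) = 0) := by
      fin_cases n
      · exact Or.inl (Or.inl hn)
      · exact Or.inl (Or.inr (Or.inl hn))
      · refine Or.inl (Or.inr (Or.inr ?_))
        have hn : 1 - i - j + r * (ε * (-a - b)) = 0 := hn
        linarith
      · exact Or.inr (Or.inl hn)
      · exact Or.inr (Or.inr (Or.inl hn))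
      · refine Or.inr (Or.inr (Or.inr ?_))
        have hn : 1 - i' - j' + r * (ε * (-a' - b')) = 0 := hn
        linarith
    rcases hcase with hcase | hcase
    · exact hK _ m1 m2 (by rw [f1]; exact bdry _ _ k0 k1 (by linarith) hcase)
    · exact hK' _ m1 m2 (by rw [f2]; exact bdry _ _ k3 k4 (by linarith) hcase)
  obtain ⟨r, hr, hr1, hr2⟩ := exit 1 one_ne_zero
  obtain ⟨t, ht, ht1, ht2⟩ := exit (-1) (by norm_num)
  have hne : x + (r * 1) • (a • (q - A) + b • (B - A)) ≠ x + (t * -1) • (a • (q - A) + b • (B - A)) := by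
    intro h
    have h3 : (r + t) • (a • (q - A) + b • (B - A)) = 0 := by
      have := sub_eq_zero.2 h
      rw [← this]; module
    have h4 := (smul_eq_zero.1 h3).resolve_left (by linarith)
    have := hlin _ _ h4
    rcases hab with h | h
    · exact h this.1
    · exact h this.2
  rcases hr1 with hr1 | hr1 <;> rcases ht1 with ht1 | ht1 <;> rw [hr1, ht1] at hne <;>
    rw [hr1] at hr2 <;> rw [ht1] at ht2
  · exact hne rfl
  · exact hC.not_both_fixed hr2 ht2
  · exact hC.not_both_fixed ht2 hr2
  · exact hne rfl

theorem height_ne {P Q : R3} (hD : NegEdge (P, Q)) {T T' : Tooth} (hT : T.Ok) (hT' : T'.Ok)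
    (hle : T'.v ≤ T.u)
    (h : ∀ x ∈ T.body P Q, x ∈ segment ℝ (T'.tp P Q) (pt P Q T'.v) →
      x ∈ segment ℝ (pt P Q T.u) (pt P Q T.v)) : T'.h ≠ T.h := by
  intro hh
  obtain ⟨u, v, s, h₀, k⟩ := T
  obtain ⟨u', v', s', h₀', k'⟩ := T'
  obtain ⟨a1, a2, a3, a4, a5⟩ := hT
  obtain ⟨b1, b2, b3, b4, b5⟩ := hT'
  simp only [Tooth.body, Tooth.tp] at *
  subst hh
  have hden : 0 < (v - v') + k' * (v - s') := by
    have : 0 < v - v' := by linarith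
    have : 0 < k' * (v - s') := mul_pos b5 (by linarith)
    linarith
  obtain ⟨d, hd⟩ : ∃ d, d = (v - v') + k' * (v - s') := ⟨_, rfl⟩
  rw [← hd] at hden
  have hl0 : 0 < k' * (v' - s') := mul_pos b5 (by linarith)
  have hl1 : k' * (v' - s') < d := by
    rw [hd]
    have : k' * (v - s') = k' * (v - v') + k' * (v' - s') := by ring
    have : 0 < k' * (v - v') := mul_pos b5 (by linarith)
    linarith
  have hd0 := hden.ne'
  have hz := zhat_mem_slab (P := P) (Q := Q) (h := h₀') a2.le a3.le (a2.trans a3) a5.le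
  have hv : pt P Q v ∈ slab P Q u v (tip P Q s h₀' k) :=
    (pt_mem_slab_iff hD (a2.trans a3).le a5.le).2 ⟨(a2.trans a3).le, le_rfl⟩
  have hy := slab_convex P Q u v (tip P Q s h₀' k) hz hv
    (a := 1 - k' * (v' - s') / d) (b := k' * (v' - s') / d)
    (by rw [sub_nonneg, div_le_one hden]; exact hl1.le) (by positivity) (by ring)
  have hmem : (1 - k' * (v' - s') / d) • h₀' • zhat + (k' * (v' - s') / d) • pt P Q v ∈
      segment ℝ (tip P Q s' h₀' k') (pt P Q v') := by
    refine ⟨1 - k' * (v - s') / d, k' * (v - s') / d, ?_, ?_, by ring, ?_⟩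
    · rw [sub_nonneg, div_le_one hden, hd]; linarith
    · have : 0 < k' * (v - s') := mul_pos b5 (by linarith)
      positivity
    · have key : ∀ x y z w m n : ℝ, x • tip P Q s' h₀' k' + y • pt P Q v' =
          (y * (1 - v') - x * k' * (1 - s')) • P + (y * v' - x * k' * s') • Q +
            (x * (1 + k') * h₀') • zhat := by
        intros; simp only [tip, pt]; module
      have key2 : ∀ x y : ℝ, x • h₀' • zhat + y • pt P Q v =
          (y * (1 - v)) • P + (y * v) • Q + (x * h₀') • zhat := by
        intros; simp only [pt]; module
      rw [key _ _ 0 0 0 0, key2]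
      congr 2
      · congr 1
        field_simp
        rw [hd]; ring
      · congr 1
        field_simp
        rw [hd]; ring
      · field_simp
        rw [hd]; ring
  obtain ⟨x, y, -, -, hxy, e⟩ := h _ hy hmem
  have : (x * (1 - u) + y * (1 - v)) • P + (x * u + y * v) • Q + (0:ℝ) • zhat =
      (k' * (v' - s') / d * (1 - v)) • P + (k' * (v' - s') / d * v) • Q +
        ((1 - k' * (v' - s') / d) * h₀') • zhat := by
    have e1 : x • pt P Q u + y • pt P Q v =
        (x * (1 - u) + y * (1 - v)) • P + (x * u + y * v) • Q + (0:ℝ) • zhat := by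
      simp only [pt]; module
    rw [← e1, e]; simp only [pt]; module
  obtain ⟨c1, c2, -⟩ := coord_inj hD this
  have : k' * (v' - s') / d = 1 := by linarith
  rw [div_eq_one_iff_eq hd0] at this
  linarith

/-! ### The teeth of an admissible sawtooth move -/

/-- The bases of a family of teeth and their mirror images. -/
def pieces (P Q : R3) (l : List Tooth) : PolyLink :=
  l.flatMap fun T => [(pt P Q T.u, pt P Q T.v), (tau (pt P Q T.v), tau (pt P Q T.u))]

theorem pieces_cons (P Q : R3) (T : Tooth) (l : List Tooth) :
    pieces P Q (T :: l) =
      (pt P Q T.u, pt P Q T.v) :: (tau (pt P Q T.v), tau (pt P Q T.u)) :: pieces P Q l := rfl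

/-- The triangle move creating a tooth. -/
def Tooth.move (P Q : R3) (T : Tooth) : R3 × R3 × R3 := (pt P Q T.u, pt P Q T.v, T.tp P Q)

theorem Ctx.piece_not_mem {M : PolyLink} {P Q : R3} (hC : Ctx M P Q) {u v : ℝ} (hu : 0 ≤ u)
    (hu1 : u < 1) : (pt P Q u, pt P Q v) ∉ rest M P Q := by
  rcases hu.eq_or_lt with rfl | h0
  · rw [pt_zero]
    intro h
    obtain ⟨h1, h2, -⟩ := hC.mem_rest.1 h
    exact (((isLink_iff M).1 hC.link).2.1.forall h1 hC.mem h2).1 rfl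
  · exact hC.inner_not_mem h0 hu1 _

theorem applyEtil_piece {M : PolyLink} {P Q : R3} (hC : Ctx M P Q) {T : Tooth} (hT : T.Ok)
    {N D : List Tooth} {x : PolyLink} (hx : x.Perm (pieces P Q (T :: N) ++ edgesOf P Q D)) :
    ∃ x' y : PolyLink,
      applyE (pt P Q T.u) (pt P Q T.v) (T.tp P Q) (rest M P Q ++ x) = rest M P Q ++ x' ∧
      (pt P Q T.u, T.tp P Q) ∈ x' ∧ (T.tp P Q, pt P Q T.v) ∈ x' ∧
      applyEtil (pt P Q T.u) (pt P Q T.v) (T.tp P Q) (rest M P Q ++ x) = rest M P Q ++ y ∧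
      y.Perm (pieces P Q N ++ edgesOf P Q (T :: D)) := by
  have hu1 : T.u < 1 := hT.us.trans (hT.sv.trans_le hT.v1)
  have h1 := hC.piece_not_mem (v := T.v) hT.u0 hu1
  have h2 : (tau (pt P Q T.v), tau (pt P Q T.u)) ∉ rest M P Q := by
    intro h
    have := hC.symm_rest _ h
    simp only [tau_tau] at this
    exact h1 this
  refine ⟨applyE (pt P Q T.u) (pt P Q T.v) (T.tp P Q) x,
    applyEtil (pt P Q T.u) (pt P Q T.v) (T.tp P Q) x, applyE_append h1, ?_, ?_, ?_, ?_⟩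
  · simp [applyE]
  · simp [applyE]
  · rw [applyEtil, applyE_append h1, applyE_append h2]; rfl
  · have e1 := hx.erase (pt P Q T.u, pt P Q T.v)
    rw [pieces_cons, List.cons_append, List.erase_cons_head, List.cons_append] at e1
    have e2 := (e1.append_right
      [(pt P Q T.u, T.tp P Q), (T.tp P Q, pt P Q T.v)]).erase (tau (pt P Q T.v), tau (pt P Q T.u))
    rw [List.cons_append, List.erase_cons_head] at e2
    refine (e2.append_right _).trans ?_
    rw [edgesOf_cons, Tooth.edges, List.perm_iff_count]
    intro f
    simp only [List.count_append, List.count_cons, List.count_nil]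
    omega

/-- The constraints on a tooth imposed by the admissibility of its triangle move, performed after
those of the teeth in `D`. -/
structure Collected (M : PolyLink) (P Q : R3) (D : List Tooth) (T : Tooth) : Prop where
  free : FreeOfT (rest M P Q) P Q T
  self : TauFreeT P Q T T
  height : ∀ T' ∈ D, T'.h ≠ T.h

theorem collected_of_adm {M : PolyLink} {P Q : R3} (hC : Ctx M P Q) {T : Tooth} (hT : T.Ok)
    {N D : List Tooth} (hD : ∀ T' ∈ D, T'.Ok ∧ T'.v ≤ T.u) {x : PolyLink}
    (hx : x.Perm (pieces P Q (T :: N) ++ edgesOf P Q D))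
    (ha : AdmEtil (pt P Q T.u) (pt P Q T.v) (T.tp P Q) (rest M P Q ++ x)) :
    Collected M P Q D T := by
  obtain ⟨⟨-, ha1⟩, ⟨-, ha2⟩⟩ := ha
  obtain ⟨x', -, hx', m1, m2, -, -⟩ := applyEtil_piece hC hT hx
  rw [hx'] at ha2
  have huv := hT.us.trans hT.sv
  have key : ∀ z ∈ T.body P Q, z ∈ carrier (rest M P Q ++ x) →
      z ∈ segment ℝ (pt P Q T.u) (pt P Q T.v) := by
    intro z hz hz'
    rw [← ha1]
    exact ⟨hz, hz'⟩
  have hsub : segment ℝ (pt P Q T.u) (pt P Q T.v) ⊆ segment ℝ P Q :=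
    (convex_segment P Q).segment_subset (pt_mem_segment hT.u0 (huv.le.trans hT.v1))
      (pt_mem_segment (hT.u0.trans huv.le) hT.v1)
  refine ⟨?_, ?_, ?_⟩
  · intro z hz hz'
    have h1 := hsub (key z hz (by rw [carrier_append]; exact Or.inl hz'))
    obtain ⟨f, hf, hzf⟩ := mem_carrier.1 hz'
    obtain ⟨h2, h3, -⟩ := hC.mem_rest.1 hf
    exact ((((isLink_iff M).1 hC.link).2.1.forall hC.mem h2 h3.symm).2.2 z
      h1 hzf).1
  · refine tauFree_self hC hT.u0 huv.le hT.v1 (NC_slab hC.neg hT.k0.le huv.ne) ?_ ?_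
    · intro z hz hz'
      refine key z hz ?_
      rw [carrier_append, mem_union]
      refine Or.inr (mem_carrier.2 ⟨(tau (pt P Q T.v), tau (pt P Q T.u)), ?_, ?_⟩)
      · rw [hx.mem_iff, pieces_cons]; simp
      · rw [mem_seg_tau, segment_symm]; exact hz'
    · intro z hz hz'
      have : z ∈ segment ℝ (tau (pt P Q T.v)) (tau (pt P Q T.u)) := by
        rw [← ha2]
        refine ⟨?_, ?_⟩
        · rw [mem_tri_tau, tri_swap]; exact hz'
        · rw [carrier_append, mem_union]
          right
          rcases hz with hz | hz
          · exact mem_carrier.2 ⟨_, m1, hz⟩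
          · exact mem_carrier.2 ⟨_, m2, hz⟩
      rw [mem_seg_tau, segment_symm] at this
      exact this
  · intro T' hT'
    refine height_ne hC.neg hT (hD T' hT').1 (hD T' hT').2 fun z hz hz' => key z hz ?_
    rw [carrier_append, mem_union]
    refine Or.inr (mem_carrier.2 ⟨(T'.tp P Q, pt P Q T'.v), ?_, hz'⟩)
    rw [hx.mem_iff, List.mem_append]
    exact Or.inr (List.mem_flatMap.2 ⟨T', hT', by simp [Tooth.edges]⟩)

theorem collected_of_admSeq {M : PolyLink} {P Q : R3} (hC : Ctx M P Q) :
    ∀ (N D : List Tooth) (x : PolyLink), x.Perm (pieces P Q N ++ edgesOf P Q D) →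
      AdmEtilSeq (N.map (Tooth.move P Q)) (rest M P Q ++ x) → (∀ T ∈ N, T.Ok) → (∀ T ∈ D, T.Ok) →
      N.Pairwise (fun T T' => T.v ≤ T'.u) → (∀ T' ∈ D, ∀ T ∈ N, T'.v ≤ T.u) →
      (N ≠ [] ∨ IsLink (rest M P Q ++ x)) →
      ∃ y, applyEtilSeq (N.map (Tooth.move P Q)) (rest M P Q ++ x) = rest M P Q ++ y ∧
        y.Perm (edgesOf P Q (N ++ D)) ∧ IsLink (rest M P Q ++ y) ∧
        (∀ T ∈ N, Collected M P Q D T) ∧ N.Pairwise (fun T T' => T.h ≠ T'.h)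
  | [], D, x, hx, _, _, _, _, _, hL => by
    refine ⟨x, rfl, hx, hL.resolve_left (fun h => h rfl), by simp, List.Pairwise.nil⟩
  | T :: N, D, x, hx, ha, hN, hD, hp, hDN, _ => by
    obtain ⟨ha, ha'⟩ : AdmEtil (pt P Q T.u) (pt P Q T.v) (T.tp P Q) (rest M P Q ++ x) ∧
        AdmEtilSeq (N.map (Tooth.move P Q))
          (applyEtil (pt P Q T.u) (pt P Q T.v) (T.tp P Q) (rest M P Q ++ x)) := ha
    have hT := hN T List.mem_cons_self
    have hc := collected_of_adm hC hT
      (fun T' h => ⟨hD T' h, hDN T' h T List.mem_cons_self⟩) hx ha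
    obtain ⟨-, y, -, -, -, hy, hyp⟩ := applyEtil_piece hC hT hx
    have hlink : IsLink (rest M P Q ++ y) := by rw [← hy]; exact ha.2.1.2
    rw [hy] at ha'
    rw [List.pairwise_cons] at hp
    obtain ⟨z, h1, h2, h3, h4, h5⟩ := collected_of_admSeq hC N (T :: D) y hyp ha'
      (fun T' h => hN T' (List.mem_cons_of_mem _ h))
      (by
        intro T' h
        rcases List.mem_cons.1 h with rfl | h
        · exact hT
        · exact hD T' h) hp.2
      (by
        intro T' h T'' h''
        rcases List.mem_cons.1 h with rfl | h
        · exact hp.1 T'' h''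
        · exact hDN T' h T'' (List.mem_cons_of_mem _ h''))
      (Or.inr hlink)
    refine ⟨z, ?_, h2.trans (edgesOf_perm List.perm_middle), h3, ?_, ?_⟩
    · rw [← h1, ← hy]; rfl
    · intro T' h
      rcases List.mem_cons.1 h with rfl | h
      · exact hc
      · have := h4 T' h
        exact ⟨this.free, this.self, fun T'' h'' => this.height T'' (List.mem_cons_of_mem _ h'')⟩
    · exact List.pairwise_cons.2 ⟨fun T' h => (h4 T' h).height T List.mem_cons_self, h5⟩

theorem exists_tip {P Q : R3} (hD : NegEdge (P, Q)) {u v : ℝ} (huv : u < v) {q : R3}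
    (h1 : PosEdge (pt P Q u, q)) (h2 : PosEdge (q, pt P Q v)) :
    ∃ s h k, u < s ∧ s < v ∧ 0 < k ∧ tip P Q s h k = q := by
  have h3 : 0 < -cross2 (proj (pt P Q u)) (proj (pt P Q v)) := by
    rw [cross_pt]
    have : cross2 (proj P) (proj Q) < 0 := hD
    nlinarith
  unfold PosEdge at h1 h2
  obtain ⟨α, hα⟩ : ∃ α, α = cross2 (proj (pt P Q u)) (proj q) := ⟨_, rfl⟩
  obtain ⟨β, hβ⟩ : ∃ β, β = cross2 (proj q) (proj (pt P Q v)) := ⟨_, rfl⟩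
  obtain ⟨γ, hγ⟩ : ∃ γ, γ = -cross2 (proj (pt P Q u)) (proj (pt P Q v)) := ⟨_, rfl⟩
  simp only [← hα, ← hβ, ← hγ] at h1 h2 h3
  have hk : 0 < (α + β) / γ := by positivity
  have hab : α + β ≠ 0 := by positivity
  have hs : pt P Q ((β * u + α * v) / (α + β)) =
      (β / (α + β)) • pt P Q u + (α / (α + β)) • pt P Q v := by
    simp only [pt]
    have e1 : 1 - (β * u + α * v) / (α + β) =
        β / (α + β) * (1 - u) + α / (α + β) * (1 - v) := by field_simp; ring
    have e2 : (β * u + α * v) / (α + β) = β / (α + β) * u + α / (α + β) * v := by field_simp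
    rw [e1, e2]; module
  refine ⟨(β * u + α * v) / (α + β),
    (q.2.2 + (α + β) / γ * (pt P Q ((β * u + α * v) / (α + β))).2.2) / (1 + (α + β) / γ),
    (α + β) / γ, ?_, ?_, hk, ?_⟩
  · rw [lt_div_iff₀ (by positivity)]; nlinarith
  · rw [div_lt_iff₀ (by positivity)]; nlinarith
  · rw [tip, mul_div_cancel₀ _ (by positivity), hs]
    generalize pt P Q u = A at *
    generalize pt P Q v = B at *
    simp only [cross2, proj] at hα hβ hγ
    have hg := h3.ne'
    refine Prod.ext ?_ (Prod.ext ?_ ?_)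
    · simp only [zhat, Prod.fst_sub, Prod.smul_fst, Prod.fst_add, smul_eq_mul]
      field_simp
      rw [hα, hβ, hγ]; ring
    · simp only [zhat, Prod.fst_sub, Prod.snd_sub, Prod.smul_snd, Prod.smul_fst, Prod.snd_add,
        Prod.fst_add, smul_eq_mul]
      field_simp
      rw [hα, hβ, hγ]; ring
    · simp only [zhat, Prod.snd_sub, Prod.smul_snd, Prod.snd_add, smul_eq_mul]
      ring

theorem tiles_finRange : ∀ (m : ℕ) (T : Fin m → Tooth) (a : Fin (m + 1) → ℝ),
    (∀ i, (T i).u = a i.castSucc ∧ (T i).v = a i.succ ∧ a i.castSucc < a i.succ) →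
      Tiles (a 0) (a (Fin.last m)) ((List.finRange m).map T)
  | 0, _, _, _ => rfl
  | m + 1, T, a, h => by
    have ih := tiles_finRange m (fun i => T i.succ) (fun i => a i.succ) fun i => h i.succ
    rw [List.finRange_succ, List.map_cons, List.map_map]
    obtain ⟨h1, h2, h3⟩ := h 0
    refine ⟨h1, by rw [h1, h2]; exact h3, ?_⟩
    rw [h2]
    exact ih

theorem pieces_perm (P Q : R3) (l : List Tooth) :
    (l.map (fun T => (pt P Q T.u, pt P Q T.v)) ++
      l.map (fun T => (tau (pt P Q T.v), tau (pt P Q T.u)))).Perm (pieces P Q l) := by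
  induction l with
  | nil => exact List.Perm.nil
  | cons T l ih =>
    rw [pieces_cons]
    refine List.Perm.cons _ (List.perm_middle.trans (List.Perm.cons _ ih))

theorem Sawtooth.Adm.ne {S : Sawtooth} {M : PolyLink} (h : S.Adm M) :
    (S.p 0, S.p (Fin.last S.m)) ≠ (tau (S.p (Fin.last S.m)), tau (S.p 0)) := by
  intro heq
  obtain ⟨m, p, q⟩ := S
  obtain ⟨hm, -, -, -, -, -, -, ha, -⟩ := h
  simp only [Sawtooth.data] at hm ha heq
  obtain ⟨m, rfl⟩ := Nat.exists_eq_succ_of_ne_zero hm.ne'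
  rw [List.finRange_succ, List.map_cons] at ha
  have hl := ha.1.1.1.2
  rw [subdivide, applyE, List.erase_append_left _ (by
    refine List.mem_append.2 (Or.inr (List.mem_map.2 ⟨0, List.mem_finRange _, rfl⟩))),
    isLink_iff, List.pairwise_append, List.pairwise_append] at hl
  have := hl.2.1.2.2 (tau (p (Fin.last m).succ), tau (p (Fin.last m).castSucc))
    (List.mem_append_right _ (List.mem_map.2 ⟨Fin.last m, List.mem_finRange _, rfl⟩))
    (p (Fin.castSucc 0), q 0) (by simp)
  exact this.1 (congrArg Prod.fst heq).symm

theorem Sawtooth.Adm.nice {S : Sawtooth} {M : PolyLink} {P Q : R3} (hC : Ctx M P Q)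
    (h : S.Adm M) (he : S.e = (P, Q)) :
    ∃ l x, Nice M P Q l ∧ Tiles 0 1 l ∧ S.apply M = rest M P Q ++ x ∧ x.Perm (edgesOf P Q l) := by
  obtain ⟨hm, -, -, hinner, hneg, -, hpos, ha, hdis⟩ := h
  have hP : S.p 0 = P := congrArg Prod.fst he
  have hQ : S.p (Fin.last S.m) = Q := congrArg Prod.snd he
  have hex : ∀ i, ∃ a : ℝ, pt P Q a = S.p i ∧ 0 ≤ a ∧ a ≤ 1 := by
    intro i
    by_cases h0 : i = 0
    · exact ⟨0, by rw [h0, hP, pt_zero], le_rfl, zero_le_one⟩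
    by_cases h1 : i = Fin.last S.m
    · exact ⟨1, by rw [h1, hQ, pt_one], zero_le_one, le_rfl⟩
    have := hinner i h0 h1
    rw [hP, hQ] at this
    obtain ⟨b, a, hb, ha, hab, e⟩ := this
    refine ⟨a, ?_, ha.le, by linarith⟩
    rw [← e, pt, ← hab]; simp
  choose a hap ha0 ha1 using hex
  have hDn : cross2 (proj P) (proj Q) < 0 := hC.neg
  have hlt : ∀ i : Fin S.m, a i.castSucc < a i.succ := by
    intro i
    have := hneg i
    rw [← hap, ← hap, NegEdge, cross_pt] at this
    by_contra hc
    push Not at hc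
    nlinarith
  have htip : ∀ i : Fin S.m, ∃ s h k, a i.castSucc < s ∧ s < a i.succ ∧ 0 < k ∧
      tip P Q s h k = S.q i := by
    intro i
    obtain ⟨h1, h2⟩ := hpos i
    rw [← hap] at h1 h2
    exact exists_tip hC.neg (hlt i) h1 h2
  choose s h k hs1 hs2 hk hq using htip
  obtain ⟨T, hTdef⟩ : ∃ T : Fin S.m → Tooth,
      T = fun i => ⟨a i.castSucc, a i.succ, s i, h i, k i⟩ := ⟨_, rfl⟩
  have hTu : ∀ i, pt P Q (T i).u = S.p i.castSucc := fun i => by rw [hTdef]; exact hap _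
  have hTv : ∀ i, pt P Q (T i).v = S.p i.succ := fun i => by rw [hTdef]; exact hap _
  have hTq : ∀ i, (T i).tp P Q = S.q i := fun i => by rw [hTdef]; exact hq _
  have hOk : ∀ i, (T i).Ok := fun i => by
    rw [hTdef]; exact ⟨ha0 _, hs1 i, hs2 i, ha1 _, hk i⟩
  have ha00 : a 0 = 0 := pt_injective hC.neg (by rw [hap, hP, pt_zero])
  have ha11 : a (Fin.last S.m) = 1 := pt_injective hC.neg (by rw [hap, hQ, pt_one])
  have htiles : Tiles 0 1 ((List.finRange S.m).map T) := by
    rw [← ha00, ← ha11]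
    exact tiles_finRange _ _ _ fun i => by rw [hTdef]; exact ⟨rfl, rfl, hlt i⟩
  have hdata : S.data = ((List.finRange S.m).map T).map (Tooth.move P Q) := by
    rw [Sawtooth.data, List.map_map]
    refine List.map_congr_left fun i _ => ?_
    simp only [Function.comp_apply, Tooth.move, hTu, hTv, hTq]
  obtain ⟨x, hx, hsub⟩ : ∃ x, x.Perm (pieces P Q ((List.finRange S.m).map T)) ∧
      subdivide S.m S.p M = rest M P Q ++ x := by
    refine ⟨_, pieces_perm _ _ _, ?_⟩
    rw [subdivide, hP, hQ, List.append_assoc, List.map_map, List.map_map]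
    simp only [Function.comp_def, hTu, hTv]
    rfl
  have hne : (List.finRange S.m).map T ≠ [] := by
    intro hc
    have := congrArg List.length hc
    simp at this
    omega
  rw [hdata, hsub] at ha
  obtain ⟨y, h1, h2, h3, h4, h5⟩ := collected_of_admSeq hC _ [] x (by simpa [edgesOf] using hx) ha
    (by
      intro t ht
      obtain ⟨i, -, rfl⟩ := List.mem_map.1 ht
      exact hOk i) (by simp) htiles.pairwise (by simp) (Or.inl hne)
  rw [List.append_nil] at h2
  refine ⟨_, y, ⟨⟨?_, fun t ht => (h4 t ht).free, ?_, ?_⟩, ?_⟩, htiles, ?_, h2⟩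
  · intro t ht
    obtain ⟨i, -, rfl⟩ := List.mem_map.1 ht
    exact hOk i
  · exact (h5.and htiles.pairwise).imp fun h => ⟨h.1, Or.inl h.2⟩
  · intro t ht t' ht'
    obtain ⟨i, -, rfl⟩ := List.mem_map.1 ht
    obtain ⟨j, -, rfl⟩ := List.mem_map.1 ht'
    by_cases hij : i = j
    · subst hij
      exact (h4 _ ht).self
    · intro z hz hz'
      exfalso
      have hb : ∀ i, (T i).body P Q = S.tooth i := fun i => by
        rw [Tooth.body, slab, hTu, hTv, hTq, Sawtooth.tooth, tri_rot]
      have : z ∈ S.tooth i ∩ tau '' S.tooth j :=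
        ⟨by rw [← hb]; exact hz, tau z, by rw [← hb]; exact hz', tau_tau z⟩
      rw [hdis i j hij] at this
      exact this
  · exact h3.perm (h2.append_left _)
  · rw [Sawtooth.apply, hdata, hsub, h1]

/-- **Factorization of compositions of sawtooth moves** (Proposition `prop: sawtooth`):
if two admissible sawtooth moves are performed on the same negative edge `e`, then the
composition of one with the inverse of the other factorizes into admissible `R̃` and `W̃`
moves and their inverses. -/
theorem stmt_15 (M : PolyLink)
    (hM : IsLink M) (hSI : StronglyInvolutive M) (hGD : GoodDiagram M)
    (S1 S2 : Sawtooth) (h1 : S1.Adm M) (h2 : S2.Adm M) (he : S1.e = S2.e) :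
    Relation.ReflTransGen
      (fun X Y => RtilStep X Y ∨ RtilStep Y X ∨ AdmWtilStep X Y ∨ AdmWtilStep Y X)
      (S1.apply M) (S2.apply M) := by
  have hC : Ctx M (S1.p 0) (S1.p (Fin.last S1.m)) :=
    ⟨hM, hSI, hGD.1, h1.2.1, h1.2.2.1, h1.ne⟩
  obtain ⟨l, x, hN, hl, e, hx⟩ := h1.nice hC rfl
  obtain ⟨l', x', hN', hl', e', hx'⟩ := h2.nice hC he.symm
  rw [e, e']
  exact (equi_of_tiles hC hN hl hN' hl').reach x x' hx hx'

end
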